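/- Let G be a finite group whose character graph Δ(G) is K₄-free with exactly seven vertices, and let M be a normal subgroup of G with R(G) < M such that S := M/R(G) ≅ PSL₂(2^f) for some integer f ≥ 2, the centralizer of M/R(G) in G/R(G) is trivial, and the complement of the induced subgraph of Δ(G) on π(S) is not bipartite. If |π(2^f − 1)| = |π(2^f + 1)| = 2, then f ∈ {6, 9} or f is prime; moreover G ≅ S × R(G), ρ(R(G)) has exactly two elements, Δ(R(G)) is edgeless (hence disconnected), and Δ(G) ≅ (K₂ ∪ K₁ ∪ K₂) ⋆ K₂ᶜ. -/

import Mathlib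

open CategoryTheory

/-- `cd(G)`: the set of character degrees of `G`, i.e. the dimensions of the simple
finite-dimensional complex representations of `G`. -/
def charDegrees (G : Type) [Group G] : Set ℕ :=
  { n | ∃ V : FDRep ℂ G, Simple V ∧ Module.finrank ℂ V = n }

/-- `ρ(G)`: the set of primes dividing some character degree of `G`. -/
def charPrimes (G : Type) [Group G] : Set ℕ :=
  { p | p.Prime ∧ ∃ n ∈ charDegrees G, p ∣ n }

/-- The character graph `Δ(G)`, on vertex set `ρ(G)`: two distinct primes `p`, `q`
are adjacent iff `p * q` divides some character degree of `G`. -/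
def charGraph (G : Type) [Group G] : SimpleGraph (charPrimes G) where
  Adj p q := (p : ℕ) ≠ (q : ℕ) ∧ ∃ n ∈ charDegrees G, (p : ℕ) * (q : ℕ) ∣ n
  symm := by
    constructor
    rintro p q ⟨h, n, hn, hd⟩
    exact ⟨fun e => h e.symm, n, hn, by rwa [mul_comm]⟩
  loopless := by constructor; rintro p ⟨h, -⟩; exact h rfl

/-- The solvable radical `R(G)` of `G`: the largest solvable normal subgroup of `G`
(realized as the join of all solvable normal subgroups). -/
def solvableRadical (G : Type*) [Group G] : Subgroup G :=
  ⨆ N : { N : Subgroup G // N.Normal ∧ IsSolvable ↥N }, (N : Subgroup G)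

instance solvableRadical_normal (G : Type*) [Group G] : (solvableRadical G).Normal := by
  constructor
  intro n hn g
  refine Subgroup.iSup_induction (C := fun x => g * x * g⁻¹ ∈ solvableRadical G)
    (fun N : { N : Subgroup G // N.Normal ∧ IsSolvable ↥N } => (N : Subgroup G)) hn ?_ ?_ ?_
  · intro N x hx
    exact Subgroup.mem_iSup_of_mem N (N.2.1.conj_mem x hx g)
  · simpa using Subgroup.one_mem _
  · intro x y hx hy
    have h : g * (x * y) * g⁻¹ = (g * x * g⁻¹) * (g * y * g⁻¹) := by group
    rw [h]; exact Subgroup.mul_mem _ hx hy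

/-- `PSL₂(F)`: the special linear group `SL₂(F)` modulo its center. -/
abbrev PSL2 (F : Type) [Field F] :=
  Matrix.SpecialLinearGroup (Fin 2) F ⧸
    Subgroup.center (Matrix.SpecialLinearGroup (Fin 2) F)

/-- The join `Γ ⋆ Δ` of two simple graphs: the disjoint union together with all
edges between the two vertex sets. -/
def graphJoin {α β : Type*} (G : SimpleGraph α) (H : SimpleGraph β) :
    SimpleGraph (α ⊕ β) :=
  (G ⊕g H) ⊔
    { Adj := fun u v => u.isLeft ≠ v.isLeft
      symm := ⟨fun _ _ h => h.symm⟩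
      loopless := ⟨fun _ h => h rfl⟩ }

/-- The image of a subgroup `M` of `G` in `G/R(G)`; when `R(G) ≤ M` this is `M/R(G)`. -/
def radicalQuotImage {G : Type*} [Group G] (M : Subgroup G) :
    Subgroup (G ⧸ solvableRadical G) :=
  M.map (QuotientGroup.mk' (solvableRadical G))

set_option linter.unusedSimpArgs false
set_option linter.unusedSectionVars false

section ModA

section basics
variable {G : Type*} [Group G] {V W : Type*} [AddCommGroup V] [Module ℂ V] [AddCommGroup W] [Module ℂ W]

/-- invariant subspaces -/
def RInv (ρ : Representation ℂ G V) (p : Submodule ℂ V) : Prop := ∀ g, ∀ v ∈ p, ρ g v ∈ p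

/-- simple (sub)representations -/
def Simp (ρ : Representation ℂ G V) (p : Submodule ℂ V) : Prop :=
  p ≠ ⊥ ∧ RInv ρ p ∧ ∀ q ≤ p, RInv ρ q → q = ⊥ ∨ q = p

def Irr (ρ : Representation ℂ G V) : Prop := Simp ρ ⊤

theorem RInv.bot (ρ : Representation ℂ G V) : RInv ρ ⊥ := by
  intro g v hv; simp_all
theorem RInv.top (ρ : Representation ℂ G V) : RInv ρ ⊤ := fun _ _ _ => trivial
theorem RInv.inf {ρ : Representation ℂ G V} {p q : Submodule ℂ V} (hp : RInv ρ p) (hq : RInv ρ q) :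
    RInv ρ (p ⊓ q) := fun g v hv => ⟨hp g v hv.1, hq g v hv.2⟩

theorem exists_simp [FiniteDimensional ℂ V] (ρ : Representation ℂ G V) {p : Submodule ℂ V}
    (h0 : p ≠ ⊥) (hp : RInv ρ p) : ∃ q ≤ p, Simp ρ q := by
  obtain ⟨q, ⟨hq0, hqi, hqp⟩, hmin⟩ := WellFounded.has_min
    (wellFounded_lt (α := Submodule ℂ V)) {q | q ≠ ⊥ ∧ RInv ρ q ∧ q ≤ p} ⟨p, h0, hp, le_rfl⟩
  refine ⟨q, hqp, hq0, hqi, fun r hr hri => ?_⟩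
  by_contra! hh
  exact hmin r ⟨hh.1, hri, hr.trans hqp⟩ (lt_of_le_of_ne hr hh.2)

theorem maschke [Finite G] (ρ : Representation ℂ G V) {p : Submodule ℂ V} (hp : RInv ρ p) :
    ∃ q, RInv ρ q ∧ IsCompl p q := by
  have : NeZero (Nat.card G : ℂ) := ⟨by exact_mod_cast Nat.card_pos.ne'⟩
  let P : Subrepresentation ρ := ⟨p, fun g v hv => hp g v hv⟩
  obtain ⟨Q, hQ⟩ := exists_isCompl P
  refine ⟨Q.toSubmodule, fun g v hv => Q.apply_mem_toSubmodule g hv, ?_⟩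
  constructor
  · rw [disjoint_iff]
    have := hQ.inf_eq_bot
    have h2 := congrArg Subrepresentation.toSubmodule this
    rw [Subrepresentation.toSubmodule_inf] at h2
    exact h2
  · rw [codisjoint_iff]
    have := hQ.sup_eq_top
    have h2 := congrArg Subrepresentation.toSubmodule this
    rw [Subrepresentation.toSubmodule_sup] at h2
    exact h2

/-- restriction of a representation to an invariant subspace -/
def subrep (ρ : Representation ℂ G V) (p : Submodule ℂ V) (hp : RInv ρ p) : Representation ℂ G p where
  toFun g := (ρ g).restrict (hp g)
  map_one' := by ext; simp
  map_mul' g h := by ext; simp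

@[simp] theorem subrep_coe (ρ : Representation ℂ G V) (p : Submodule ℂ V) (hp : RInv ρ p) (g : G) (v : p) :
    ((subrep ρ p hp g v : p) : V) = ρ g v := rfl

theorem Irr.of_forall {ρ : Representation ℂ G V} [Nontrivial V]
    (h : ∀ q, RInv ρ q → q = ⊥ ∨ q = ⊤) : Irr ρ :=
  ⟨top_ne_bot, RInv.top ρ, fun q _ hq => h q hq⟩

theorem Irr.eq {ρ : Representation ℂ G V} (h : Irr ρ) {q : Submodule ℂ V} (hq : RInv ρ q) (h0 : q ≠ ⊥) : q = ⊤ :=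
  (h.2.2 q le_top hq).resolve_left h0

theorem Irr.nontrivial {ρ : Representation ℂ G V} (h : Irr ρ) : Nontrivial V := by
  by_contra hn
  rw [not_nontrivial_iff_subsingleton] at hn
  exact h.1 (Subsingleton.elim _ _)

theorem Simp.irr {ρ : Representation ℂ G V} {p : Submodule ℂ V} (h : Simp ρ p) : Irr (subrep ρ p h.2.1) := by
  have : Nontrivial p := Submodule.nontrivial_iff_ne_bot.2 h.1
  refine Irr.of_forall fun q hq => ?_
  have : RInv ρ (q.map p.subtype) := by
    rintro g _ ⟨v, hv, rfl⟩
    exact ⟨_, hq g v hv, rfl⟩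
  rcases h.2.2 _ (Submodule.map_subtype_le p q) this with h1 | h1
  · left; exact Submodule.map_injective_of_injective p.injective_subtype (by rw [h1, Submodule.map_bot])
  · right
    apply Submodule.map_injective_of_injective p.injective_subtype
    rw [h1]; simp

theorem RInv.map {ρ : Representation ℂ G V} {σ : Representation ℂ G W} (f : V →ₗ[ℂ] W)
    (hf : ∀ g v, f (ρ g v) = σ g (f v)) {p : Submodule ℂ V} (hp : RInv ρ p) : RInv σ (p.map f) := by
  rintro g _ ⟨v, hv, rfl⟩
  exact ⟨ρ g v, hp g v hv, hf g v⟩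

theorem RInv.ker {ρ : Representation ℂ G V} {σ : Representation ℂ G W} (f : V →ₗ[ℂ] W)
    (hf : ∀ g v, f (ρ g v) = σ g (f v)) : RInv ρ (LinearMap.ker f) := by
  intro g v hv
  rw [LinearMap.mem_ker] at *
  rw [hf, hv, map_zero]

theorem RInv.range {ρ : Representation ℂ G V} {σ : Representation ℂ G W} (f : V →ₗ[ℂ] W)
    (hf : ∀ g v, f (ρ g v) = σ g (f v)) : RInv σ (LinearMap.range f) := by
  rw [LinearMap.range_eq_map]
  exact RInv.map f hf (RInv.top ρ)

theorem Irr.inj {ρ : Representation ℂ G V} {σ : Representation ℂ G W} (h : Irr ρ) (f : V →ₗ[ℂ] W)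
    (hf : ∀ g v, f (ρ g v) = σ g (f v)) (h0 : f ≠ 0) : Function.Injective f := by
  rw [← LinearMap.ker_eq_bot]
  rcases h.2.2 _ le_top (RInv.ker f hf) with h1 | h1
  · exact h1
  · exact absurd (LinearMap.ker_eq_top.1 h1) h0

theorem Irr.surj {ρ : Representation ℂ G V} {σ : Representation ℂ G W} (h : Irr σ) (f : V →ₗ[ℂ] W)
    (hf : ∀ g v, f (ρ g v) = σ g (f v)) (h0 : f ≠ 0) : Function.Surjective f := by
  rw [← LinearMap.range_eq_top]
  exact h.eq (RInv.range f hf) (fun h1 => h0 (LinearMap.range_eq_bot.1 h1))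

theorem Irr.schur [FiniteDimensional ℂ V] {ρ : Representation ℂ G V} (h : Irr ρ) (f : V →ₗ[ℂ] V)
    (hf : ∀ g v, f (ρ g v) = ρ g (f v)) : ∃ c : ℂ, ∀ v, f v = c • v := by
  have := h.nontrivial
  obtain ⟨c, hc⟩ := Module.End.exists_eigenvalue f
  refine ⟨c, fun v => ?_⟩
  have hI : RInv ρ (Module.End.eigenspace f c) := by
    intro g v hv
    rw [Module.End.mem_eigenspace_iff] at *
    rw [hf, hv, map_smul]
  have := h.eq hI hc
  have hv : v ∈ Module.End.eigenspace f c := this ▸ trivial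
  exact Module.End.mem_eigenspace_iff.1 hv

theorem exists_eigenvector [FiniteDimensional ℂ V] (ρ : Representation ℂ G V) {p : Submodule ℂ V}
    (h0 : p ≠ ⊥) (hp : RInv ρ p) (hc : ∀ g h, ∀ v ∈ p, ρ g (ρ h v) = ρ h (ρ g v)) :
    ∃ v ∈ p, v ≠ 0 ∧ ∀ g, ∃ c : ℂ, ρ g v = c • v := by
  obtain ⟨q, hqp, hq⟩ := exists_simp ρ h0 hp
  have hi := hq.irr
  obtain ⟨v, hv, hv0⟩ := q.ne_bot_iff.1 hq.1
  refine ⟨v, hqp hv, hv0, fun g => ?_⟩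
  obtain ⟨c, hc'⟩ := hi.schur (subrep ρ q hq.2.1 g) (fun h w => Subtype.ext (hc g h w (hqp w.2)))
  exact ⟨c, congrArg Subtype.val (hc' ⟨v, hv⟩)⟩

/-- a common eigenvector gives a linear character -/
theorem exists_char (ρ : Representation ℂ G V) {v : V} (hv : v ≠ 0)
    (h : ∀ g, ∃ c : ℂ, ρ g v = c • v) : ∃ μ : G →* ℂˣ, ∀ g, ρ g v = (μ g : ℂ) • v := by
  choose c hc using h
  have inj : ∀ a b : ℂ, a • v = b • v → a = b := fun a b hab => smul_left_injective ℂ hv hab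
  let m : G →* ℂ :=
    { toFun := c
      map_one' := inj _ _ (by rw [← hc]; simp)
      map_mul' := fun a b => inj _ _ (by
        rw [← hc, map_mul, Module.End.mul_apply, hc b, map_smul, hc a, smul_smul, mul_comm]) }
  exact ⟨m.toHomUnits, fun g => hc g⟩

end basics

/-- degrees of irreducible representations -/
def Deg (G : Type) [Group G] (n : ℕ) : Prop :=
  ∃ (V : Type) (_ : AddCommGroup V) (_ : Module ℂ V) (_ : FiniteDimensional ℂ V)
    (ρ : Representation ℂ G V), Irr ρ ∧ Module.finrank ℂ V = n

theorem irr_iff_finrank {G : Type*} [Group G] [Finite G] {V : Type*} [AddCommGroup V] [Module ℂ V]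
    [FiniteDimensional ℂ V] (ρ : Representation ℂ G V) :
    Module.finrank ℂ (Representation.IntertwiningMap ρ ρ) = 1 ↔ Irr ρ := by
  constructor
  · intro h
    have hnt : Nontrivial V := by
      by_contra hn
      rw [not_nontrivial_iff_subsingleton] at hn
      have : Subsingleton (Representation.IntertwiningMap ρ ρ) :=
        ⟨fun a b => Representation.IntertwiningMap.ext (Subsingleton.elim _ _)⟩
      rw [Module.finrank_zero_of_subsingleton] at h
      omega
    refine Irr.of_forall fun q hq => ?_
    obtain ⟨q', hq', hc⟩ := maschke ρ hq
    let P : V →ₗ[ℂ] V := q.subtype ∘ₗ q.projectionOnto q' hc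
    have hP1 : ∀ v ∈ q, P v = v := fun v hv => by
      simpa [P] using congrArg Subtype.val (Submodule.projectionOnto_apply_left hc ⟨v, hv⟩)
    have hP2 : ∀ v ∈ q', P v = 0 := fun v hv => by
      simpa [P] using congrArg Subtype.val (Submodule.projectionOnto_apply_right hc ⟨v, hv⟩)
    have hP3 : ∀ g v, P (ρ g v) = ρ g (P v) := by
      intro g v
      obtain ⟨a, ha, b, hb, rfl⟩ := Submodule.mem_sup.1 (show v ∈ q ⊔ q' by rw [hc.sup_eq_top]; trivial)
      simp only [map_add]
      rw [hP1 a ha, hP2 b hb, hP1 _ (hq g a ha), hP2 _ (hq' g b hb)]; simp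
    let PI : Representation.IntertwiningMap ρ ρ := ⟨P, fun g => by ext v; exact hP3 g v⟩
    have hid : Representation.IntertwiningMap.id ρ ≠ 0 := by
      intro h0
      obtain ⟨v, hv⟩ := exists_ne (0 : V)
      exact hv (by simpa using congrArg (fun F => F.toLinearMap v) h0)
    obtain ⟨c, hcP⟩ := (finrank_eq_one_iff_of_nonzero' _ hid).1 h PI
    have hcv : ∀ v, P v = c • v := fun v => by
      have := congrArg (fun F => F.toLinearMap v) hcP
      exact this.symm
    by_cases h0 : q = ⊥
    · exact Or.inl h0
    · right
      obtain ⟨v, hv, hv0⟩ := q.ne_bot_iff.1 h0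
      have : c = 1 := by
        have h1 := hcv v
        rw [hP1 v hv] at h1
        have h2 : (1 : ℂ) • v = c • v := by simpa using h1
        exact (smul_left_injective ℂ hv0 h2).symm
      rw [eq_top_iff]
      intro w _
      have h1 := hcv w
      rw [this, one_smul] at h1
      rw [← h1]
      exact (q.projectionOnto q' hc w).2
  · intro h
    have := h.nontrivial
    have hid : Representation.IntertwiningMap.id ρ ≠ 0 := by
      intro h0
      obtain ⟨v, hv⟩ := exists_ne (0 : V)
      exact hv (by simpa using congrArg (fun F => F.toLinearMap v) h0)
    rw [finrank_eq_one_iff_of_nonzero' _ hid]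
    intro F
    obtain ⟨c, hc⟩ := h.schur F.toLinearMap (fun g v => F.isIntertwining _ _ g v)
    refine ⟨c, Representation.IntertwiningMap.ext (LinearMap.ext fun v => (hc v).symm)⟩

theorem FDRep.endo_iff {G : Type} [Group G] [Finite G] (V : FDRep ℂ G) : Simple V ↔ Irr V.ρ := by
  have : NeZero (Nat.card G : ℂ) := ⟨by exact_mod_cast Nat.card_pos.ne'⟩
  rw [FDRep.simple_iff_end_is_rank_one, ← LinearEquiv.finrank_eq (FDRep.forget₂HomLinearEquiv V V),
    LinearEquiv.finrank_eq (Rep.homLinearEquiv _ _)]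
  exact irr_iff_finrank V.ρ

theorem mem_charDegrees {G : Type} [Group G] [Finite G] {n : ℕ} : n ∈ charDegrees G ↔ Deg G n := by
  constructor
  · rintro ⟨V, hV, rfl⟩
    exact ⟨V, inferInstance, inferInstance, inferInstance, V.ρ, (FDRep.endo_iff V).1 hV, rfl⟩
  · rintro ⟨V, _, _, _, ρ, h, rfl⟩
    exact ⟨FDRep.of ρ, (FDRep.endo_iff _).2 h, rfl⟩
end ModA

section ModB

theorem finrank_internal {ι : Type*} [Fintype ι] {V : Type*} [AddCommGroup V] [Module ℂ V]
    [FiniteDimensional ℂ V] (F : ι → Submodule ℂ V) (hF : iSupIndep F) (ht : ⨆ i, F i = ⊤) :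
    Module.finrank ℂ V = ∑ i, Module.finrank ℂ (F i) := by
  classical
  have hI : DirectSum.IsInternal F := DirectSum.isInternal_submodule_of_iSupIndep_of_iSup_eq_top hF ht
  rw [← LinearEquiv.finrank_eq (LinearEquiv.ofBijective (DirectSum.coeLinearMap F) hI),
    Module.finrank_directSum]

section
variable {G : Type*} [Group G] {V W : Type*} [AddCommGroup V] [Module ℂ V] [AddCommGroup W] [Module ℂ W]

/-- restriction to a subgroup -/
abbrev res (ρ : Representation ℂ G V) (N : Subgroup G) : Representation ℂ N V := ρ.comp N.subtype

theorem rho_inv (ρ : Representation ℂ G V) (g : G) (v : V) : ρ g⁻¹ (ρ g v) = v := by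
  rw [← Module.End.mul_apply, ← map_mul]; simp
theorem rho_inv' (ρ : Representation ℂ G V) (g : G) (v : V) : ρ g (ρ g⁻¹ v) = v := by
  rw [← Module.End.mul_apply, ← map_mul]; simp
theorem rho_mul (ρ : Representation ℂ G V) (g h : G) (v : V) : ρ (g * h) v = ρ g (ρ h v) := by
  rw [map_mul]; rfl
theorem rho_inj (ρ : Representation ℂ G V) (g : G) : Function.Injective (ρ g) :=
  Function.LeftInverse.injective (rho_inv ρ g)

@[simp] theorem map_end_one (X : Submodule ℂ V) : X.map (1 : V →ₗ[ℂ] V) = X := Submodule.map_id X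

theorem map_map_rho (ρ : Representation ℂ G V) (g h : G) (p : Submodule ℂ V) :
    (p.map (ρ h)).map (ρ g) = p.map (ρ (g * h)) := by
  rw [← Submodule.map_comp, map_mul]; rfl

theorem map_rho_eq {ρ : Representation ℂ G V} {p : Submodule ℂ V} {g : G} 
    (h : ∀ v ∈ p, ρ g v ∈ p) (h' : ∀ v ∈ p, ρ g⁻¹ v ∈ p) : p.map (ρ g) = p := by
  apply le_antisymm
  · rintro _ ⟨v, hv, rfl⟩; exact h v hv
  · intro v hv; exact ⟨ρ g⁻¹ v, h' v hv, rho_inv' ρ g v⟩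

theorem finrank_map_rho (ρ : Representation ℂ G V) (g : G) (p : Submodule ℂ V) :
    Module.finrank ℂ (p.map (ρ g)) = Module.finrank ℂ p :=
  LinearEquiv.finrank_eq (Submodule.equivMapOfInjective _ (rho_inj ρ g) p).symm

/-- orbit lemma -/
theorem orbit_core [Finite G] [FiniteDimensional ℂ V] {ρ : Representation ℂ G V} (hρ : Irr ρ) (H : Subgroup G)
    (X : Submodule ℂ V) (hX0 : X ≠ ⊥) (hX : ∀ h ∈ H, ∀ v ∈ X, ρ h v ∈ X)
    (hi : iSupIndep (fun c : G ⧸ H => X.map (ρ c.out))) :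
    Module.finrank ℂ V = H.index * Module.finrank ℂ X := by
  have : Fintype (G ⧸ H) := Fintype.ofFinite _
  have key : ∀ g : G, X.map (ρ g) = X.map (ρ (g : G ⧸ H).out) := by
    intro g
    obtain ⟨h, hh⟩ := QuotientGroup.mk_out_eq_mul H g
    rw [hh, ← map_map_rho, map_rho_eq (hX h h.2) (hX _ (H.inv_mem h.2))]
  have htop : ⨆ c : G ⧸ H, X.map (ρ c.out) = ⊤ := by
    refine hρ.eq ?_ ?_
    · intro g v hv
      have : (⨆ c : G ⧸ H, X.map (ρ c.out)).map (ρ g) ≤ ⨆ c : G ⧸ H, X.map (ρ c.out) := by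
        rw [Submodule.map_iSup]
        refine iSup_le fun c => ?_
        rw [map_map_rho, key]
        exact le_iSup (fun c : G ⧸ H => X.map (ρ c.out)) _
      exact this ⟨v, hv, rfl⟩
    · intro h0
      have h1 : X.map (ρ 1) ≤ ⊥ := by
        rw [key, ← h0]
        exact le_iSup (fun c : G ⧸ H => X.map (ρ c.out)) _
      apply hX0
      rw [eq_bot_iff]
      simpa using h1
  rw [finrank_internal _ hi htop]
  simp only [finrank_map_rho, Finset.sum_const, Finset.card_univ, smul_eq_mul]
  rw [← Nat.card_eq_fintype_card]; rfl

theorem orbit_lemma [Finite G] [FiniteDimensional ℂ V] {ρ : Representation ℂ G V} (hρ : Irr ρ)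
    {J : Type*} [MulAction G J] (E : J → Submodule ℂ V) (hE : iSupIndep E)
    (hEg : ∀ g j, ∀ v ∈ E j, ρ g v ∈ E (g • j)) (j : J) (X : Submodule ℂ V) (hXE : X ≤ E j)
    (hX0 : X ≠ ⊥) (hX : ∀ h ∈ MulAction.stabilizer G j, ∀ v ∈ X, ρ h v ∈ X) :
    Module.finrank ℂ V = (MulAction.stabilizer G j).index * Module.finrank ℂ X := by
  refine orbit_core hρ _ X hX0 hX ?_
  have : iSupIndep (E ∘ fun c : G ⧸ MulAction.stabilizer G j => c.out • j) := by
    refine hE.comp ?_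
    intro c d hcd
    have : c.out⁻¹ * d.out ∈ MulAction.stabilizer G j := by
      rw [MulAction.mem_stabilizer_iff, mul_smul]
      have h2 : c.out • j = d.out • j := hcd
      rw [← h2, inv_smul_smul]
    rw [← QuotientGroup.eq] at this
    simpa using this
  refine this.mono fun c => ?_
  rintro _ ⟨v, hv, rfl⟩
  exact hEg _ _ _ (hXE hv)

/-- isomorphism of invariant subspaces -/
def SIso (σ : Representation ℂ G V) (A B : Submodule ℂ V) : Prop :=
  ∃ e : A ≃ₗ[ℂ] B, ∀ n (a a' : A), (a' : V) = σ n a → (e a' : V) = σ n (e a)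

theorem SIso.refl (σ : Representation ℂ G V) (A : Submodule ℂ V) : SIso σ A A :=
  ⟨LinearEquiv.refl ℂ A, fun _ _ _ h => h⟩

theorem SIso.symm {σ : Representation ℂ G V} {A B : Submodule ℂ V} (hA : RInv σ A) (h : SIso σ A B) :
    SIso σ B A := by
  obtain ⟨e, he⟩ := h
  refine ⟨e.symm, fun n b b' hb => ?_⟩
  have h1 := he n (e.symm b) ⟨σ n (e.symm b), hA _ _ (e.symm b).2⟩ rfl
  have h2 : e ⟨σ n (e.symm b), hA _ _ (e.symm b).2⟩ = b' := by
    apply Subtype.ext; rw [h1, hb]; simp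
  rw [← h2]; simp

theorem SIso.trans {σ : Representation ℂ G V} {A B C : Submodule ℂ V} (h : SIso σ A B) (h' : SIso σ B C) :
    SIso σ A C := by
  obtain ⟨e, he⟩ := h
  obtain ⟨e', he'⟩ := h'
  exact ⟨e.trans e', fun n a a' ha => he' n _ _ (he n a a' ha)⟩

theorem Simp.exists_iso [Finite G] {ι : Type*} {σ : Representation ℂ G V} {A : Submodule ℂ V} (hA : Simp σ A)
    (F : ι → Submodule ℂ V) (hF : ∀ i, Simp σ (F i)) (hle : A ≤ ⨆ i, F i) : ∃ i, SIso σ (F i) A := by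
  obtain ⟨A', hA', hc⟩ := maschke σ hA.2.1
  let P := A.projectionOnto A' hc
  have hP3 : ∀ g (v : V), P (σ g v) = subrep σ A hA.2.1 g (P v) := by
    intro g v
    obtain ⟨a, ha, b, hb, rfl⟩ := Submodule.mem_sup.1 (show v ∈ A ⊔ A' by rw [hc.sup_eq_top]; trivial)
    have h1 : ∀ v (hv : v ∈ A), P v = ⟨v, hv⟩ := fun v hv => Submodule.projectionOnto_apply_left hc ⟨v, hv⟩
    have h2 : ∀ v (hv : v ∈ A'), P v = 0 := fun v hv => Submodule.projectionOnto_apply_right hc ⟨v, hv⟩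
    simp only [map_add]
    rw [h1 a ha, h2 b hb, h1 _ (hA.2.1 g a ha), h2 _ (hA' g b hb)]; simp only [map_zero, add_zero]; rfl
  have hex : ∃ i, ¬ F i ≤ A' := by
    by_contra! hh
    have h1 : A ≤ A' := hle.trans (iSup_le hh)
    exact hA.1 (by rw [← inf_eq_left.2 h1]; exact hc.inf_eq_bot)
  obtain ⟨i, hi⟩ := hex
  refine ⟨i, ?_⟩
  let f : F i →ₗ[ℂ] A := P ∘ₗ (F i).subtype
  have hf : ∀ g v, f (subrep σ (F i) (hF i).2.1 g v) = subrep σ A hA.2.1 g (f v) := fun g v => hP3 g v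
  have hf0 : f ≠ 0 := by
    intro h0
    apply hi
    intro v hv
    have h1 : P v = 0 := LinearMap.congr_fun h0 ⟨v, hv⟩
    exact (Submodule.projectionOnto_apply_eq_zero_iff hc).1 h1
  refine ⟨LinearEquiv.ofBijective f ⟨(hF i).irr.inj f hf hf0, hA.irr.surj f hf hf0⟩, fun n a a' ha => ?_⟩
  have h1 : a' = subrep σ (F i) (hF i).2.1 n a := Subtype.ext ha
  rw [h1]
  exact congrArg Subtype.val (hf n a)

theorem iSupIndep_of_not_iso [Finite G] {ι : Type*} {σ : Representation ℂ G V} 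
    (F : ι → Submodule ℂ V) (hF : ∀ i, Simp σ (F i)) (hn : ∀ i j, i ≠ j → ¬ SIso σ (F i) (F j)) :
    iSupIndep F := by
  intro i
  rw [disjoint_iff]
  have hinv : RInv σ (⨆ j, ⨆ (_ : j ≠ i), F j) := by
    intro g v hv
    have : (⨆ j, ⨆ (_ : j ≠ i), F j).map (σ g) ≤ (⨆ j, ⨆ (_ : j ≠ i), F j) := by
      simp only [Submodule.map_iSup]
      refine iSup₂_mono fun j _ => ?_
      rintro _ ⟨v, hv, rfl⟩
      exact (hF j).2.1 g v hv
    exact this ⟨v, hv, rfl⟩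
  rcases (hF i).2.2 _ inf_le_left ((hF i).2.1.inf hinv) with h | h
  · exact h
  · exfalso
    have hle : F i ≤ ⨆ j : {j // j ≠ i}, F j := by
      rw [iSup_subtype]; exact inf_eq_left.1 h
    obtain ⟨j, hj⟩ := (hF i).exists_iso (fun j : {j // j ≠ i} => F j) (fun j => hF j) hle
    exact hn j i j.2 hj

variable {N : Subgroup G} [hN : N.Normal]

theorem Simp.translate {ρ : Representation ℂ G V} {A : Submodule ℂ V} (hA : Simp (res ρ N) A) (g : G) :
    Simp (res ρ N) (A.map (ρ g)) := by
  have h1 : ∀ (g : G) (q : Submodule ℂ V), RInv (res ρ N) q → RInv (res ρ N) (q.map (ρ g)) := by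
    rintro g q hq n _ ⟨v, hv, rfl⟩
    refine ⟨ρ (g⁻¹ * n * g) v, hq ⟨g⁻¹ * n * g, by simpa using hN.conj_mem n n.2 g⁻¹⟩ v hv, ?_⟩
    change _ = ρ n (ρ g v)
    rw [← rho_mul, ← rho_mul]; congr 2; group
  refine ⟨?_, h1 g A hA.2.1, fun q hq hqi => ?_⟩
  · intro h0
    apply hA.1
    rw [eq_bot_iff]
    intro v hv
    have : ρ g v ∈ A.map (ρ g) := ⟨v, hv, rfl⟩
    rw [h0] at this
    exact rho_inj ρ g (by simpa using this)
  · have h2 : (q.map (ρ g⁻¹)).map (ρ g) = q := by rw [map_map_rho]; simp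
    have h3 : q.map (ρ g⁻¹) ≤ A := by
      have := Submodule.map_mono (f := ρ g⁻¹) hq
      rw [map_map_rho] at this
      simpa using this
    rcases hA.2.2 (q.map (ρ g⁻¹)) h3 (h1 _ _ hqi) with h | h
    · left; rw [← h2, h]; simp
    · right; rw [← h2, h]

theorem SIso.translate {ρ : Representation ℂ G V} {A B : Submodule ℂ V} (h : SIso (res ρ N) A B) (g : G) :
    SIso (res ρ N) (A.map (ρ g)) (B.map (ρ g)) := by
  obtain ⟨e, he⟩ := h
  let eA := Submodule.equivMapOfInjective _ (rho_inj ρ g) A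
  let eB := Submodule.equivMapOfInjective _ (rho_inj ρ g) B
  refine ⟨eA.symm.trans (e.trans eB), fun n a a' ha => ?_⟩
  obtain ⟨a, rfl⟩ := eA.surjective a
  obtain ⟨a', rfl⟩ := eA.surjective a'
  have h1 : (a' : V) = ρ (g⁻¹ * n * g) a := by
    have : ρ g a' = ρ n (ρ g a) := ha
    rw [rho_mul, rho_mul, ← this, rho_inv]
  have h2 : (e a' : V) = ρ (g⁻¹ * n * g) (e a) :=
    he ⟨g⁻¹ * n * g, by simpa using hN.conj_mem n n.2 g⁻¹⟩ a a' h1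
  simp only [LinearEquiv.trans_apply, LinearEquiv.symm_apply_apply]
  change ρ g (e a') = ρ n (ρ g (e a))
  rw [h2, ← rho_mul, ← rho_mul]; congr 2; group

theorem iSup_translates [Finite G] {ρ : Representation ℂ G V} (hρ : Irr ρ) {A : Submodule ℂ V} (hA : A ≠ ⊥) :
    ⨆ g : G, A.map (ρ g) = ⊤ := by
  refine hρ.eq ?_ ?_
  · intro g v hv
    have : (⨆ g : G, A.map (ρ g)).map (ρ g) ≤ ⨆ g : G, A.map (ρ g) := by
      rw [Submodule.map_iSup]
      refine iSup_le fun c => ?_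
      rw [map_map_rho]
      exact le_iSup (fun g => A.map (ρ g)) _
    exact this ⟨v, hv, rfl⟩
  · intro h0
    apply hA
    rw [eq_bot_iff, ← h0]
    simpa using le_iSup (fun g => A.map (ρ g)) 1

theorem clifford_dvd [Finite G] [FiniteDimensional ℂ V] {ρ : Representation ℂ G V} (hρ : Irr ρ) {A : Submodule ℂ V}
    (hA : Simp (res ρ N) A) : Module.finrank ℂ A ∣ Module.finrank ℂ V := by
  have key : ∀ d : ℕ, ∀ X : Submodule ℂ V, RInv (res ρ N) X → Module.finrank ℂ X = d → 
      Module.finrank ℂ A ∣ Module.finrank ℂ X := by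
    intro d
    induction d using Nat.strong_induction_on with
    | _ d ih =>
      intro X hX hd
      by_cases h0 : X = ⊥
      · rw [h0]; simp
      obtain ⟨B, hBX, hB⟩ := exists_simp (res ρ N) h0 hX
      obtain ⟨g, ⟨e, -⟩⟩ := hB.exists_iso (fun g : G => A.map (ρ g)) (fun g => hA.translate g)
        (by rw [iSup_translates hρ hA.1]; exact le_top)
      have hdim : Module.finrank ℂ B = Module.finrank ℂ A := by
        rw [← finrank_map_rho ρ g A, LinearEquiv.finrank_eq e]
      obtain ⟨B', hB', hc⟩ := maschke (res ρ N) hB.2.1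
      have hsup : B ⊔ (B' ⊓ X) = X := by
        rw [← sup_inf_assoc_of_le B' hBX, hc.sup_eq_top, top_inf_eq]
      have hinf : B ⊓ (B' ⊓ X) = ⊥ := by
        rw [← inf_assoc, hc.inf_eq_bot, bot_inf_eq]
      have hsum := Submodule.finrank_sup_add_finrank_inf_eq B (B' ⊓ X)
      rw [hsup, hinf, finrank_bot, add_zero] at hsum
      have hBpos : 0 < Module.finrank ℂ B := by
        have := hB.irr.nontrivial
        exact Module.finrank_pos
      rw [hsum]
      refine dvd_add (by rw [hdim]) (ih _ ?_ _ (hB'.inf hX) rfl)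
      omega
  have := key _ ⊤ (RInv.top _) rfl
  simpa using this
end

/-- every irreducible of a subgroup lies under an irreducible of the group -/
theorem exists_over {G : Type} [Group G] [Finite G] (N : Subgroup G) {A : Type} [AddCommGroup A] [Module ℂ A]
    [FiniteDimensional ℂ A] {σ : Representation ℂ N A} (hσ : Irr σ) :
    ∃ (V : Type) (_ : AddCommGroup V) (_ : Module ℂ V) (_ : FiniteDimensional ℂ V)
      (ρ : Representation ℂ G V) (f : A →ₗ[ℂ] V), Irr ρ ∧ Function.Injective f ∧ ∀ n a, f (σ n a) = ρ n (f a) := by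
  let τ : Representation ℂ G (G → A) :=
    { toFun := fun g => { toFun := fun F x => F (x * g), map_add' := fun _ _ => rfl, map_smul' := fun _ _ => rfl }
      map_one' := by ext; simp
      map_mul' := fun a b => by ext; simp [mul_assoc] }
  let Wd : Submodule ℂ (G → A) :=
    { carrier := {F | ∀ (n : N) x, F (n * x) = σ n (F x)}
      add_mem' := fun {a b} ha hb n x => by simp [ha n x, hb n x]
      zero_mem' := fun n x => by simp
      smul_mem' := fun c a ha n x => by simp [ha n x] }
  have hW : RInv τ Wd := fun g F hF n x => by
    change F (n * x * g) = σ n (F (x * g))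
    rw [mul_assoc]; exact hF n _
  have hW0 : Wd ≠ ⊥ := by
    classical
    have := hσ.nontrivial
    obtain ⟨a, ha⟩ := exists_ne (0 : A)
    let F : G → A := fun x => if h : x ∈ N then σ ⟨x, h⟩ a else 0
    have hF : F ∈ Wd := by
      intro n x
      by_cases hx : x ∈ N
      · have h2 : (n : G) * x ∈ N := N.mul_mem n.2 hx
        simp only [F, hx, h2, dif_pos]
        rw [← rho_mul]; rfl
      · have h2 : ¬ (n : G) * x ∈ N := fun h => hx ((N.mul_mem_cancel_left n.2).1 h)
        simp only [F, hx, h2, dif_neg, not_false_eq_true, map_zero]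
    intro h0
    rw [h0] at hF
    have h1 : F = 0 := by simpa using hF
    have h2 := congrFun h1 1
    have h3 : F 1 = a := by
      simp only [F, N.one_mem, dif_pos]
      change σ 1 a = a
      simp
    exact ha (by rw [← h3, h2]; rfl)
  obtain ⟨Vs, hVW, hV⟩ := exists_simp τ hW0 hW
  let ev : Vs →ₗ[ℂ] A := (LinearMap.proj (1 : G)) ∘ₗ Vs.subtype
  have hev : ∀ (n : N) v, ev (res (subrep τ Vs hV.2.1) N n v) = σ n (ev v) := by
    intro n v
    change (v : G → A) (1 * n) = σ n ((v : G → A) 1)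
    rw [one_mul]; simpa using hVW v.2 n 1
  have hev0 : ev ≠ 0 := by
    intro h0
    apply hV.1
    rw [eq_bot_iff]
    intro F hF
    rw [Submodule.mem_bot]
    funext x
    have := LinearMap.congr_fun h0 ⟨τ x F, hV.2.1 x F hF⟩
    simpa [ev, τ] using this
  have hsurj := hσ.surj ev hev hev0
  obtain ⟨C, hC, hcc⟩ := maschke (res (subrep τ Vs hV.2.1) N) (RInv.ker ev hev)
  let e : C →ₗ[ℂ] A := ev ∘ₗ C.subtype
  have he : Function.Bijective e := by
    constructor
    · intro c d hcd
      have : (c : Vs) - d ∈ LinearMap.ker ev ⊓ C :=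
        ⟨LinearMap.sub_mem_ker_iff.2 hcd, C.sub_mem c.2 d.2⟩
      rw [hcc.inf_eq_bot] at this
      exact Subtype.ext (sub_eq_zero.1 ((Submodule.mem_bot ℂ).1 this))
    · intro a
      obtain ⟨v, rfl⟩ := hsurj a
      obtain ⟨x, hx, y, hy, rfl⟩ := Submodule.mem_sup.1 (show v ∈ LinearMap.ker ev ⊔ C by rw [hcc.sup_eq_top]; trivial)
      refine ⟨⟨y, hy⟩, ?_⟩
      rw [LinearMap.mem_ker] at hx
      simp [e, hx]
  let E := LinearEquiv.ofBijective e he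
  refine ⟨Vs, inferInstance, inferInstance, inferInstance, subrep τ Vs hV.2.1, C.subtype ∘ₗ E.symm.toLinearMap,
    hV.irr, ?_, ?_⟩
  · exact C.injective_subtype.comp E.symm.injective
  · intro n a
    obtain ⟨c, rfl⟩ := E.surjective a
    have : E ⟨res (subrep τ Vs hV.2.1) N n c, hC n c c.2⟩ = σ n (E c) := hev n c
    rw [← this]
    simp
end ModB

section ModC

theorem cyclic_ext {G : Type*} [Group G] [Finite G] {V : Type*} [AddCommGroup V] [Module ℂ V]
    [FiniteDimensional ℂ V] {N : Subgroup G} [N.Normal] (hcyc : IsCyclic (G ⧸ N))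
    {ρ : Representation ℂ G V} (hρ : Irr ρ) {A : Submodule ℂ V} (hA : Simp (res ρ N) A) :
    ∃ I : Subgroup G, N ≤ I ∧ (∀ g ∈ I, SIso (res ρ N) A (A.map (ρ g))) ∧
      Module.finrank ℂ V = I.index * Module.finrank ℂ A := by
  let I : Subgroup G :=
    { carrier := {g | SIso (res ρ N) A (A.map (ρ g))}
      one_mem' := by simpa using SIso.refl _ _
      mul_mem' := fun {a b} ha hb => by
        have h1 := SIso.translate (N := N) (g := a) hb
        rw [map_map_rho] at h1
        exact SIso.trans ha h1
      inv_mem' := fun {a} ha => by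
        have h1 := SIso.translate (N := N) (g := a⁻¹) ha
        rw [map_map_rho] at h1
        have h2 := h1.symm (hA.translate a⁻¹).2.1
        simpa using h2 }
  have hNI : N ≤ I := by
    intro n hn
    change SIso (res ρ N) A (A.map (ρ n))
    rw [map_rho_eq (ρ := ρ) (g := n) (hA.2.1 ⟨n, hn⟩) (hA.2.1 ⟨n, hn⟩⁻¹)]
    exact SIso.refl _ _
  refine ⟨I, hNI, fun g hg => hg, ?_⟩
  -- generator of `I` modulo `N`
  have hgen : ∃ x ∈ I, ∀ g ∈ I, ∃ k : ℤ, x ^ k * g ∈ N := by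
    obtain ⟨⟨y, hy⟩, hyg⟩ := (inferInstance : IsCyclic (I.map (QuotientGroup.mk' N))).exists_generator
    obtain ⟨x, hx, rfl⟩ := hy
    refine ⟨x, hx, fun g hg => ?_⟩
    obtain ⟨k, hk⟩ := Subgroup.mem_zpowers_iff.1 (hyg ⟨QuotientGroup.mk' N g, g, hg, rfl⟩)
    refine ⟨-k, ?_⟩
    have h1 : (QuotientGroup.mk' N x) ^ k = QuotientGroup.mk' N g := congrArg Subtype.val hk
    rw [← map_zpow] at h1
    rw [zpow_neg]
    exact QuotientGroup.eq.1 h1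
  obtain ⟨x, hxI, hx⟩ := hgen
  obtain ⟨e, he⟩ : SIso (res ρ N) A (A.map (ρ x)) := hxI
  have hY : ∀ a : A, ρ x⁻¹ (e a) ∈ A := by
    intro a
    obtain ⟨w, hw, hw2⟩ := (e a).2
    rw [← hw2, rho_inv]; exact hw
  let Y : A →ₗ[ℂ] A := LinearMap.codRestrict A (ρ x⁻¹ ∘ₗ (A.map (ρ x)).subtype ∘ₗ e.toLinearMap) hY
  have hYv : ∀ a, ρ x (Y a) = e a := fun a => rho_inv' ρ x _
  have hYinj : Function.Injective Y := by
    intro a b hab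
    apply e.injective
    apply Subtype.ext
    rw [← hYv, ← hYv, hab]
  have hYsurj : Function.Surjective Y := LinearMap.injective_iff_surjective.1 hYinj
  let Hs : Submodule ℂ (A →ₗ[ℂ] V) :=
    { carrier := {h | ∀ (n : N) (a : A), h (subrep (res ρ N) A hA.2.1 n a) = ρ n (h a)}
      add_mem' := fun {a b} ha hb n x => by simp only [LinearMap.add_apply, ha n x, hb n x, map_add]
      zero_mem' := fun n x => by simp
      smul_mem' := fun c a ha n x => by simp only [LinearMap.smul_apply, ha n x, map_smul] }
  let T0 : (A →ₗ[ℂ] V) →ₗ[ℂ] (A →ₗ[ℂ] V) :=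
    { toFun := fun h => ρ x ∘ₗ h ∘ₗ Y
      map_add' := fun a b => by ext; simp
      map_smul' := fun c a => by ext; simp }
  have hT : ∀ h ∈ Hs, T0 h ∈ Hs := by
    intro h hh n a
    change ρ x (h (Y _)) = ρ n (ρ x (h (Y a)))
    have h1 : Y (subrep (res ρ N) A hA.2.1 n a) = 
        subrep (res ρ N) A hA.2.1 ⟨x⁻¹ * n * x, by simpa using (inferInstance : N.Normal).conj_mem n n.2 x⁻¹⟩ (Y a) := by
      apply Subtype.ext
      apply rho_inj ρ x
      rw [hYv, he n a _ rfl, subrep_coe]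
      change ρ n (e a) = ρ x (ρ (x⁻¹ * n * x) (Y a))
      rw [← hYv, ← rho_mul, ← rho_mul]; congr 2; group
    rw [h1, hh]
    change ρ x (ρ (x⁻¹ * n * x) _) = _
    rw [← rho_mul, ← rho_mul]; congr 2; group
  have hs : Hs ≠ ⊥ := by
    intro h0
    have h1 : A.subtype ∈ Hs := fun n a => rfl
    rw [h0, Submodule.mem_bot] at h1
    apply hA.1
    rw [eq_bot_iff]
    intro v hv
    exact LinearMap.congr_fun h1 ⟨v, hv⟩
  have : Nontrivial Hs := Submodule.nontrivial_iff_ne_bot.2 hs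
  obtain ⟨c, hc⟩ := Module.End.exists_eigenvalue (T0.restrict hT)
  obtain ⟨⟨h, hh⟩, hhc, hh0⟩ := hc.exists_hasEigenvector
  rw [Module.End.mem_eigenspace_iff] at hhc
  have hhc' : ∀ a, ρ x (h (Y a)) = c • h a := fun a => 
    LinearMap.congr_fun (congrArg Subtype.val hhc : T0 h = c • h) a
  have hh0' : h ≠ 0 := fun h0 => hh0 (Subtype.ext h0)
  have hhN : ∀ (n : N) (a : A), h (subrep (res ρ N) A hA.2.1 n a) = res ρ N n (h a) := hh
  have hinj : Function.Injective h := hA.irr.inj h hhN hh0'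
  have hc0 : c ≠ 0 := by
    rintro rfl
    apply hh0'
    ext a
    obtain ⟨b, rfl⟩ := hYsurj a
    have := hhc' b
    rw [zero_smul] at this
    have : h (Y b) = 0 := rho_inj ρ x (by rw [this, map_zero])
    rw [this]; rfl
  set A' := LinearMap.range h with hA'
  have hAA : SIso (res ρ N) A A' := by
    refine ⟨LinearEquiv.ofInjective h hinj, fun n a a' ha => ?_⟩
    have h1 : a' = subrep (res ρ N) A hA.2.1 n a := Subtype.ext ha
    rw [h1]; exact hhN n a
  have hA'inv : RInv (res ρ N) A' := RInv.range h hhN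
  have hA's : Simp (res ρ N) A' := by
    refine ⟨?_, hA'inv, fun q hq hqi => ?_⟩
    · intro h0; exact hh0' (LinearMap.range_eq_bot.1 h0)
    · have h1 : RInv (subrep (res ρ N) A hA.2.1) (q.comap h) := by
        intro n a ha
        rw [Submodule.mem_comap] at *
        rw [hhN]; exact hqi n _ ha
      have h2 : (q.comap h).map h = q := Submodule.map_comap_eq_of_le hq
      rcases hA.irr.2.2 _ le_top h1 with h3 | h3
      · left; rw [← h2, h3]; simp
      · right; rw [← h2, h3, hA', LinearMap.range_eq_map]
  have hxA : A'.map (ρ x) = A' := by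
    apply le_antisymm
    · rintro _ ⟨_, ⟨a, rfl⟩, rfl⟩
      obtain ⟨b, rfl⟩ := hYsurj a
      rw [hhc']; exact A'.smul_mem _ ⟨b, rfl⟩
    · rintro _ ⟨a, rfl⟩
      refine ⟨h (Y (c⁻¹ • a)), ⟨_, rfl⟩, ?_⟩
      rw [hhc', map_smul, smul_smul, mul_inv_cancel₀ hc0, one_smul]
  have hIinv : ∀ g ∈ I, ∀ v ∈ A', ρ g v ∈ A' := by
    let St : Subgroup G :=
      { carrier := {g | A'.map (ρ g) = A'}
        one_mem' := by simp
        mul_mem' := fun {a b} ha hb => by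
          change A'.map (ρ (a * b)) = A'
          rw [← map_map_rho]; rw [show A'.map (ρ b) = A' from hb]; exact ha
        inv_mem' := fun {a} ha => by
          change A'.map (ρ a⁻¹) = A'
          conv_lhs => rw [← show A'.map (ρ a) = A' from ha]
          rw [map_map_rho]; simp }
    have hxS : x ∈ St := hxA
    intro g hg v hv
    obtain ⟨k, hk⟩ := hx g hg
    have h1 : x ^ k * g ∈ St := map_rho_eq (hA'inv ⟨_, hk⟩) (hA'inv ⟨_, hk⟩⁻¹)
    have h2 : g ∈ St := (St.mul_mem_cancel_left (St.zpow_mem hxS k)).1 h1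
    have h3 : A'.map (ρ g) = A' := h2
    rw [← h3]; exact ⟨v, hv, rfl⟩
  rw [orbit_core hρ I A' hA's.1 hIinv, ← LinearEquiv.finrank_eq (LinearEquiv.ofInjective h hinj)]
  refine iSupIndep_of_not_iso (σ := res ρ N) _ (fun c => hA's.translate c.out) ?_
  intro c d hcd hiso
  apply hcd
  have h1 := SIso.translate (N := N) (g := c.out⁻¹) hiso
  rw [map_map_rho, map_map_rho, inv_mul_cancel, map_one, map_end_one] at h1
  have h2 : c.out⁻¹ * d.out ∈ I := by
    have h3 := hAA.translate (N := N) (c.out⁻¹ * d.out)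
    exact (hAA.trans h1).trans (h3.symm (hA.translate _).2.1)
  rw [← QuotientGroup.eq] at h2
  simpa using h2

open scoped TensorProduct in
/-- outer tensor product -/
noncomputable def tens {K R B C : Type*} [Group K] [Group R] [AddCommGroup B] [Module ℂ B] [AddCommGroup C] [Module ℂ C]
    (β : Representation ℂ K B) (γ : Representation ℂ R C) : Representation ℂ (K × R) (B ⊗[ℂ] C) :=
  Representation.tprod (β.comp (MonoidHom.fst K R)) (γ.comp (MonoidHom.snd K R))

theorem irr_char {G V : Type*} [Group G] [Fintype G] [AddCommGroup V] [Module ℂ V] [FiniteDimensional ℂ V]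
    (ρ : Representation ℂ G V) : Irr ρ ↔ (Nat.card G : ℂ)⁻¹ * ∑ g, ρ.character g * ρ.character g⁻¹ = 1 := by
  have : Invertible (Nat.card G : ℂ) := invertibleOfNonzero (by exact_mod_cast Nat.card_pos.ne')
  rw [Representation.card_inv_mul_sum_char_mul_char_eq_finrank, ← irr_iff_finrank]
  norm_cast

theorem tens_irr {K R B C : Type*} [Group K] [Group R] [Finite K] [Finite R] [AddCommGroup B] [Module ℂ B]
    [AddCommGroup C] [Module ℂ C] [FiniteDimensional ℂ B] [FiniteDimensional ℂ C]
    {β : Representation ℂ K B} {γ : Representation ℂ R C} (hβ : Irr β) (hγ : Irr γ) : Irr (tens β γ) := by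
  have := Fintype.ofFinite K
  have := Fintype.ofFinite R
  rw [irr_char] at *
  rw [Fintype.sum_prod_type]
  have h1 : ∀ x y, (tens β γ).character (x, y) = β.character x * γ.character y := by
    intro x y
    unfold tens
    rw [Representation.char_tensor]; rfl
  simp only [Prod.inv_mk, h1]
  rw [Nat.card_prod, Nat.cast_mul, mul_inv]
  calc _ = ((Nat.card K : ℂ)⁻¹ * ∑ g, β.character g * β.character g⁻¹) *
     ((Nat.card R : ℂ)⁻¹ * ∑ g, γ.character g * γ.character g⁻¹) := by
        rw [mul_mul_mul_comm, Finset.sum_mul_sum]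
        congr 1
        refine Finset.sum_congr rfl fun x _ => Finset.sum_congr rfl fun y _ => by ring
    _ = 1 := by rw [hβ, hγ, one_mul]

open scoped TensorProduct in
theorem prod_decomp {K R : Type*} [Group K] [Group R] [Finite K] [Finite R] {A : Type}
    [AddCommGroup A] [Module ℂ A] [FiniteDimensional ℂ A] {σ : Representation ℂ (K × R) A} (hσ : Irr σ) :
    ∃ (B : Type) (_ : AddCommGroup B) (_ : Module ℂ B) (_ : FiniteDimensional ℂ B)
      (C : Type) (_ : AddCommGroup C) (_ : Module ℂ C) (_ : FiniteDimensional ℂ C)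
      (β : Representation ℂ K B) (γ : Representation ℂ R C), Irr β ∧ Irr γ ∧
      Module.finrank ℂ A = Module.finrank ℂ B * Module.finrank ℂ C ∧
      ∀ k r, LinearMap.trace ℂ A (σ (k, r)) = LinearMap.trace ℂ B (β k) * LinearMap.trace ℂ C (γ r) := by
  let σK : Representation ℂ K A := σ.comp (MonoidHom.inl K R)
  have := hσ.nontrivial
  obtain ⟨Bs, -, hB⟩ := exists_simp σK (top_ne_bot) (RInv.top _)
  let β := subrep σK Bs hB.2.1
  let Hs : Submodule ℂ (Bs →ₗ[ℂ] A) :=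
    { carrier := {h | ∀ k (a : Bs), h (β k a) = σK k (h a)}
      add_mem' := fun {a b} ha hb n x => by simp only [LinearMap.add_apply, ha n x, hb n x, map_add]
      zero_mem' := fun n x => by simp
      smul_mem' := fun c a ha n x => by simp only [LinearMap.smul_apply, ha n x, map_smul] }
  let τ : Representation ℂ R (Bs →ₗ[ℂ] A) :=
    { toFun := fun r => 
        { toFun := fun h => σ (1, r) ∘ₗ h
          map_add' := fun a b => by ext; simp
          map_smul' := fun c a => by ext; simp }
      map_one' := by
        refine LinearMap.ext fun h => LinearMap.ext fun v => ?_
        change σ 1 (h v) = h v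
        simp
      map_mul' := fun a b => by
        refine LinearMap.ext fun h => LinearMap.ext fun v => ?_
        change σ (1, a * b) (h v) = σ (1, a) (σ (1, b) (h v))
        rw [← rho_mul]; simp }
  have hcomm : ∀ k r v, σ (1, r) (σK k v) = σK k (σ (1, r) v) := by
    intro k r v
    change σ (1, r) (σ (k, 1) v) = σ (k, 1) (σ (1, r) v)
    rw [← rho_mul, ← rho_mul]; simp
  have hHs : RInv τ Hs := by
    intro r h hh k a
    change σ (1, r) (h (β k a)) = σK k (σ (1, r) (h a))
    rw [hh, hcomm]
  have hs : Hs ≠ ⊥ := by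
    intro h0
    have h1 : Bs.subtype ∈ Hs := fun n a => rfl
    rw [h0, Submodule.mem_bot] at h1
    apply hB.1
    rw [eq_bot_iff]
    intro v hv
    exact LinearMap.congr_fun h1 ⟨v, hv⟩
  obtain ⟨Cs, hCH, hC⟩ := exists_simp τ hs hHs
  let γ := subrep τ Cs hC.2.1
  let e : Bs ⊗[ℂ] Cs →ₗ[ℂ] A := TensorProduct.lift (Cs.subtype.flip)
  have he : ∀ b (h : Cs), e (b ⊗ₜ h) = (h : Bs →ₗ[ℂ] A) b := fun b h => rfl
  have hequiv : ∀ g x, e (tens β γ g x) = σ g (e x) := by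
    rintro ⟨k, r⟩ x
    induction x using TensorProduct.induction_on with
    | zero => simp
    | add x y hx hy => rw [map_add, map_add, hx, hy, map_add, map_add]
    | tmul b h =>
      change σ (1, r) ((h : Bs →ₗ[ℂ] A) (β k b)) = σ (k, r) ((h : Bs →ₗ[ℂ] A) b)
      rw [hCH h.2 k b]
      change σ (1, r) (σ (k, 1) _) = _
      rw [← rho_mul]; simp
  have he0 : e ≠ 0 := by
    intro h0
    apply hC.1
    rw [eq_bot_iff]
    intro h hh
    rw [Submodule.mem_bot]
    ext b
    exact LinearMap.congr_fun h0 (b ⊗ₜ ⟨h, hh⟩)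
  have hbij : Function.Bijective e := ⟨(tens_irr hB.irr hC.irr).inj e hequiv he0, hσ.surj e hequiv he0⟩
  let E := LinearEquiv.ofBijective e hbij
  refine ⟨Bs, inferInstance, inferInstance, inferInstance, Cs, inferInstance, inferInstance, inferInstance, β, γ,
    hB.irr, hC.irr, ?_, ?_⟩
  · rw [← LinearEquiv.finrank_eq E, Module.finrank_tensorProduct]
  · intro k r
    have h1 : σ (k, r) = E.conj (tens β γ (k, r)) := by
      ext v
      obtain ⟨w, rfl⟩ := E.surjective v
      simp only [LinearEquiv.conj_apply_apply, LinearEquiv.symm_apply_apply]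
      exact (hequiv _ _).symm
    rw [h1, LinearMap.trace_conj']
    exact congrFun (Representation.char_tensor (β.comp (MonoidHom.fst K R)) (γ.comp (MonoidHom.snd K R))) (k, r)

theorem trace_compl {V : Type*} [AddCommGroup V] [Module ℂ V] [FiniteDimensional ℂ V] {p q : Submodule ℂ V}
    (h : IsCompl p q) (f : V →ₗ[ℂ] V) (hp : ∀ v ∈ p, f v ∈ p) (hq : ∀ v ∈ q, f v ∈ q) :
    LinearMap.trace ℂ V f = LinearMap.trace ℂ p (f.restrict hp) + LinearMap.trace ℂ q (f.restrict hq) := by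
  let N : Bool → Submodule ℂ V := fun b => if b then p else q
  have hN : DirectSum.IsInternal N := by
    rw [DirectSum.isInternal_submodule_iff_isCompl N (i := true) (j := false) (by simp) (by ext x; cases x <;> simp)]
    exact h
  have hf : ∀ i, Set.MapsTo f (N i) (N i) := by rintro (_ | _); exacts [hq, hp]
  rw [LinearMap.trace_eq_sum_trace_restrict hN hf, Fintype.sum_bool]
  rfl

theorem trace_prod_congr {K R : Type*} [Group K] [Group R] [Finite K] [Finite R] (x y : K) (z : R)
    (h : ∀ (V : Type) [AddCommGroup V] [Module ℂ V] [FiniteDimensional ℂ V] (ρ : Representation ℂ K V), Irr ρ →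
      LinearMap.trace ℂ V (ρ x) = LinearMap.trace ℂ V (ρ y)) :
    ∀ (d : ℕ) (A : Type) [AddCommGroup A] [Module ℂ A] [FiniteDimensional ℂ A]
      (σ : Representation ℂ (K × R) A), Module.finrank ℂ A = d →
      LinearMap.trace ℂ A (σ (x, z)) = LinearMap.trace ℂ A (σ (y, z)) := by
  intro d
  induction d using Nat.strong_induction_on with
  | _ d ih =>
    intro A _ _ _ σ hd
    by_cases hnt : Nontrivial A
    · obtain ⟨p, -, hp⟩ := exists_simp σ (top_ne_bot) (RInv.top _)
      obtain ⟨q, hq, hc⟩ := maschke σ hp.2.1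
      rw [trace_compl hc (σ (x, z)) (hp.2.1 _) (hq _), trace_compl hc (σ (y, z)) (hp.2.1 _) (hq _)]
      congr 1
      · obtain ⟨B, _, _, _, C, _, _, _, β, γ, hβ, hγ, -, ht⟩ := prod_decomp hp.irr
        have h1 := ht x z
        have h2 := ht y z
        rw [h B β hβ, ← h2] at h1
        exact h1
      · refine ih _ ?_ q (subrep σ q hq) rfl
        have h1 := Submodule.finrank_add_eq_of_isCompl hc
        have := hp.irr.nontrivial
        have h2 : 0 < Module.finrank ℂ p := Module.finrank_pos
        omega
    · rw [not_nontrivial_iff_subsingleton] at hnt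
      rw [Subsingleton.elim (σ (x, z)) (σ (y, z))]

theorem trace_perm {X : Type*} [Fintype X] [DecidableEq X] (s : Equiv.Perm X) (T : (X → ℂ) →ₗ[ℂ] (X → ℂ))
    (hT : ∀ F x, T F x = F (s x)) : LinearMap.trace ℂ (X → ℂ) T = (Finset.univ.filter (fun x => s x = x)).card := by
  rw [LinearMap.trace_eq_matrix_trace ℂ (Pi.basisFun ℂ X)]
  simp only [Matrix.trace, Matrix.diag, LinearMap.toMatrix_apply, Pi.basisFun_repr, Pi.basisFun_apply, hT]
  simp [Pi.single_apply]

theorem separation {K : Type} [Group K] [Finite K] (x y : K)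
    (h : ∀ (V : Type) [AddCommGroup V] [Module ℂ V] [FiniteDimensional ℂ V] (ρ : Representation ℂ K V), Irr ρ →
      LinearMap.trace ℂ V (ρ x) = LinearMap.trace ℂ V (ρ y)) : IsConj x y := by
  classical
  have := Fintype.ofFinite K
  let τ : Representation ℂ (K × K) (K → ℂ) :=
    { toFun := fun g => { toFun := fun F k => F (g.1⁻¹ * k * g.2), map_add' := fun _ _ => rfl, map_smul' := fun _ _ => rfl }
      map_one' := by ext; simp
      map_mul' := fun a b => by ext; simp [mul_assoc] }
  have h1 := trace_prod_congr x y y h _ (K → ℂ) τ rfl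
  let s : K → K → Equiv.Perm K := fun a b => (Equiv.mulLeft a⁻¹).trans (Equiv.mulRight b)
  rw [trace_perm (s x y) (τ (x, y)) (fun F k => rfl), trace_perm (s y y) (τ (y, y)) (fun F k => rfl)] at h1
  norm_cast at h1
  have h2 : 0 < (Finset.univ.filter (fun k => s y y k = k)).card :=
    Finset.card_pos.2 ⟨1, Finset.mem_filter.2 ⟨Finset.mem_univ _, by simp [s]⟩⟩
  rw [← h1] at h2
  obtain ⟨k, hk⟩ := Finset.card_pos.1 h2
  have hk2 : x⁻¹ * k * y = k := (Finset.mem_filter.1 hk).2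
  rw [isConj_iff]
  refine ⟨k⁻¹, ?_⟩
  have : x * k = k * y := by
    rw [mul_assoc, inv_mul_eq_iff_eq_mul] at hk2
    exact hk2.symm
  rw [inv_inv, mul_assoc, this, inv_mul_cancel_left]
end ModC

section ModD

abbrev SL (F : Type) [Field F] := Matrix.SpecialLinearGroup (Fin 2) F

section sl2
variable {F : Type} [Field F]

theorem SL.ext' {g h : SL F} (h00 : g 0 0 = h 0 0) (h01 : g 0 1 = h 0 1) (h10 : g 1 0 = h 1 0) (h11 : g 1 1 = h 1 1) :
    g = h := by
  ext i j
  fin_cases i <;> fin_cases j <;> assumption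

theorem SL.det' (g : SL F) : g 0 0 * g 1 1 - g 0 1 * g 1 0 = 1 := by
  rw [← Matrix.det_fin_two]; exact g.2

/-- constructor -/
def SL.mk4 (a b c d : F) (h : a * d - b * c = 1) : SL F := ⟨!![a, b; c, d], by rw [Matrix.det_fin_two_of]; exact h⟩

@[simp] theorem SL.mk4_00 (a b c d : F) (h : a * d - b * c = 1) : (SL.mk4 a b c d h) 0 0 = a := rfl
@[simp] theorem SL.mk4_01 (a b c d : F) (h : a * d - b * c = 1) : (SL.mk4 a b c d h) 0 1 = b := rfl
@[simp] theorem SL.mk4_10 (a b c d : F) (h : a * d - b * c = 1) : (SL.mk4 a b c d h) 1 0 = c := rfl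
@[simp] theorem SL.mk4_11 (a b c d : F) (h : a * d - b * c = 1) : (SL.mk4 a b c d h) 1 1 = d := rfl

theorem SL.mul00 (g h : SL F) : (g * h) 0 0 = g 0 0 * h 0 0 + g 0 1 * h 1 0 := by
  simp [Matrix.mul_apply, Fin.sum_univ_two]
theorem SL.mul01 (g h : SL F) : (g * h) 0 1 = g 0 0 * h 0 1 + g 0 1 * h 1 1 := by
  simp [Matrix.mul_apply, Fin.sum_univ_two]
theorem SL.mul10 (g h : SL F) : (g * h) 1 0 = g 1 0 * h 0 0 + g 1 1 * h 1 0 := by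
  simp [Matrix.mul_apply, Fin.sum_univ_two]
theorem SL.mul11 (g h : SL F) : (g * h) 1 1 = g 1 0 * h 0 1 + g 1 1 * h 1 1 := by
  simp [Matrix.mul_apply, Fin.sum_univ_two]
theorem SL.inv00 (g : SL F) : (g⁻¹) 0 0 = g 1 1 := by simp [Matrix.adjugate_fin_two]
theorem SL.inv01 (g : SL F) : (g⁻¹) 0 1 = - g 0 1 := by simp [Matrix.adjugate_fin_two]
theorem SL.inv10 (g : SL F) : (g⁻¹) 1 0 = - g 1 0 := by simp [Matrix.adjugate_fin_two]
theorem SL.inv11 (g : SL F) : (g⁻¹) 1 1 = g 0 0 := by simp [Matrix.adjugate_fin_two]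
theorem SL.one00 : (1 : SL F) 0 0 = 1 := by simp
theorem SL.one01 : (1 : SL F) 0 1 = 0 := by simp
theorem SL.one10 : (1 : SL F) 1 0 = 0 := by simp
theorem SL.one11 : (1 : SL F) 1 1 = 1 := by simp

/-- upper unipotent -/
def uu (x : F) : SL F := SL.mk4 1 x 0 1 (by ring)
/-- lower unipotent -/
def ll (x : F) : SL F := SL.mk4 1 0 x 1 (by ring)
/-- torus -/
def tt (a : Fˣ) : SL F := SL.mk4 a 0 0 (a⁻¹ : Fˣ) (by simp)
/-- antidiagonal -/
def nn (a : Fˣ) : SL F := SL.mk4 0 (-(a⁻¹ : Fˣ)) a 0 (by simp)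

@[simp] theorem uu00 (x : F) : (uu x) 0 0 = 1 := rfl
@[simp] theorem uu01 (x : F) : (uu x) 0 1 = x := rfl
@[simp] theorem uu10 (x : F) : (uu x) 1 0 = 0 := rfl
@[simp] theorem uu11 (x : F) : (uu x) 1 1 = 1 := rfl
@[simp] theorem ll00 (x : F) : (ll x) 0 0 = 1 := rfl
@[simp] theorem ll01 (x : F) : (ll x) 0 1 = 0 := rfl
@[simp] theorem ll10 (x : F) : (ll x) 1 0 = x := rfl
@[simp] theorem ll11 (x : F) : (ll x) 1 1 = 1 := rfl
@[simp] theorem tt00 (x : Fˣ) : (tt x) 0 0 = x := rfl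
@[simp] theorem tt01 (x : Fˣ) : (tt x) 0 1 = 0 := rfl
@[simp] theorem tt10 (x : Fˣ) : (tt x) 1 0 = 0 := rfl
@[simp] theorem tt11 (x : Fˣ) : (tt x) 1 1 = (x⁻¹ : Fˣ) := rfl
@[simp] theorem nn00 (x : Fˣ) : (nn x) 0 0 = 0 := rfl
@[simp] theorem nn01 (x : Fˣ) : (nn x) 0 1 = -(x⁻¹ : Fˣ) := rfl
@[simp] theorem nn10 (x : Fˣ) : (nn x) 1 0 = x := rfl
@[simp] theorem nn11 (x : Fˣ) : (nn x) 1 1 = 0 := rfl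

theorem uu_add (x y : F) : uu (x + y) = uu x * uu y := by
  apply SL.ext' <;> simp only [SL.mul00, SL.mul01, SL.mul10, SL.mul11, uu00, uu01, uu10, uu11] <;> ring
theorem uu_zero : uu (0 : F) = 1 := by
  apply SL.ext' <;> simp [uu00, uu01, uu10, uu11]
theorem uu_neg (x : F) : uu (-x) = (uu x)⁻¹ := by
  rw [eq_inv_iff_mul_eq_one, ← uu_add]; simp [uu_zero]
theorem uu_inj : Function.Injective (uu : F → SL F) := fun x y h => by
  have := congrArg (fun g : SL F => g 0 1) h; simpa using this
theorem ll_add (x y : F) : ll (x + y) = ll x * ll y := by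
  apply SL.ext' <;> simp only [SL.mul00, SL.mul01, SL.mul10, SL.mul11, ll00, ll01, ll10, ll11] <;> ring
theorem ll_zero : ll (0 : F) = 1 := by
  apply SL.ext' <;> simp [ll00, ll01, ll10, ll11]
theorem ll_inj : Function.Injective (ll : F → SL F) := fun x y h => by
  have := congrArg (fun g : SL F => g 1 0) h; simpa using this
theorem tt_mul (a b : Fˣ) : tt (a * b) = tt a * tt b := by
  apply SL.ext' <;> simp only [SL.mul00, SL.mul01, SL.mul10, SL.mul11, tt00, tt01, tt10, tt11, mul_inv, Units.val_mul] <;> ring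
theorem tt_one : tt (1 : Fˣ) = 1 := by
  apply SL.ext' <;> simp
theorem tt_inv (a : Fˣ) : tt a⁻¹ = (tt a)⁻¹ := by
  rw [eq_inv_iff_mul_eq_one, ← tt_mul]; simp [tt_one]
theorem tt_inj : Function.Injective (tt : Fˣ → SL F) := fun x y h => by
  have := congrArg (fun g : SL F => g 0 0) h; exact Units.ext (by simpa using this)

theorem tt_uu (a : Fˣ) (x : F) : tt a * uu x = uu (a ^ 2 * x) * tt a := by
  apply SL.ext' <;> simp only [SL.mul00, SL.mul01, SL.mul10, SL.mul11, tt00, tt01, tt10, tt11, uu00, uu01, uu10, uu11]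
  · ring
  · have : (a : F) * (a⁻¹ : Fˣ) = 1 := by simp
    linear_combination (-(a : F) * x) * this
  · ring
  · ring

theorem tt_ll (a : Fˣ) (x : F) : tt a * ll ((a : F) ^ 2 * x) = ll x * tt a := by
  have h : (a : F) * (a⁻¹ : Fˣ) = 1 := by simp
  apply SL.ext' <;> simp only [SL.mul00, SL.mul01, SL.mul10, SL.mul11, tt00, tt01, tt10, tt11, ll00, ll01, ll10, ll11]
  · ring
  · ring
  · linear_combination (a : F) * x * h
  · ring

theorem nn_uu (a : Fˣ) (x : F) : nn a * uu x = ll (-(a : F) ^ 2 * x) * nn a := by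
  have h : (a : F) * (a⁻¹ : Fˣ) = 1 := by simp
  apply SL.ext' <;> simp only [SL.mul00, SL.mul01, SL.mul10, SL.mul11, nn00, nn01, nn10, nn11, ll00, ll01, ll10, ll11,
    uu00, uu01, uu10, uu11]
  · ring
  · ring
  · ring
  · linear_combination (-(a : F) * x) * h

/-- Borel subgroup -/
def BB (F : Type) [Field F] : Subgroup (SL F) where
  carrier := {g | g 1 0 = 0}
  one_mem' := SL.one10
  mul_mem' {a b} ha hb := by
    change (a * b) 1 0 = 0
    have ha : a 1 0 = 0 := ha
    have hb : b 1 0 = 0 := hb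
    rw [SL.mul10, ha, hb]; ring
  inv_mem' {a} ha := by
    change (a⁻¹) 1 0 = 0
    have ha : a 1 0 = 0 := ha
    rw [SL.inv10, ha, neg_zero]

theorem mem_BB {g : SL F} : g ∈ BB F ↔ g 1 0 = 0 := Iff.rfl

/-- unipotent subgroup -/
def UU (F : Type) [Field F] : Subgroup (SL F) where
  carrier := Set.range uu
  one_mem' := ⟨0, uu_zero⟩
  mul_mem' := by rintro _ _ ⟨x, rfl⟩ ⟨y, rfl⟩; exact ⟨x + y, uu_add x y⟩
  inv_mem' := by rintro _ ⟨x, rfl⟩; exact ⟨-x, uu_neg x⟩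

theorem uu_mem (x : F) : uu x ∈ UU F := ⟨x, rfl⟩

theorem BB_decomp {g : SL F} (hg : g ∈ BB F) : ∃ a x, g = uu x * tt a := by
  have h1 := SL.det' g
  rw [mem_BB.1 hg] at h1
  have h2 : g 0 0 * g 1 1 = 1 := by linear_combination h1
  refine ⟨⟨g 0 0, g 1 1, h2, by rw [mul_comm]; exact h2⟩, g 0 1 * g 0 0, ?_⟩
  have := mem_BB.1 hg
  apply SL.ext' <;> simp only [SL.mul00, SL.mul01, SL.mul10, SL.mul11, tt00, tt01, tt10, tt11, uu00, uu01, uu10, uu11]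
  · ring
  · simp only [Units.inv_mk]; linear_combination (-(g 0 1)) * h2
  · rw [this]; ring
  · simp only [Units.inv_mk]; ring

theorem UU_le_BB : UU F ≤ BB F := by rintro _ ⟨x, rfl⟩; exact mem_BB.2 rfl
theorem tt_mem_BB (a : Fˣ) : tt a ∈ BB F := mem_BB.2 rfl

theorem BB_norm {g : SL F} (hg : g ∈ BB F) {u : SL F} (hu : u ∈ UU F) : g * u * g⁻¹ ∈ UU F := by
  obtain ⟨a, x, rfl⟩ := BB_decomp hg
  obtain ⟨y, rfl⟩ := hu
  refine ⟨x + a ^ 2 * y - x, ?_⟩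
  rw [sub_eq_add_neg, uu_add, uu_add, uu_neg, mul_inv_rev, mul_assoc (uu x) (tt a), tt_uu]; group

theorem bruhat {g : SL F} (hg : g 1 0 ≠ 0) : g = uu ((g 0 0 - 1) / g 1 0) * ll (g 1 0) * uu ((g 1 1 - 1) / g 1 0) := by
  have h1 := SL.det' g
  apply SL.ext' <;> simp only [SL.mul00, SL.mul01, SL.mul10, SL.mul11, ll00, ll01, ll10, ll11, uu00, uu01, uu10, uu11] <;>
  field_simp
  · ring
  · linear_combination -h1
  · ring
  · ring

theorem bruhat' {g : SL F} (c : Fˣ) (hg : g 1 0 = c) : g = uu (g 0 0 / c) * nn c * uu (g 1 1 / c) := by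
  have h1 := SL.det' g
  rw [hg] at h1
  apply SL.ext' <;> simp only [SL.mul00, SL.mul01, SL.mul10, SL.mul11, nn00, nn01, nn10, nn11, uu00, uu01, uu10, uu11,
    Units.val_inv_eq_inv_val] <;>
  field_simp
  · ring
  · linear_combination -h1
  · rw [hg]; ring
  · ring

theorem gen_UL {H : Subgroup (SL F)} (hU : ∀ x, uu x ∈ H) (hL : ∀ x, ll x ∈ H) : H = ⊤ := by
  rw [eq_top_iff]
  intro g _
  by_cases hg : g 1 0 = 0
  · have h2 : ll 1 * g ∈ H := by
      rw [bruhat (g := ll 1 * g) ?_]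
      · exact H.mul_mem (H.mul_mem (hU _) (hL _)) (hU _)
      · rw [SL.mul10, hg]
        have h1 := SL.det' g
        rw [hg] at h1
        intro h0
        simp at h0
        rw [h0] at h1; simp at h1
    exact (H.mul_mem_cancel_left (hL 1)).1 h2
  · rw [bruhat hg]
    exact H.mul_mem (H.mul_mem (hU _) (hL _)) (hU _)

theorem gen_U {H : Subgroup (SL F)} (hU : UU F ≤ H) (hB : ¬ H ≤ BB F) : H = ⊤ := by
  have hU' : ∀ x, uu x ∈ H := fun x => hU (uu_mem x)
  obtain ⟨g, hgH, hgB⟩ := SetLike.not_le_iff_exists.1 hB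
  rw [mem_BB] at hgB
  let c : Fˣ := Units.mk0 _ hgB
  have hn : nn c ∈ H := by
    have h1 := bruhat' c (g := g) rfl
    rw [h1] at hgH
    exact (H.mul_mem_cancel_left (hU' _)).1 ((H.mul_mem_cancel_right (hU' _)).1 hgH)
  refine gen_UL hU' fun x => ?_
  have h2 := nn_uu c (-x / (c : F) ^ 2)
  have h3 : -(c : F) ^ 2 * (-x / (c : F) ^ 2) = x := by field_simp
  rw [h3] at h2
  have h4 : ll x = nn c * uu (-x / (c : F) ^ 2) * (nn c)⁻¹ := by rw [h2]; group
  rw [h4]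
  exact H.mul_mem (H.mul_mem hn (hU' _)) (H.inv_mem hn)

theorem conj_u_entry (g : SL F) (x : F) : (g⁻¹ * uu x * g) 1 0 = - x * (g 1 0) ^ 2 := by
  simp only [SL.mul00, SL.mul01, SL.mul10, SL.mul11, SL.inv00, SL.inv01, SL.inv10, SL.inv11, uu00, uu01, uu10, uu11]
  ring

theorem exists_unit_sq_ne (h3 : 4 ≤ Nat.card F) [CharP F 2] : ∃ a : Fˣ, (a : F) ^ 2 ≠ 1 := by
  by_contra! hh
  have h1 : ∀ a : Fˣ, a = 1 := fun a => by
    have := hh a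
    have h2 : ((a : F) - 1) ^ 2 = 0 := by
      have h0 : (2 : F) = 0 := CharTwo.two_eq_zero
      linear_combination this + (1 - (a : F)) * h0
    exact Units.ext (by simpa [sub_eq_zero] using h2)
  have h2 : Nat.card Fˣ = 1 := Nat.card_eq_one_iff_unique.2 ⟨⟨fun a b => by rw [h1 a, h1 b]⟩, ⟨1⟩⟩
  have := Nat.card_units F
  omega

open scoped commutatorElement in
theorem perfect_SL (h3 : 4 ≤ Nat.card F) [CharP F 2] : commutator (SL F) = ⊤ := by
  obtain ⟨a, ha⟩ := exists_unit_sq_ne (F := F) h3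
  have ha' : (a : F) ^ 2 - 1 ≠ 0 := sub_ne_zero.2 ha
  have hU : ∀ x, uu x ∈ commutator (SL F) := by
    intro x
    have h1 : uu x = ⁅tt a, uu (x / ((a : F) ^ 2 - 1))⁆ := by
      rw [commutatorElement_def, tt_uu, mul_assoc (uu _), mul_inv_cancel, mul_one, ← uu_neg, ← uu_add]
      congr 1
      field_simp
      ring
    rw [h1]
    exact Subgroup.commutator_mem_commutator (Subgroup.mem_top _) (Subgroup.mem_top _)
  refine gen_UL hU fun x => ?_
  have h2 : ll x = nn 1 * uu (-x) * (nn 1)⁻¹ := by rw [nn_uu]; simp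
  rw [h2]
  exact (inferInstance : (commutator (SL F)).Normal).conj_mem _ (hU _) _
end sl2
end ModD

section ModE

section cnt
variable {F : Type} [Field F]

theorem UU_card : Nat.card (UU F) = Nat.card F := by
  refine (Nat.card_congr (Equiv.ofBijective (fun x : F => (⟨uu x, uu_mem x⟩ : UU F)) ⟨?_, ?_⟩)).symm
  · intro x y h; exact uu_inj (congrArg Subtype.val h)
  · rintro ⟨_, x, rfl⟩; exact ⟨x, rfl⟩

theorem BB_card [Finite F] : Nat.card (BB F) = Nat.card F * (Nat.card F - 1) := by
  rw [← Nat.card_units, ← Nat.card_prod]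
  refine (Nat.card_congr (Equiv.ofBijective
    (fun p : F × Fˣ => (⟨uu p.1 * tt p.2, (BB F).mul_mem (UU_le_BB (uu_mem _)) (tt_mem_BB _)⟩ : BB F)) ⟨?_, ?_⟩)).symm
  · rintro ⟨x, a⟩ ⟨y, b⟩ h
    have h1 : uu x * tt a = uu y * tt b := congrArg Subtype.val h
    have h2 : a = b := by
      have := congrArg (fun g : SL F => g 0 0) h1
      simp only [SL.mul00, uu00, uu01, tt00, tt10] at this
      exact Units.ext (by simpa using this)
    subst h2
    have := uu_inj (mul_right_cancel h1)
    rw [this]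
  · rintro ⟨g, hg⟩
    obtain ⟨a, x, rfl⟩ := BB_decomp hg
    exact ⟨(x, a), rfl⟩

theorem SL_card [Finite F] : Nat.card (SL F) = (Nat.card F + 1) * (Nat.card F * (Nat.card F - 1)) := by
  have h : Nat.card (BB F ⊕ (F × Fˣ × F)) = (Nat.card F + 1) * (Nat.card F * (Nat.card F - 1)) := by
    rw [Nat.card_sum, Nat.card_prod, Nat.card_prod, BB_card, Nat.card_units]; ring
  rw [← h]
  refine (Nat.card_congr (Equiv.ofBijective
    (Sum.elim (fun b : BB F => (b : SL F)) (fun p : F × Fˣ × F => uu p.1 * nn p.2.1 * uu p.2.2)) ⟨?_, ?_⟩)).symm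
  · have e10 : ∀ p : F × Fˣ × F, (uu p.1 * nn p.2.1 * uu p.2.2) 1 0 = p.2.1 := by
      intro p; simp [SL.mul10, SL.mul11, SL.mul00, SL.mul01]
    have e00 : ∀ p : F × Fˣ × F, (uu p.1 * nn p.2.1 * uu p.2.2) 0 0 = p.1 * p.2.1 := by
      intro p; simp [SL.mul10, SL.mul11, SL.mul00, SL.mul01]
    have e11 : ∀ p : F × Fˣ × F, (uu p.1 * nn p.2.1 * uu p.2.2) 1 1 = p.2.1 * p.2.2 := by
      intro p; simp [SL.mul10, SL.mul11, SL.mul00, SL.mul01]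
    rintro (b | p) (b' | p') hh
    · simp only [Sum.elim_inl] at hh; rw [Subtype.ext hh]
    · exfalso
      simp only [Sum.elim_inl, Sum.elim_inr] at hh
      have := e10 p'
      rw [← hh, mem_BB.1 b.2] at this
      exact p'.2.1.ne_zero this.symm
    · exfalso
      simp only [Sum.elim_inl, Sum.elim_inr] at hh
      have := e10 p
      rw [hh, mem_BB.1 b'.2] at this
      exact p.2.1.ne_zero this.symm
    · simp only [Sum.elim_inr] at hh
      have h1 : p.2.1 = p'.2.1 := Units.ext (by rw [← e10, ← e10, hh])
      have h2 : p.1 * p.2.1 = p'.1 * p'.2.1 := by rw [← e00, ← e00, hh]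
      have h3 : p.2.1 * p.2.2 = p'.2.1 * p'.2.2 := by rw [← e11, ← e11, hh]
      rw [← h1] at h2 h3
      have h4 := mul_right_cancel₀ p.2.1.ne_zero h2
      have h5 := mul_left_cancel₀ p.2.1.ne_zero h3
      congr 1
      exact Prod.ext h4 (Prod.ext h1 h5)
  · intro g
    by_cases hg : g 1 0 = 0
    · exact ⟨Sum.inl ⟨g, hg⟩, rfl⟩
    · exact ⟨Sum.inr (g 0 0 / g 1 0, Units.mk0 _ hg, g 1 1 / g 1 0), (bruhat' (Units.mk0 _ hg) rfl).symm⟩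

theorem BB_index [Finite F] : (BB F).index = Nat.card F + 1 := by
  have h1 := (BB F).card_mul_index
  rw [SL_card, BB_card, mul_comm] at h1
  have : 1 < Nat.card F := Finite.one_lt_card
  exact Nat.eq_of_mul_eq_mul_right (Nat.mul_pos (by omega) (by omega)) h1

theorem u_fix {x : F} {c : SL F ⧸ BB F} (h : uu x • c = c) : c = ((1 : SL F) : SL F ⧸ BB F) ∨ x = 0 := by
  obtain ⟨g, rfl⟩ := QuotientGroup.mk_surjective c
  have h1 : ((uu x * g : SL F) : SL F ⧸ BB F) = (g : SL F ⧸ BB F) := h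
  rw [eq_comm, QuotientGroup.eq, ← mul_assoc, mem_BB, conj_u_entry] at h1
  rcases mul_eq_zero.1 h1 with h2 | h2
  · right; simpa using h2
  · left
    rw [QuotientGroup.eq]
    refine mem_BB.2 ?_
    rw [mul_one, SL.inv10]
    rw [pow_eq_zero_iff two_ne_zero] at h2
    rw [h2, neg_zero]

/-- split traces -/
def Sp (F : Type) [Field F] : Set F := {s | ∃ a : Fˣ, s = a + (a⁻¹ : Fˣ)}

theorem trace_conj_SL (g x : SL F) : (g⁻¹ * x * g) 0 0 + (g⁻¹ * x * g) 1 1 = x 0 0 + x 1 1 := by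
  simp only [SL.mul00, SL.mul01, SL.mul10, SL.mul11, SL.inv00, SL.inv01, SL.inv10, SL.inv11]
  have := SL.det' g
  linear_combination (x 0 0 + x 1 1) * this

/-- nonsplit elements -/
def NSp (x : SL F) : Prop := ∀ g : SL F, g⁻¹ * x * g ∉ BB F

theorem NSp_of_trace {x : SL F} (h : x 0 0 + x 1 1 ∉ Sp F) : NSp x := by
  intro g hg
  obtain ⟨a, y, hb⟩ := BB_decomp hg
  apply h
  refine ⟨a, ?_⟩
  rw [← trace_conj_SL g x, hb]
  simp [SL.mul00, SL.mul01, SL.mul10, SL.mul11]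

/-- element of given trace -/
def ofTr [CharP F 2] (s : F) : SL F := SL.mk4 0 1 1 s (by rw [zero_mul, zero_sub, mul_one]; exact CharTwo.neg_eq 1)

variable [CharP F 2]

theorem plus_inv_eq {a b : Fˣ} (h : (a : F) + (a⁻¹ : Fˣ) = b + (b⁻¹ : Fˣ)) : a = b ∨ a = b⁻¹ := by
  have h1 : ((a : F) - b) * ((a : F) * b - 1) = 0 := by
    have e1 : (a : F) * (a⁻¹ : Fˣ) = 1 := by simp
    have e2 : (b : F) * (b⁻¹ : Fˣ) = 1 := by simp
    linear_combination ((a : F) * b) * h - (b : F) * e1 + (a : F) * e2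
  rcases mul_eq_zero.1 h1 with h2 | h2
  · left; exact Units.ext (sub_eq_zero.1 h2)
  · right; rw [eq_inv_iff_mul_eq_one]; exact Units.ext (by simpa using sub_eq_zero.1 h2)

theorem Sp_card [Finite F] : 2 * (Sp F).ncard = Nat.card F := by
  classical
  have := Fintype.ofFinite F
  have hq : 1 < Nat.card F := Finite.one_lt_card
  have h0 : (0 : F) ∈ Sp F := ⟨1, by simp [CharTwo.add_self_eq_zero]⟩
  let T : Finset F := (Finset.univ : Finset Fˣ).image (fun a : Fˣ => (a : F) + (a⁻¹ : Fˣ))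
  have hT : (T : Set F) = Sp F := by
    ext s; simp [T, Sp, eq_comm]
  have hT' : (Sp F).ncard = T.card := by rw [← hT, Set.ncard_coe_finset]
  have h1 := Finset.card_eq_sum_card_image (fun a : Fˣ => (a : F) + (a⁻¹ : Fˣ)) (Finset.univ : Finset Fˣ)
  change _ = ∑ b ∈ T, _ at h1
  have h0T : (0 : F) ∈ T := by
    have : (0 : F) ∈ (T : Set F) := by rw [hT]; exact h0
    exact this
  have inv1 : ∀ a : Fˣ, a = a⁻¹ → a = 1 := by
    intro a ha
    have h2 : (a : F) * a = 1 := by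
      have := congrArg (fun z : Fˣ => (z : F) * a) ha
      simpa using this
    have h3 : ((a : F) - 1) ^ 2 = 0 := by
      have h0 : (2 : F) = 0 := CharTwo.two_eq_zero
      linear_combination h2 + (1 - (a : F)) * h0
    exact Units.ext (by simpa [sub_eq_zero] using h3)
  rw [← Finset.add_sum_erase _ _ h0T] at h1
  have hz : (Finset.univ.filter (fun a : Fˣ => (a : F) + (a⁻¹ : Fˣ) = 0)).card = 1 := by
    rw [Finset.card_eq_one]
    refine ⟨1, ?_⟩
    ext a
    rw [Finset.mem_filter, Finset.mem_singleton]
    constructor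
    · rintro ⟨-, h⟩
      exact inv1 a (Units.ext (CharTwo.add_eq_zero.1 h))
    · rintro rfl; simp [CharTwo.add_self_eq_zero]
  have hnz : ∀ b ∈ T.erase 0, (Finset.univ.filter (fun a : Fˣ => (a : F) + (a⁻¹ : Fˣ) = b)).card = 2 := by
    intro b hb
    obtain ⟨hb0, hbT⟩ := Finset.mem_erase.1 hb
    obtain ⟨a, -, rfl⟩ := Finset.mem_image.1 hbT
    rw [Finset.card_eq_two]
    refine ⟨a, a⁻¹, ?_, ?_⟩
    · intro h
      rw [inv1 a h] at hb0
      simp [CharTwo.add_self_eq_zero] at hb0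
    · ext c
      rw [Finset.mem_filter, Finset.mem_insert, Finset.mem_singleton]
      constructor
      · rintro ⟨-, h⟩; exact plus_inv_eq h
      · rintro (rfl | rfl)
        · simp
        · simp [add_comm]
  rw [hz, Finset.sum_congr rfl hnz, Finset.sum_const, smul_eq_mul, Finset.card_erase_of_mem h0T, Finset.card_univ,
    ← Nat.card_eq_fintype_card, Nat.card_units] at h1
  have : 0 < T.card := Finset.card_pos.2 ⟨0, h0T⟩
  omega
end cnt
end ModE

section ModF

section irrS
variable {F : Type} [Field F] [Fintype F] {V : Type*} [AddCommGroup V] [Module ℂ V]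

/-- projections to the eigenspaces of the unipotent subgroup -/
noncomputable def ee (ψ : AddChar F ℂ) (ρ : Representation ℂ (SL F) V) (r : F) : Module.End ℂ V :=
  (Fintype.card F : ℂ)⁻¹ • ∑ x, ψ (-(r * x)) • (ρ (uu x) : Module.End ℂ V)

variable (ψ : AddChar F ℂ) (ρ : Representation ℂ (SL F) V)

theorem ee_uu (r y : F) : ee ψ ρ r * ρ (uu y) = ψ (r * y) • ee ψ ρ r := by
  rw [ee, smul_mul_assoc, smul_comm]
  congr 1
  rw [Finset.sum_mul, Finset.smul_sum]
  refine Fintype.sum_equiv (Equiv.addRight y) _ _ fun x => ?_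
  rw [smul_mul_assoc, ← map_mul, ← uu_add, smul_smul, ← AddChar.map_add_eq_mul]
  simp only [Equiv.coe_addRight]
  congr 2; ring

theorem uu_ee (r y : F) : ρ (uu y) * ee ψ ρ r = ψ (r * y) • ee ψ ρ r := by
  rw [← ee_uu, ee, mul_smul_comm, smul_mul_assoc, Finset.mul_sum, Finset.sum_mul]
  congr 1
  refine Finset.sum_congr rfl fun x _ => ?_
  rw [mul_smul_comm, smul_mul_assoc, ← map_mul, ← map_mul, ← uu_add, ← uu_add, add_comm]

theorem tt_ee (a : Fˣ) (r : F) : ρ (tt a) * ee ψ ρ ((a : F) ^ 2 * r) = ee ψ ρ r * ρ (tt a) := by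
  rw [ee, ee, mul_smul_comm, smul_mul_assoc, Finset.mul_sum, Finset.sum_mul]
  congr 1
  refine Fintype.sum_equiv (Units.mulLeft (a ^ 2)) _ _ fun x => ?_
  rw [mul_smul_comm, smul_mul_assoc, ← map_mul, ← map_mul, tt_uu]
  simp only [Units.mulLeft_apply, Units.val_pow_eq_pow_val]
  congr 2; ring

theorem ee_mul_def (r : F) (X : Module.End ℂ V) : ee ψ ρ r * X =
    (Fintype.card F : ℂ)⁻¹ • ∑ x, ψ (-(r * x)) • (ρ (uu x) * X) := by
  rw [ee, smul_mul_assoc, Finset.sum_mul]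
  simp_rw [smul_mul_assoc]

variable {ψ} (hψ : ψ.IsPrimitive)
include hψ

theorem ee_mul_self (r : F) : ee ψ ρ r * ee ψ ρ r = ee ψ ρ r := by
  rw [ee_mul_def]
  simp_rw [uu_ee, smul_smul, ← AddChar.map_add_eq_mul]
  have h : (Fintype.card F : ℂ) ≠ 0 := by exact_mod_cast Fintype.card_ne_zero
  simp only [neg_add_cancel, AddChar.map_zero_eq_one, one_smul, Finset.sum_const, Finset.card_univ]
  rw [← Nat.cast_smul_eq_nsmul ℂ, smul_smul, inv_mul_cancel₀ h, one_smul]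

theorem ee_mul_ne {r s : F} (hrs : r ≠ s) : ee ψ ρ r * ee ψ ρ s = 0 := by
  classical
  rw [ee_mul_def]
  simp_rw [uu_ee, smul_smul, ← AddChar.map_add_eq_mul]
  rw [← Finset.sum_smul]
  have := AddChar.sum_mulShift (s - r) hψ
  rw [if_neg (sub_ne_zero.2 hrs.symm)] at this
  have h2 : ∑ x : F, ψ (-(r * x) + s * x) = 0 := by
    push_cast at this
    rw [← this]; refine Finset.sum_congr rfl fun x _ => ?_
    congr 1; ring
  rw [h2, zero_smul, smul_zero]

theorem sum_ee : ∑ r, ee ψ ρ r = 1 := by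
  classical
  simp_rw [ee]
  rw [← Finset.smul_sum, Finset.sum_comm]
  simp_rw [← Finset.sum_smul]
  have h : ∀ x : F, ∑ r, ψ (-(r * x)) = if x = 0 then (Fintype.card F : ℂ) else 0 := fun x => by
    have := AddChar.sum_mulShift (-x) hψ
    simp only [neg_eq_zero, mul_neg] at this
    rw [this]; push_cast; rfl
  simp_rw [h]
  have h : (Fintype.card F : ℂ) ≠ 0 := by exact_mod_cast Fintype.card_ne_zero
  simp [uu_zero, smul_smul, h]

theorem trace_tt [FiniteDimensional ℂ V] {a : Fˣ} (ha : (a : F) ^ 2 ≠ 1) :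
    LinearMap.trace ℂ V (ρ (tt a)) = LinearMap.trace ℂ V (ρ (tt a) * ee ψ ρ 0) := by
  classical
  have h1 : ρ (tt a) = ∑ r, ρ (tt a) * ee ψ ρ r := by
    rw [← Finset.mul_sum, sum_ee ρ hψ, mul_one]
  conv_lhs => rw [h1]
  rw [map_sum, Finset.sum_eq_single 0 _ (by simp)]
  intro r _ hr
  have h2 : ρ (tt a) * ee ψ ρ r = (ee ψ ρ ((a : F)⁻¹ ^ 2 * r) * ρ (tt a)) * ee ψ ρ r := by
    rw [← tt_ee, mul_assoc]
    congr 1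
    rw [show (a : F) ^ 2 * ((a : F)⁻¹ ^ 2 * r) = r by field_simp, ee_mul_self ρ hψ]
  rw [h2, LinearMap.trace_mul_comm, ← mul_assoc, ee_mul_ne ρ hψ, zero_mul, map_zero]
  intro h
  apply ha
  have h3 : (a : F) ≠ 0 := a.ne_zero
  field_simp at h
  exact h

/-- eigenspace dimension -/
theorem trace_ee [FiniteDimensional ℂ V] (r : F) : LinearMap.trace ℂ V (ee ψ ρ r) = Module.finrank ℂ (LinearMap.range (ee ψ ρ r)) := by
  apply LinearMap.IsProj.trace
  refine ⟨fun x => ⟨x, rfl⟩, ?_⟩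
  rintro _ ⟨x, rfl⟩
  exact LinearMap.congr_fun (ee_mul_self ρ hψ r) x

theorem finrank_ee [FiniteDimensional ℂ V] [CharP F 2] : Module.finrank ℂ V = Module.finrank ℂ (LinearMap.range (ee ψ ρ 0)) +
    (Fintype.card F - 1) * Module.finrank ℂ (LinearMap.range (ee ψ ρ 1)) := by
  classical
  have h1 : ∀ r : F, r ≠ 0 → LinearMap.trace ℂ V (ee ψ ρ r) = LinearMap.trace ℂ V (ee ψ ρ 1) := by
    intro r hr
    obtain ⟨a, ha⟩ : ∃ a : F, a ^ 2 = r := by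
      obtain ⟨a, ha⟩ := FiniteField.isSquare_of_char_two (F := F) (ringChar.eq F 2 ▸ rfl) r
      exact ⟨a, by rw [ha]; ring⟩
    have ha0 : a ≠ 0 := by rintro rfl; simp at ha; exact hr ha.symm
    have h2 := tt_ee ψ ρ (Units.mk0 a ha0) 1
    simp only [Units.val_mk0, mul_one, ha] at h2
    have h3 : ee ψ ρ 1 = ρ (tt (Units.mk0 a ha0)) * ee ψ ρ r * ρ (tt (Units.mk0 a ha0))⁻¹ := by
      rw [h2, mul_assoc, ← map_mul, mul_inv_cancel, map_one, mul_one]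
    rw [h3, LinearMap.trace_mul_comm, ← mul_assoc, ← map_mul, inv_mul_cancel, map_one, one_mul]
  have h2 : (Module.finrank ℂ V : ℂ) = ∑ r : F, LinearMap.trace ℂ V (ee ψ ρ r) := by
    rw [← map_sum, sum_ee ρ hψ, LinearMap.trace_one]
  rw [← Finset.add_sum_erase _ _ (Finset.mem_univ 0), Finset.sum_congr rfl (fun r hr => h1 r (Finset.ne_of_mem_erase hr)),
    trace_ee ρ hψ, trace_ee ρ hψ, Finset.sum_const, Finset.card_erase_of_mem (Finset.mem_univ _), Finset.card_univ] at h2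
  rw [nsmul_eq_mul] at h2
  exact_mod_cast h2

end irrS
end ModF

section ModF2

section irrS2
variable {F : Type} [Field F] [Fintype F] [CharP F 2] {V : Type*} [AddCommGroup V] [Module ℂ V] [FiniteDimensional ℂ V]
variable {ψ : AddChar F ℂ} (ρ : Representation ℂ (SL F) V)

theorem triv_of_U (h : ∀ x, ρ (uu x) = 1) (g : SL F) : ρ g = 1 := by
  have h1 : (MonoidHom.ker ρ) = ⊤ := by
    apply gen_U
    · rintro _ ⟨x, rfl⟩; exact h x
    · intro hle
      have h2 : nn 1 * uu 1 * (nn 1)⁻¹ ∈ MonoidHom.ker ρ := (MonoidHom.normal_ker ρ).conj_mem _ (h 1) _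
      have h3 := mem_BB.1 (hle h2)
      rw [nn_uu, mul_assoc, mul_inv_cancel, mul_one, ll10] at h3
      simp at h3
  have : g ∈ MonoidHom.ker ρ := h1 ▸ Subgroup.mem_top g
  exact this

theorem triv_of_m (hψ : ψ.IsPrimitive) (h : Module.finrank ℂ (LinearMap.range (ee ψ ρ 1)) = 0) (g : SL F) : ρ g = 1 := by
  apply triv_of_U
  intro x
  have h1 := finrank_ee ρ hψ
  rw [h, mul_zero, add_zero] at h1
  have h2 := Submodule.eq_top_of_finrank_eq h1.symm
  have h3 : ee ψ ρ 0 = 1 := by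
    ext v
    obtain ⟨w, rfl⟩ := LinearMap.range_eq_top.1 h2 v
    exact LinearMap.congr_fun (ee_mul_self ρ hψ 0) w
  have h4 := uu_ee ψ ρ 0 x
  rw [h3] at h4
  simpa using h4

/-- the value on the big cell -/
theorem ege (g : SL F) (c : Fˣ) (hg : g 1 0 = c) :
    ee ψ ρ 1 * ρ g * ee ψ ρ 1 = ψ ((g 0 0 + g 1 1) / c) • (ee ψ ρ 1 * ρ (nn c) * ee ψ ρ 1) := by
  conv_lhs => rw [bruhat' c hg]
  rw [map_mul, map_mul, ← mul_assoc, ← mul_assoc, ee_uu, mul_assoc, uu_ee]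
  simp only [smul_mul_assoc, mul_smul_comm, one_mul, smul_smul, ← AddChar.map_add_eq_mul]
  congr 2; ring

theorem ete (hψ : ψ.IsPrimitive) {a : Fˣ} (ha : a ≠ 1) : ee ψ ρ 1 * ρ (tt a) * ee ψ ρ 1 = 0 := by
  rw [← tt_ee, mul_assoc, ee_mul_ne ρ hψ, mul_zero]
  rw [mul_one]
  intro h
  apply ha
  ext
  have : ((a : F) - 1) ^ 2 = 0 := by rw [sub_sq, h]; rw [CharTwo.two_eq_zero]; ring_nf; exact CharTwo.two_eq_zero
  rw [Units.val_one]; exact sub_eq_zero.1 (pow_eq_zero_iff (two_ne_zero) |>.1 this)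

theorem enene (hψ : ψ.IsPrimitive) (a b : Fˣ) : (ee ψ ρ 1 * ρ (nn a) * ee ψ ρ 1) * (ee ψ ρ 1 * ρ (nn b) * ee ψ ρ 1) =
    (ee ψ ρ 1 * ρ (nn b) * ee ψ ρ 1) * (ee ψ ρ 1 * ρ (nn a) * ee ψ ρ 1) := by
  classical
  by_cases hab : a = b
  · rw [hab]
  have key : ∀ a b : Fˣ, a ≠ b → (ee ψ ρ 1 * ρ (nn a) * ee ψ ρ 1) * (ee ψ ρ 1 * ρ (nn b) * ee ψ ρ 1) =
      (Fintype.card F : ℂ)⁻¹ • ∑ x : F, if h : x = 0 then 0 else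
        (ψ (-x) * ψ ((b * (a : F)⁻¹ + a * (b : F)⁻¹) / (a * b * x))) • (ee ψ ρ 1 * ρ (nn (a * b * Units.mk0 x h)) * ee ψ ρ 1) := by
    intro a b hab
    have e1 : (ee ψ ρ 1 * ρ (nn a) * ee ψ ρ 1) * (ee ψ ρ 1 * ρ (nn b) * ee ψ ρ 1) =
        ee ψ ρ 1 * ρ (nn a) * (ee ψ ρ 1 * (ρ (nn b) * ee ψ ρ 1)) := by
      simp only [mul_assoc]
      rw [← mul_assoc (ee ψ ρ 1) (ee ψ ρ 1) (_ * _), ee_mul_self ρ hψ 1]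
    rw [e1, ee_mul_def ψ ρ 1 (ρ (nn b) * ee ψ ρ 1), mul_smul_comm, Finset.mul_sum]
    congr 1
    refine Finset.sum_congr rfl fun x _ => ?_
    rw [mul_smul_comm]
    have e2 : ee ψ ρ 1 * ρ (nn a) * (ρ (uu x) * (ρ (nn b) * ee ψ ρ 1)) =
        ee ψ ρ 1 * ρ (nn a * uu x * nn b) * ee ψ ρ 1 := by
      simp only [map_mul, mul_assoc]
    rw [e2]
    have ha0 := a.ne_zero
    have hb0 := b.ne_zero
    split_ifs with hx
    · subst hx
      have e3 : nn a * uu 0 * nn b = tt (b * a⁻¹) := by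
        rw [uu_zero, mul_one]
        apply SL.ext' <;> simp [SL.mul00, SL.mul01, SL.mul10, SL.mul11, CharTwo.neg_eq, mul_comm]
      rw [e3, ete ρ hψ, smul_zero]
      intro h
      exact hab (mul_inv_eq_one.1 h).symm
    · rw [ege ρ _ (a * b * Units.mk0 x hx), smul_smul]
      · congr 3
        · simp
        · simp [SL.mul00, SL.mul01, SL.mul10, SL.mul11, CharTwo.neg_eq, mul_comm]
      · simp [SL.mul00, SL.mul01, SL.mul10, SL.mul11, CharTwo.neg_eq]; ring
  rw [key a b hab, key b a (Ne.symm hab)]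
  congr 1
  refine Finset.sum_congr rfl fun x _ => ?_
  split_ifs with hx
  · rfl
  · rw [mul_comm b a, mul_comm (b : F) a, add_comm]

omit [Fintype F] [CharP F 2] in
theorem span_top {ρ : Representation ℂ (SL F) V} (hρ : Irr ρ) {v : V} (hv : v ≠ 0) :
    Submodule.span ℂ (Set.range fun g => ρ g v) = ⊤ := by
  apply hρ.eq
  · intro g w hw
    have : Submodule.span ℂ (Set.range fun g => ρ g v) ≤ (Submodule.span ℂ (Set.range fun g => ρ g v)).comap (ρ g) := by
      rw [Submodule.span_le]
      rintro _ ⟨h, rfl⟩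
      exact Submodule.subset_span ⟨g * h, by simp⟩
    exact this hw
  · intro h
    have : v ∈ Submodule.span ℂ (Set.range fun g => ρ g v) := Submodule.subset_span ⟨1, by simp⟩
    rw [h] at this
    exact hv this

theorem m_eq_one (hψ : ψ.IsPrimitive) (hρ : Irr ρ) (h : ∃ g, ρ g ≠ 1) :
    Module.finrank ℂ (LinearMap.range (ee ψ ρ 1)) = 1 := by
  obtain ⟨g, hg⟩ := h
  have h0 : LinearMap.range (ee ψ ρ 1) ≠ ⊥ := by
    intro h
    exact hg (triv_of_m ρ hψ (by rw [h, finrank_bot]) g)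
  obtain ⟨p, ⟨hp0, hpi, hpe⟩, hmin⟩ := WellFounded.has_min
    (wellFounded_lt (α := Submodule ℂ V)) {p | p ≠ ⊥ ∧ (∀ a : Fˣ, ∀ v ∈ p, (ee ψ ρ 1 * ρ (nn a) * ee ψ ρ 1) v ∈ p) ∧
      p ≤ LinearMap.range (ee ψ ρ 1)} ⟨_, h0, fun a v hv => ⟨_, rfl⟩, le_rfl⟩
  obtain ⟨v, hv, hv0⟩ := p.ne_bot_iff.1 hp0
  have hev : ee ψ ρ 1 v = v := by
    obtain ⟨w, hw⟩ := hpe hv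
    rw [← hw]; exact LinearMap.congr_fun (ee_mul_self ρ hψ 1) w
  have hsc : ∀ a : Fˣ, ∃ c : ℂ, (ee ψ ρ 1 * ρ (nn a) * ee ψ ρ 1) v = c • v := by
    intro a
    have : Nontrivial p := Submodule.nontrivial_iff_ne_bot.2 hp0
    obtain ⟨c, hc⟩ := Module.End.exists_eigenvalue (LinearMap.restrict (ee ψ ρ 1 * ρ (nn a) * ee ψ ρ 1) (hpi a))
    refine ⟨c, ?_⟩
    obtain ⟨w, hw⟩ := hc.exists_hasEigenvector
    let E : Submodule ℂ V := LinearMap.ker ((ee ψ ρ 1 * ρ (nn a) * ee ψ ρ 1) - c • (1 : Module.End ℂ V))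
    have hE : ∀ u, u ∈ E ↔ (ee ψ ρ 1 * ρ (nn a) * ee ψ ρ 1) u = c • u := fun u => by
      rw [LinearMap.mem_ker, LinearMap.sub_apply, sub_eq_zero]; rfl
    by_contra hcon
    refine hmin (p ⊓ E) ⟨?_, ?_, inf_le_left.trans hpe⟩ ?_
    · rw [Submodule.ne_bot_iff]
      refine ⟨w, ⟨w.2, (hE _).2 ?_⟩, fun h => hw.2 (Subtype.ext h)⟩
      have := congrArg Subtype.val hw.apply_eq_smul
      exact this
    · rintro b u ⟨hu, hu'⟩
      refine ⟨hpi b u hu, (hE _).2 ?_⟩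
      have := LinearMap.congr_fun (enene ρ hψ a b) u
      refine this.trans ?_
      rw [Module.End.mul_apply (_ * _ * _) (_ * _ * _), (hE u).1 hu', map_smul]
    · refine lt_of_le_of_ne inf_le_left fun h => hcon ?_
      rw [← h] at hv
      exact (hE v).1 hv.2
  have hall : ∀ g, ee ψ ρ 1 (ρ g v) ∈ Submodule.span ℂ {v} := by
    intro g
    have e0 : ee ψ ρ 1 (ρ g v) = (ee ψ ρ 1 * ρ g * ee ψ ρ 1) v := by
      simp [hev]
    by_cases hg : g 1 0 = 0
    · obtain ⟨a, x, rfl⟩ := BB_decomp (mem_BB.2 hg)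
      rw [map_mul]
      by_cases ha : a = 1
      · subst ha
        rw [tt_one, map_one, mul_one]
        have := LinearMap.congr_fun (ee_uu ψ ρ 1 x) v
        rw [Module.End.mul_apply] at this
        rw [this, LinearMap.smul_apply, hev]
        exact Submodule.smul_mem _ _ (Submodule.mem_span_singleton_self v)
      · have := LinearMap.congr_fun (ee_uu ψ ρ 1 x) (ρ (tt a) v)
        rw [Module.End.mul_apply] at this
        rw [Module.End.mul_apply, this, LinearMap.smul_apply]
        have h2 := LinearMap.congr_fun (ete ρ hψ ha) v
        rw [Module.End.mul_apply, Module.End.mul_apply, hev] at h2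
        rw [h2]; simp
    · rw [e0, ege ρ g (Units.mk0 _ hg) rfl, LinearMap.smul_apply]
      obtain ⟨c, hc⟩ := hsc (Units.mk0 _ hg)
      rw [hc]
      exact Submodule.smul_mem _ _ (Submodule.smul_mem _ _ (Submodule.mem_span_singleton_self v))
  have hr : LinearMap.range (ee ψ ρ 1) = Submodule.span ℂ {v} := by
    apply le_antisymm
    · rw [LinearMap.range_eq_map, ← span_top hρ hv0, Submodule.map_span, Submodule.span_le]
      rintro _ ⟨_, ⟨g, rfl⟩, rfl⟩
      exact hall g
    · rw [Submodule.span_singleton_le_iff_mem]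
      exact hpe hv
  rw [hr, finrank_span_singleton hv0]

end irrS2
end ModF2

section ModF3

section irrS3
variable {F : Type} [Field F] [Fintype F] [CharP F 2] {V : Type*} [AddCommGroup V] [Module ℂ V] [FiniteDimensional ℂ V]
variable {ψ : AddChar F ℂ} (ρ : Representation ℂ (SL F) V)

theorem BB_out (g : SL F) : ∃ b ∈ BB F, g = ((g : SL F ⧸ BB F)).out * b := by
  refine ⟨((g : SL F ⧸ BB F)).out⁻¹ * g, ?_, by group⟩
  rw [← QuotientGroup.eq]
  exact QuotientGroup.out_eq' _

theorem span_out {w : V} (hw : ∀ b ∈ BB F, ∃ c : ℂ, ρ b w = c • w) (hs : Submodule.span ℂ (Set.range fun g => ρ g w) = ⊤) :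
    ⊤ ≤ Submodule.span ℂ (Set.range fun c : SL F ⧸ BB F => ρ c.out w) := by
  rw [← hs, Submodule.span_le]
  rintro _ ⟨g, rfl⟩
  obtain ⟨b, hb, hg⟩ := BB_out g
  obtain ⟨c, hc⟩ := hw b hb
  have : ρ g w = c • ρ ((g : SL F ⧸ BB F)).out w := by
    conv_lhs => rw [hg]
    rw [map_mul, Module.End.mul_apply, hc, map_smul]
  change ρ g w ∈ _
  rw [this]
  exact Submodule.smul_mem _ _ (Submodule.subset_span ⟨_, rfl⟩)

theorem le_out {w : V} (hw : ∀ b ∈ BB F, ∃ c : ℂ, ρ b w = c • w) (hs : Submodule.span ℂ (Set.range fun g => ρ g w) = ⊤) :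
    Module.finrank ℂ V ≤ Nat.card F + 1 := by
  classical
  have := Fintype.ofFinite (SL F ⧸ BB F)
  have h := finrank_range_le_card (R := ℂ) (fun c : SL F ⧸ BB F => ρ c.out w)
  rw [Set.finrank, top_le_iff.1 (span_out ρ hw hs), finrank_top, ← Nat.card_eq_fintype_card] at h
  rw [← BB_index]; exact h

theorem trace_nsp {w : V} (hw : ∀ b ∈ BB F, ∃ c : ℂ, ρ b w = c • w) (hs : Submodule.span ℂ (Set.range fun g => ρ g w) = ⊤)
    (hd : Module.finrank ℂ V = Nat.card F + 1) {x : SL F} (hx : NSp x) : LinearMap.trace ℂ V (ρ x) = 0 := by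
  classical
  have := Fintype.ofFinite (SL F ⧸ BB F)
  let b := basisOfTopLeSpanOfCardEqFinrank _ (span_out ρ hw hs) (by
    rw [hd, ← BB_index, ← Nat.card_eq_fintype_card]; rfl)
  have hb : ∀ c : SL F ⧸ BB F, b c = ρ c.out w := fun c => by
    simp only [b, coe_basisOfTopLeSpanOfCardEqFinrank]
  rw [LinearMap.trace_eq_matrix_trace ℂ b, Matrix.trace]
  apply Finset.sum_eq_zero
  intro c _
  rw [Matrix.diag_apply, LinearMap.toMatrix_apply]
  obtain ⟨β, hβ, hg⟩ := BB_out (x * c.out)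
  obtain ⟨k, hk⟩ := hw β hβ
  have h1 : ρ x (b c) = k • b ((x * c.out : SL F) : SL F ⧸ BB F) := by
    rw [hb, hb, ← Module.End.mul_apply, ← map_mul]
    conv_lhs => rw [hg]
    rw [map_mul, Module.End.mul_apply, hk, map_smul]
  rw [h1, map_smul, Module.Basis.repr_self, Finsupp.smul_apply, Finsupp.single_apply, if_neg, smul_zero]
  intro h
  have h2 : ((x * c.out : SL F) : SL F ⧸ BB F) = ((c.out : SL F) : SL F ⧸ BB F) := by
    rw [h]; exact (QuotientGroup.out_eq' c).symm
  rw [eq_comm, QuotientGroup.eq] at h2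
  exact hx c.out (by rw [mul_assoc]; exact h2)

theorem mem_range_e0 (_hψ : ψ.IsPrimitive) {v : V} (hv : v ∈ LinearMap.range (ee ψ ρ 0)) : ∀ x, ρ (uu x) v = v := by
  intro x
  obtain ⟨w, rfl⟩ := hv
  have := LinearMap.congr_fun (uu_ee ψ ρ 0 x) w
  simpa using this

theorem e0_of_fix {v : V} (hv : ∀ x, ρ (uu x) v = v) : ee ψ ρ 0 v = v := by
  have h : (Fintype.card F : ℂ) ≠ 0 := by exact_mod_cast Fintype.card_ne_zero
  rw [ee, LinearMap.smul_apply, LinearMap.sum_apply]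
  simp [hv]
  rw [← Nat.cast_smul_eq_nsmul ℂ, smul_smul, inv_mul_cancel₀ h, one_smul]

theorem B_eigen (hψ : ψ.IsPrimitive) (h0 : LinearMap.range (ee ψ ρ 0) ≠ ⊥) :
    ∃ v ∈ LinearMap.range (ee ψ ρ 0), v ≠ 0 ∧ ∀ b ∈ BB F, ∃ c : ℂ, ρ b v = c • v := by
  have hB : ∀ b ∈ BB F, ∃ a, ∀ v ∈ LinearMap.range (ee ψ ρ 0), ρ b v = ρ (tt a) v ∧ ρ (tt a) v ∈ LinearMap.range (ee ψ ρ 0) := by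
    intro b hb
    obtain ⟨a, x, rfl⟩ := BB_decomp hb
    refine ⟨a, fun v hv => ?_⟩
    have : ρ (tt a) v ∈ LinearMap.range (ee ψ ρ 0) := by
      obtain ⟨w, rfl⟩ := hv
      have := LinearMap.congr_fun (tt_ee ψ ρ a 0) w
      rw [mul_zero] at this
      exact ⟨_, this.symm⟩
    refine ⟨?_, this⟩
    rw [map_mul, Module.End.mul_apply, mem_range_e0 ρ hψ this]
  obtain ⟨v, hv, hv0, h⟩ := exists_eigenvector (res ρ (BB F)) h0 (fun b v hv => by
    obtain ⟨a, ha⟩ := hB b b.2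
    change ρ b v ∈ _
    rw [(ha v hv).1]; exact (ha v hv).2) (fun b c v hv => by
    obtain ⟨a, ha⟩ := hB b b.2
    obtain ⟨d, hd⟩ := hB c c.2
    change ρ b (ρ c v) = ρ c (ρ b v)
    rw [(ha v hv).1, (hd v hv).1, (ha _ (hd v hv).2).1, (hd _ (ha v hv).2).1, ← Module.End.mul_apply, ← Module.End.mul_apply,
      ← map_mul, ← map_mul, ← tt_mul, ← tt_mul, mul_comm])
  exact ⟨v, hv, hv0, fun b hb => h ⟨b, hb⟩⟩

theorem sq_surj (r : F) : ∃ a : F, a ^ 2 = r := by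
  obtain ⟨a, ha⟩ := FiniteField.isSquare_of_char_two (F := F) (ringChar.eq F 2 ▸ rfl) r
  exact ⟨a, by rw [ha]; ring⟩

theorem sq_ne_one {a : Fˣ} (ha : a ≠ 1) : (a : F) ^ 2 ≠ 1 := by
  intro h
  apply ha
  ext
  have : ((a : F) - 1) ^ 2 = 0 := by rw [sub_sq, h]; rw [CharTwo.two_eq_zero]; ring_nf; exact CharTwo.two_eq_zero
  rw [Units.val_one]; exact sub_eq_zero.1 (pow_eq_zero_iff (two_ne_zero) |>.1 this)

theorem S_irr (h8 : 4 ≤ Nat.card F) (hρ : Irr ρ) (h : ∃ g, ρ g ≠ 1) :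
    (Module.finrank ℂ V = Nat.card F - 1 ∧ (∀ a : Fˣ, a ≠ 1 → LinearMap.trace ℂ V (ρ (tt a)) = 0) ∧
      ∀ v, (∀ x, ρ (uu x) v = v) → v = 0) ∨
    (Module.finrank ℂ V = Nat.card F ∧ (∀ a : Fˣ, a ≠ 1 → LinearMap.trace ℂ V (ρ (tt a)) = 1) ∧
      ∀ x, NSp x → LinearMap.trace ℂ V (ρ x) = -1) ∨
    (Module.finrank ℂ V = Nat.card F + 1 ∧ ∀ x, NSp x → LinearMap.trace ℂ V (ρ x) = 0) := by
  have hψ := AddChar.FiniteField.primitiveChar_to_Complex_isPrimitive F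
  set ψ := AddChar.FiniteField.primitiveChar_to_Complex F
  have hd := finrank_ee ρ hψ
  rw [m_eq_one ρ hψ hρ h, mul_one, ← Nat.card_eq_fintype_card] at hd
  by_cases h0 : LinearMap.range (ee ψ ρ 0) = ⊥
  · left
    have h1 : ee ψ ρ 0 = 0 := LinearMap.range_eq_bot.1 h0
    refine ⟨by rw [hd, h0, finrank_bot, zero_add], fun a ha => ?_, fun v hv => ?_⟩
    · rw [trace_tt ρ hψ (sq_ne_one ha), h1, mul_zero, map_zero]
    · have := e0_of_fix (ψ := ψ) ρ hv
      rw [← this, h1]; rfl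
  right
  obtain ⟨v, hv, hv0, hB⟩ := B_eigen ρ hψ h0
  have hs := span_top hρ hv0
  have hle := le_out ρ hB hs
  have h1 : 1 ≤ Module.finrank ℂ (LinearMap.range (ee ψ ρ 0)) := by
    rw [Submodule.one_le_finrank_iff]; exact h0
  rcases Nat.lt_or_ge (Module.finrank ℂ V) (Nat.card F + 1) with hlt | hge
  swap
  · right
    exact ⟨le_antisymm hle hge, fun x hx => trace_nsp ρ hB hs (le_antisymm hle hge) hx⟩
  left
  have hq : Module.finrank ℂ V = Nat.card F := by omega
  have h2 : Module.finrank ℂ (LinearMap.range (ee ψ ρ 0)) = 1 := by omega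
  have hr : LinearMap.range (ee ψ ρ 0) = Submodule.span ℂ {v} := by
    symm
    apply Submodule.eq_of_le_of_finrank_eq
    · rw [Submodule.span_singleton_le_iff_mem]; exact hv
    · rw [h2, finrank_span_singleton hv0]
  have htr : ∀ (a : Fˣ) (c : ℂ), a ≠ 1 → ρ (tt a) v = c • v → LinearMap.trace ℂ V (ρ (tt a)) = c := by
    intro a c ha hc
    rw [trace_tt ρ hψ (sq_ne_one ha)]
    have : ρ (tt a) * ee ψ ρ 0 = c • ee ψ ρ 0 := by
      ext w
      obtain ⟨k, hk⟩ := Submodule.mem_span_singleton.1 (hr ▸ LinearMap.mem_range_self (ee ψ ρ 0) w)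
      rw [Module.End.mul_apply, LinearMap.smul_apply, ← hk, map_smul, hc, smul_comm]
    rw [this, map_smul, trace_ee ρ hψ, h2]; simp
  have hconj : ∀ a : Fˣ, LinearMap.trace ℂ V (ρ (tt a⁻¹)) = LinearMap.trace ℂ V (ρ (tt a)) := by
    intro a
    have : tt a⁻¹ = nn 1 * tt a * (nn 1)⁻¹ := by
      rw [eq_mul_inv_iff_mul_eq]
      apply SL.ext' <;> simp [SL.mul00, SL.mul01, SL.mul10, SL.mul11]
    rw [this, map_mul, LinearMap.trace_mul_comm, ← map_mul, inv_mul_cancel_left]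
  have hone : ∀ a : Fˣ, ρ (tt a) v = v := by
    intro a
    obtain ⟨b, hb⟩ := sq_surj (a : F)
    have hb0 : b ≠ 0 := by rintro rfl; simp at hb; exact a.ne_zero hb.symm
    have hab : a = Units.mk0 b hb0 * Units.mk0 b hb0 := by ext; simp [← hb]; ring
    generalize Units.mk0 b hb0 = β at hab
    rw [hab]
    by_cases hβ : β = 1
    · subst hβ; simp [tt_one]
    obtain ⟨c, hc⟩ := hB _ (tt_mem_BB β)
    obtain ⟨d, hd'⟩ := hB _ (tt_mem_BB β⁻¹)
    have e1 : d = c := by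
      rw [← htr β⁻¹ d (by simpa using hβ) hd', ← htr β c hβ hc]; exact hconj β
    rw [tt_mul, map_mul, Module.End.mul_apply, hc, map_smul, hc]
    subst e1
    rw [← hc, ← map_smul, ← hd', ← Module.End.mul_apply, ← map_mul, ← tt_mul, mul_inv_cancel, tt_one, map_one]; rfl
  have hBv : ∀ b ∈ BB F, ρ b v = v := by
    intro b hb
    obtain ⟨a, x, rfl⟩ := BB_decomp hb
    rw [map_mul, Module.End.mul_apply, hone, mem_range_e0 ρ hψ hv]
  refine ⟨hq, fun a ha => htr a 1 ha (by rw [hone, one_smul]), fun x hx => ?_⟩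
  let σ : Representation ℂ (SL F) (V × ℂ) :=
    { toFun := fun g => (ρ g).prodMap LinearMap.id
      map_one' := by ext <;> simp
      map_mul' := fun g h => by ext <;> simp }
  have hσ : ∀ g w, σ g w = (ρ g w.1, w.2) := fun g w => rfl
  have hspan : Submodule.span ℂ (Set.range fun g => σ g (v, 1)) = ⊤ := by
    set p := Submodule.span ℂ (Set.range fun g => σ g (v, 1)) with hp
    have hpi : RInv σ p := by
      intro g w hw
      have : p ≤ p.comap (σ g) := by
        rw [hp, Submodule.span_le]
        rintro _ ⟨h, rfl⟩
        exact Submodule.subset_span ⟨g * h, by simp⟩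
      exact this hw
    have hmem : ∀ g, (ρ g v, (1 : ℂ)) ∈ p := fun g => Submodule.subset_span ⟨g, rfl⟩
    have hmem1 : (v, (1 : ℂ)) ∈ p := by have := hmem 1; simpa using this
    have hci : RInv ρ (p.comap (LinearMap.inl ℂ V ℂ)) := fun g w hw => by
      have := hpi g _ hw
      simpa [hσ] using this
    rcases hρ.2.2 _ le_top hci with hc | hc
    · exfalso
      have hfix : ∀ g, ρ g v = v := by
        intro g
        have : ρ g v - v ∈ p.comap (LinearMap.inl ℂ V ℂ) := by
          have := p.sub_mem (hmem g) hmem1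
          simpa using this
        rw [hc] at this
        exact sub_eq_zero.1 this
      have : (⊤ : Submodule ℂ V) = Submodule.span ℂ {v} := by
        rw [← hs]
        congr 1; ext w; simp [hfix, eq_comm]
      have h3 := congrArg (fun p : Submodule ℂ V => Module.finrank ℂ p) this
      simp only [finrank_top, finrank_span_singleton hv0] at h3
      omega
    · rw [eq_top_iff]
      rintro ⟨w, c⟩ -
      have h3 : w - c • v ∈ p.comap (LinearMap.inl ℂ V ℂ) := hc ▸ trivial
      have h4 := p.add_mem h3 (p.smul_mem c hmem1)
      simpa using h4
  have ht := trace_nsp σ (w := (v, 1)) (fun b hb => ⟨1, by rw [hσ, hBv b hb]; simp⟩) hspan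
    (by rw [Module.finrank_prod, hq, Module.finrank_self]) hx
  have : LinearMap.trace ℂ _ (σ x) = LinearMap.trace ℂ V (ρ x) + 1 := by
    change LinearMap.trace ℂ _ ((ρ x).prodMap LinearMap.id) = _
    rw [LinearMap.trace_prodMap']
    simp
  rw [ht] at this
  linear_combination -this

end irrS3
end ModF3

section ModF4

section irrS4
variable {F : Type} [Field F] [Finite F] [CharP F 2]

theorem isConj_trace {x y : SL F} (h : IsConj x y) : x 0 0 + x 1 1 = y 0 0 + y 1 1 := by
  obtain ⟨g, hg⟩ := isConj_iff.1 h
  rw [← hg, ← trace_conj_SL g⁻¹ x, inv_inv]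

theorem exists_trace_ne {x y : SL F} (h : x 0 0 + x 1 1 ≠ y 0 0 + y 1 1) :
    ∃ (V : Type) (_ : AddCommGroup V) (_ : Module ℂ V) (_ : FiniteDimensional ℂ V) (ρ : Representation ℂ (SL F) V), Irr ρ ∧
      LinearMap.trace ℂ V (ρ x) ≠ LinearMap.trace ℂ V (ρ y) ∧ ∃ g, ρ g ≠ 1 := by
  by_contra! hh
  refine h (isConj_trace (separation x y fun V _ _ _ ρ hρ => ?_))
  by_contra hne
  have := hh V _ _ inferInstance ρ hρ hne
  exact hne (by rw [this, this])

theorem sep_nsp (h4 : 4 ≤ Nat.card F) {x y : SL F} (h : x 0 0 + x 1 1 ≠ y 0 0 + y 1 1) (hx : NSp x) (hy : NSp y) :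
    ∃ (V : Type) (_ : AddCommGroup V) (_ : Module ℂ V) (_ : FiniteDimensional ℂ V) (ρ : Representation ℂ (SL F) V), Irr ρ ∧
      LinearMap.trace ℂ V (ρ x) ≠ LinearMap.trace ℂ V (ρ y) ∧ Module.finrank ℂ V = Nat.card F - 1 := by
  have := Fintype.ofFinite F
  obtain ⟨V, _, _, _, ρ, hρ, hne, hg⟩ := exists_trace_ne h
  refine ⟨V, _, _, inferInstance, ρ, hρ, hne, ?_⟩
  rcases S_irr ρ h4 hρ hg with h | h | h
  · exact h.1
  · exact absurd (by rw [h.2.2 x hx, h.2.2 y hy]) hne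
  · exact absurd (by rw [h.2 x hx, h.2 y hy]) hne

theorem sep_sp (h4 : 4 ≤ Nat.card F) {a b : Fˣ} (h : (a : F) + (a⁻¹ : Fˣ) ≠ b + (b⁻¹ : Fˣ)) (hx : a ≠ 1) (hy : b ≠ 1) :
    ∃ (V : Type) (_ : AddCommGroup V) (_ : Module ℂ V) (_ : FiniteDimensional ℂ V) (ρ : Representation ℂ (SL F) V), Irr ρ ∧
      LinearMap.trace ℂ V (ρ (tt a)) ≠ LinearMap.trace ℂ V (ρ (tt b)) ∧ Module.finrank ℂ V = Nat.card F + 1 := by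
  have := Fintype.ofFinite F
  obtain ⟨V, _, _, _, ρ, hρ, hne, hg⟩ := exists_trace_ne (x := tt a) (y := tt b) h
  refine ⟨V, _, _, inferInstance, ρ, hρ, hne, ?_⟩
  rcases S_irr ρ h4 hρ hg with h | h | h
  · exact absurd (by rw [h.2.1 a hx, h.2.1 b hy]) hne
  · exact absurd (by rw [h.2.1 a hx, h.2.1 b hy]) hne
  · exact h.1

theorem exists_q (h4 : 4 ≤ Nat.card F) : Deg (SL F) (Nat.card F) := by
  classical
  have := Fintype.ofFinite F
  have := Fintype.ofFinite (SL F ⧸ BB F)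
  let τ : Representation ℂ (SL F) (SL F ⧸ BB F → ℂ) :=
    { toFun := fun g => { toFun := fun f c => f (g⁻¹ • c), map_add' := fun _ _ => rfl, map_smul' := fun _ _ => rfl }
      map_one' := by ext; simp
      map_mul' := fun g h => by ext; simp [mul_smul] }
  have hτ : ∀ g f c, τ g f c = f (g⁻¹ • c) := fun _ _ _ => rfl
  let s : (SL F ⧸ BB F → ℂ) →ₗ[ℂ] ℂ := ∑ c, LinearMap.proj c
  have hs : ∀ f, s f = ∑ c, f c := fun f => by simp [s]
  have hcard : Fintype.card (SL F ⧸ BB F) = Nat.card F + 1 := by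
    rw [← Nat.card_eq_fintype_card]; exact BB_index
  have hinv : RInv τ (LinearMap.ker s) := by
    intro g f hf
    rw [LinearMap.mem_ker, hs] at hf ⊢
    rw [← hf]
    exact Fintype.sum_equiv (MulAction.toPerm g⁻¹) _ _ fun c => by simp [hτ]
  have hrk : Module.finrank ℂ (LinearMap.ker s) = Nat.card F := by
    have h1 := LinearMap.finrank_range_add_finrank_ker s
    have h2 : LinearMap.range s = ⊤ := by
      rw [LinearMap.range_eq_top]
      intro c
      refine ⟨Pi.single ((1 : SL F) : SL F ⧸ BB F) c, ?_⟩
      rw [hs]; simp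
    rw [h2, finrank_top, Module.finrank_self, Module.finrank_fintype_fun_eq_card, hcard] at h1
    omega
  have hne : LinearMap.ker s ≠ ⊥ := by
    intro h; rw [h, finrank_bot] at hrk; omega
  obtain ⟨p, hp, hps⟩ := exists_simp τ hne hinv
  have hirr := hps.irr
  have hple : Module.finrank ℂ p ≤ Nat.card F := hrk ▸ Submodule.finrank_mono hp
  obtain ⟨f, hf, hf0⟩ := p.ne_bot_iff.1 hps.1
  obtain ⟨c, hc⟩ := Function.ne_iff.1 hf0
  have hnt : ∃ g, subrep τ p hps.2.1 g ≠ 1 := by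
    by_contra! hh
    have h1 : ∀ d, f d = f c := by
      intro d
      obtain ⟨g, hg⟩ := MulAction.exists_smul_eq (SL F) d c
      have := congrArg Subtype.val (LinearMap.congr_fun (hh g) ⟨f, hf⟩)
      have h2 := congrFun this c
      simp only [subrep_coe, hτ] at h2
      rw [← hg, inv_smul_smul] at h2
      rw [h2, hg]; rfl
    have h2 := LinearMap.mem_ker.1 (hp hf)
    rw [hs, Finset.sum_congr rfl (fun d _ => h1 d), Finset.sum_const, nsmul_eq_mul, Finset.card_univ, hcard] at h2
    rcases mul_eq_zero.1 h2 with h2 | h2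
    · have h3 : (Nat.card F + 1 : ℕ) = 0 := by exact_mod_cast h2
      omega
    · exact hc h2
  refine ⟨p, inferInstance, inferInstance, inferInstance, _, hirr, ?_⟩
  rcases S_irr _ h4 hirr hnt with h | h | h
  · exfalso
    obtain ⟨g, hg⟩ := MulAction.exists_smul_eq (SL F) c ((1 : SL F) : SL F ⧸ BB F)
    let f1 : SL F ⧸ BB F → ℂ := τ g f
    have hf1 : f1 ∈ p := hps.2.1 g f hf
    have hf10 : f1 ((1 : SL F) : SL F ⧸ BB F) ≠ 0 := by
      simp only [f1]
      rw [hτ, ← hg, inv_smul_smul]; exact hc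
    let f2 : SL F ⧸ BB F → ℂ := ∑ x : F, τ (uu x) f1
    have hf2 : f2 ∈ p := p.sum_mem fun x _ => hps.2.1 _ _ hf1
    have h3 := h.2.2 ⟨f2, hf2⟩ (fun y => by
      apply Subtype.ext
      rw [subrep_coe]
      simp only [f2]
      rw [map_sum]
      refine Fintype.sum_equiv (Equiv.addLeft y) _ _ fun x => ?_
      rw [← Module.End.mul_apply, ← map_mul, ← uu_add]; rfl)
    have h4 := congrFun (congrArg Subtype.val h3) ((1 : SL F) : SL F ⧸ BB F)
    have h5 : f2 ((1 : SL F) : SL F ⧸ BB F) = Fintype.card F * f1 ((1 : SL F) : SL F ⧸ BB F) := by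
      simp only [f2]
      rw [Finset.sum_apply, Finset.sum_congr rfl (g := fun _ => f1 ((1 : SL F) : SL F ⧸ BB F)), Finset.sum_const, nsmul_eq_mul, Finset.card_univ]
      intro x _
      rw [hτ]
      congr 1
      rw [← uu_neg]
      change ((uu (-x) * 1 : SL F) : SL F ⧸ BB F) = _
      rw [eq_comm, QuotientGroup.eq]
      simp only [inv_one, one_mul, mul_one]
      exact UU_le_BB (uu_mem _)
    replace h4 : f2 ((1 : SL F) : SL F ⧸ BB F) = 0 := h4
    rw [h5] at h4
    rcases mul_eq_zero.1 h4 with h6 | h6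
    · have : Fintype.card F = 0 := by exact_mod_cast h6
      exact Fintype.card_ne_zero this
    · exact hf10 h6
  · exact h.1
  · have := h.1; omega

theorem deg_q_sub (h4 : 8 ≤ Nat.card F) : Deg (SL F) (Nat.card F - 1) := by
  have h1 := Sp_card (F := F)
  have h2 : (Sp F)ᶜ.ncard = Nat.card F - (Sp F).ncard := Set.ncard_compl _
  obtain ⟨s, hs, t, ht, hst⟩ := (Set.one_lt_ncard_iff_nontrivial (s := (Sp F)ᶜ)).1 (by omega)
  obtain ⟨V, _, _, _, ρ, hρ, -, hd⟩ := sep_nsp (F := F) (by omega) (x := ofTr s) (y := ofTr t) (by simpa [ofTr] using hst)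
    (NSp_of_trace (by simpa [ofTr] using hs)) (NSp_of_trace (by simpa [ofTr] using ht))
  exact ⟨V, _, _, inferInstance, ρ, hρ, hd⟩

theorem deg_q_add (h4 : 8 ≤ Nat.card F) : Deg (SL F) (Nat.card F + 1) := by
  have h1 := Sp_card (F := F)
  obtain ⟨s, hs, t, ht, hst⟩ := (Set.one_lt_ncard_iff_nontrivial (s := Sp F \ {0})).1 (by
    have := Set.ncard_le_ncard_sdiff_add_ncard (Sp F) {0}
    rw [Set.ncard_singleton] at this
    omega)
  obtain ⟨a, ha⟩ := hs.1
  obtain ⟨b, hb⟩ := ht.1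
  have h1 : ∀ s : F, s ∈ Sp F \ {0} → ∀ a : Fˣ, s = a + (a⁻¹ : Fˣ) → a ≠ 1 := by
    rintro s hs a ha rfl
    apply hs.2
    rw [ha]; simp [CharTwo.add_self_eq_zero]
  obtain ⟨V, _, _, _, ρ, hρ, -, hd⟩ := sep_sp (F := F) (by omega) (a := a) (b := b) (by rw [← ha, ← hb]; exact hst)
    (h1 s hs a ha) (h1 t ht b hb)
  exact ⟨V, _, _, inferInstance, ρ, hρ, hd⟩

theorem deg_SL (h4 : 4 ≤ Nat.card F) {n : ℕ} (hn : Deg (SL F) n) : n = 1 ∨ n = Nat.card F - 1 ∨ n = Nat.card F ∨ n = Nat.card F + 1 := by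
  have := Fintype.ofFinite F
  obtain ⟨V, _, _, _, ρ, hρ, rfl⟩ := hn
  by_cases h : ∃ g, ρ g ≠ 1
  · rcases S_irr ρ h4 hρ h with h | h | h
    · exact Or.inr (Or.inl h.1)
    · exact Or.inr (Or.inr (Or.inl h.1))
    · exact Or.inr (Or.inr (Or.inr h.1))
  · left
    push Not at h
    have := hρ.nontrivial
    obtain ⟨v, hv⟩ := exists_ne (0 : V)
    have h1 : Submodule.span ℂ {v} = ⊤ := hρ.eq (fun g w hw => by rw [h g]; exact hw) (by simpa using hv)
    rw [← finrank_top ℂ V, ← h1, finrank_span_singleton hv]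

end irrS4
end ModF4

section ModH1

theorem over_char {G : Type} [Group G] [Finite G] (N : Subgroup G) (l : N →* ℂˣ) :
    ∃ (V : Type) (_ : AddCommGroup V) (_ : Module ℂ V) (_ : FiniteDimensional ℂ V) (ρ : Representation ℂ G V) (v : V),
      Irr ρ ∧ v ≠ 0 ∧ ∀ n : N, ρ n v = (l n : ℂ) • v := by
  let σ : Representation ℂ N ℂ :=
    { toFun := fun n => (l n : ℂ) • LinearMap.id
      map_one' := by ext; simp
      map_mul' := fun a b => by ext; simp [mul_comm] }
  have hσ : Irr σ := Irr.of_forall fun q _ => by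
    rcases eq_or_ne q ⊥ with h | h
    · exact Or.inl h
    · right
      obtain ⟨c, hc, hc0⟩ := q.ne_bot_iff.1 h
      rw [eq_top_iff]
      intro d _
      have := q.smul_mem (d / c) hc
      rwa [smul_eq_mul, div_mul_cancel₀ _ hc0] at this
  obtain ⟨V, _, _, _, ρ, f, hρ, hf, h⟩ := exists_over N hσ
  refine ⟨V, _, _, inferInstance, ρ, f 1, hρ, fun h0 => ?_, fun n => ?_⟩
  · exact one_ne_zero (hf (h0.trans (map_zero f).symm))
  · rw [← h n 1, ← map_smul]; rfl

theorem perfect_hom {K A : Type*} [Group K] [CommGroup A] (hK : commutator K = ⊤) (f : K →* A) (k : K) : f k = 1 := by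
  have h := Abelianization.commutator_subset_ker f
  rw [hK] at h
  exact h (Subgroup.mem_top k)

theorem transfer_char {K : Type*} [Group K] [Finite K] (hK : commutator K = ⊤) {W P : Subgroup K} [W.Normal] (hWP : W ≤ P)
    (μ : P →* ℂˣ) (hinv : ∀ (k w : K) (hw : w ∈ W), μ ⟨k * w * k⁻¹, hWP (Subgroup.Normal.conj_mem ‹_› w hw k)⟩ = μ ⟨w, hWP hw⟩)
    (w : K) (hw : w ∈ W) : μ ⟨w, hWP hw⟩ ^ P.index = 1 := by
  classical
  have h1 := perfect_hom hK (MonoidHom.transfer μ) w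
  let _ := P.fintypeQuotientOfFiniteIndex
  let T : P.LeftTransversal := default
  rw [MonoidHom.transfer_def μ T, Subgroup.leftTransversals.diff] at h1
  have h2 : ∀ q : K ⧸ P, w⁻¹ • q = q := by
    intro q
    obtain ⟨g, rfl⟩ := QuotientGroup.mk_surjective q
    change ((w⁻¹ * g : K) : K ⧸ P) = g
    rw [eq_comm, QuotientGroup.eq]
    have := Subgroup.Normal.conj_mem ‹W.Normal› w⁻¹ (W.inv_mem hw) g⁻¹
    rw [inv_inv] at this
    rw [← mul_assoc]
    exact hWP this
  rw [← h1, Subgroup.index, Nat.card_eq_fintype_card, ← Finset.card_univ, ← Finset.prod_const]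
  refine Finset.prod_congr rfl fun q _ => ?_
  rw [← hinv ((T.2.leftQuotientEquiv q : K)⁻¹) w hw]
  congr 1
  apply Subtype.ext
  simp only [Subgroup.smul_apply_eq_smul_apply_inv_smul, h2, smul_eq_mul, inv_inv, mul_assoc]

section cyc
variable {F : Type} [Field F] [Finite F] [CharP F 2]

theorem sq_one_of_trace {l : SL F} (h : l 0 0 + l 1 1 = 0) : l ^ 2 = 1 := by
  have h1 : l 1 1 = l 0 0 := by rw [← CharTwo.neg_eq (l 0 0)]; linear_combination h
  have h2 := SL.det' l
  rw [CharTwo.sub_eq_add, h1] at h2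
  have h3 : (2 : F) = 0 := CharTwo.two_eq_zero
  rw [pow_two]
  apply SL.ext' <;> simp only [SL.mul00, SL.mul01, SL.mul10, SL.mul11, SL.one00, SL.one01, SL.one10, SL.one11, h1]
  · exact h2
  · linear_combination l 0 0 * l 0 1 * h3
  · linear_combination l 0 0 * l 1 0 * h3
  · linear_combination h2

theorem cyclic_odd {p : ℕ} [Fact p.Prime] (hp2 : p ≠ 2) (L : Subgroup (SL F)) (hL : IsPGroup p L) : IsCyclic L := by
  rcases subsingleton_or_nontrivial L with hs | hn
  · infer_instance
  have hodd : ∀ l ∈ L, l ^ 2 = 1 → l = 1 := by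
    intro l hl h2
    obtain ⟨k, hk⟩ := hL ⟨l, hl⟩
    have hk' : l ^ p ^ k = 1 := by simpa using congrArg Subtype.val hk
    have hc : Nat.Coprime 2 (p ^ k) := Nat.Coprime.pow_right k ((Nat.coprime_primes Nat.prime_two Fact.out).2 hp2.symm)
    have h3 : orderOf l ∣ Nat.gcd 2 (p ^ k) := Nat.dvd_gcd (orderOf_dvd_of_pow_eq_one h2) (orderOf_dvd_of_pow_eq_one hk')
    rw [hc, Nat.dvd_one, orderOf_eq_one_iff] at h3
    exact h3
  have := hL.center_nontrivial
  obtain ⟨z, hz⟩ := exists_ne (1 : Subgroup.center L)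
  have hzc : ∀ l ∈ L, l * (z : L) = (z : L) * l := fun l hl => by
    have := Subgroup.mem_center_iff.1 z.2 ⟨l, hl⟩
    exact congrArg Subtype.val this
  set y : SL F := ((z : L) : SL F) with hy
  have hy1 : y ≠ 1 := fun h => hz (Subtype.ext (Subtype.ext h))
  let Ω := AlgebraicClosure F
  let ι := algebraMap F Ω
  let m : SL F → Matrix (Fin 2) (Fin 2) Ω := fun g => g.1.map ι
  have hm : ∀ g h, m (g * h) = m g * m h := fun g h => by simp [m, Matrix.map_mul]
  have hm1 : m 1 = 1 := by simp [m]
  obtain ⟨ζ, hζ⟩ := Module.End.exists_eigenvalue (Matrix.toLin' (m y))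
  obtain ⟨v, hv⟩ := hζ.exists_hasEigenvector
  have hvz : (m y).mulVec v = ζ • v := by have := hv.apply_eq_smul; rwa [Matrix.toLin'_apply] at this
  have hline : ∀ l ∈ L, ∃ c : Ω, (m l).mulVec v = c • v := by
    intro l hl
    have hw : (m y).mulVec ((m l).mulVec v) = ζ • (m l).mulVec v := by
      rw [Matrix.mulVec_mulVec, ← hm, ← hzc l hl, hm, ← Matrix.mulVec_mulVec, hvz, Matrix.mulVec_smul]
    set w := (m l).mulVec v
    by_cases hD : v 0 * w 1 - v 1 * w 0 = 0
    · by_cases h0 : v 0 = 0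
      · have h1 : v 1 ≠ 0 := by
          intro h1; apply hv.2; ext i; fin_cases i <;> simp [h0, h1]
        refine ⟨w 1 / v 1, ?_⟩
        rw [h0, zero_mul, zero_sub, neg_eq_zero, mul_eq_zero, or_iff_right h1] at hD
        ext i; fin_cases i
        · simp [h0, hD]
        · simp [div_mul_cancel₀ _ h1]
      · refine ⟨w 0 / v 0, ?_⟩
        ext i; fin_cases i
        · simp [div_mul_cancel₀ _ h0]
        · change w 1 = w 0 / v 0 * v 1
          rw [div_mul_eq_mul_div, eq_div_iff h0]; linear_combination hD
    · exfalso
      have e1 := congrFun hvz 0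
      have e2 := congrFun hvz 1
      have e3 := congrFun hw 0
      have e4 := congrFun hw 1
      simp only [Matrix.mulVec, dotProduct, Fin.sum_univ_two, Pi.smul_apply, smul_eq_mul] at e1 e2 e3 e4
      have f1 : m y 0 0 - ζ = 0 := by
        have : (m y 0 0 - ζ) * (v 0 * w 1 - v 1 * w 0) = 0 := by linear_combination w 1 * e1 - v 1 * e3
        exact (mul_eq_zero.1 this).resolve_right hD
      have f2 : m y 0 1 = 0 := by
        have : (m y 0 1) * (v 0 * w 1 - v 1 * w 0) = 0 := by linear_combination (-w 0) * e1 + v 0 * e3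
        exact (mul_eq_zero.1 this).resolve_right hD
      have f3 : m y 1 0 = 0 := by
        have : (m y 1 0) * (v 0 * w 1 - v 1 * w 0) = 0 := by linear_combination w 1 * e2 - v 1 * e4
        exact (mul_eq_zero.1 this).resolve_right hD
      have f4 : m y 1 1 - ζ = 0 := by
        have : (m y 1 1 - ζ) * (v 0 * w 1 - v 1 * w 0) = 0 := by linear_combination (-w 0) * e2 + v 0 * e4
        exact (mul_eq_zero.1 this).resolve_right hD
      have f5 : ι (y 0 0) + ι (y 1 1) = 0 := by
        have h1 : ι (y 0 0) = ι (y 1 1) := (sub_eq_zero.1 f1).trans (sub_eq_zero.1 f4).symm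
        rw [h1, ← map_add, CharTwo.add_self_eq_zero, map_zero]
      rw [← map_add, map_eq_zero] at f5
      exact hy1 (hodd y (z : L).2 (sq_one_of_trace f5))
  choose c hc using fun l : L => hline l l.2
  have hcu : ∀ a b : Ω, a • v = b • v → a = b := fun a b hab => smul_left_injective Ω hv.2 hab
  let χ : L →* Ω :=
    { toFun := c
      map_one' := hcu _ _ (by rw [← hc]; simp [hm1])
      map_mul' := fun a b => hcu _ _ (by
        rw [← hc, Subgroup.coe_mul, hm, ← Matrix.mulVec_mulVec, hc b, Matrix.mulVec_smul, hc a, smul_smul, mul_comm]) }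
  refine isCyclic_of_injective_ringHom χ ((injective_iff_map_eq_one χ).2 fun l hl => ?_)
  have h1 : (m l).mulVec v = v := by rw [hc l]; change χ l • v = v; rw [hl, one_smul]
  have h2 : (m l - 1).det = 0 := by
    rw [← Matrix.exists_mulVec_eq_zero_iff]
    exact ⟨v, hv.2, by rw [Matrix.sub_mulVec, h1, Matrix.one_mulVec, sub_self]⟩
  rw [Matrix.det_fin_two] at h2
  have h3 := congrArg ι (SL.det' (l : SL F))
  have h5 : (2 : Ω) = 0 := by
    rw [← map_ofNat ι 2]
    have : (OfNat.ofNat 2 : F) = 0 := CharTwo.two_eq_zero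
    rw [this, map_zero]
  have h4 : ι ((l : SL F) 0 0 + (l : SL F) 1 1) = 0 := by
    have h6 : (ι ((l : SL F) 0 0) - 1) * (ι ((l : SL F) 1 1) - 1) - (ι ((l : SL F) 0 1) - 0) * (ι ((l : SL F) 1 0) - 0) = 0 := h2
    simp only [map_sub, map_mul, map_one] at h3
    rw [map_add]
    linear_combination h3 - h6 + h5
  rw [map_eq_zero] at h4
  exact Subtype.ext (hodd l l.2 (sq_one_of_trace h4))

end cyc
end ModH1

section ModH2

section mult
variable {F : Type} [Field F] [Finite F] [CharP F 2] {K : Type} [Group K] [Finite K] {φ : K →* SL F}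

theorem mult_core (hK : commutator K = ⊤) (hφ : Function.Surjective φ) (l : φ.ker →* ℂˣ)
    (hinv : ∀ (k : K) (w w' : φ.ker), (w' : K) = k * w * k⁻¹ → l w' = l w)
    {V : Type} [AddCommGroup V] [Module ℂ V] [FiniteDimensional ℂ V] [Nontrivial V] (ρ : Representation ℂ K V)
    (hW : ∀ w : φ.ker, ρ w = (l w : ℂ) • (1 : Module.End ℂ V))
    (P : Subgroup (SL F)) (hc : ∀ a b, φ a ∈ P → φ b ∈ P → ρ a * ρ b = ρ b * ρ a) : ∀ w, l w ^ P.index = 1 := by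
  obtain ⟨v, -, hv0, h⟩ := exists_eigenvector (res ρ (P.comap φ)) (p := ⊤) top_ne_bot (RInv.top _) (fun a b v _ => by
    exact LinearMap.congr_fun (hc a b a.2 b.2) v)
  obtain ⟨μ, hμ⟩ := exists_char _ hv0 h
  have hle : φ.ker ≤ P.comap φ := fun x hx => by
    rw [Subgroup.mem_comap, MonoidHom.mem_ker.1 hx]; exact P.one_mem
  have hl : ∀ (w : K) (hw : w ∈ φ.ker), μ ⟨w, hle hw⟩ = l ⟨w, hw⟩ := by
    intro w hw
    have h1 := hμ ⟨w, hle hw⟩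
    have h2 : ρ w v = (l ⟨w, hw⟩ : ℂ) • v := LinearMap.congr_fun (hW ⟨w, hw⟩) v
    exact Units.ext (smul_left_injective ℂ hv0 (h1.symm.trans h2))
  intro w
  have := transfer_char hK hle μ (fun k w hw => by
    rw [hl _ ((MonoidHom.normal_ker φ).conj_mem w hw k), hl w hw]
    exact hinv k _ _ rfl) w w.2
  rw [hl w w.2, Subgroup.index_comap_of_surjective _ hφ] at this
  exact this

theorem comm_odd {p : ℕ} [Fact p.Prime] (hp2 : p ≠ 2) (l : φ.ker →* ℂˣ)
    {V : Type} [AddCommGroup V] [Module ℂ V] (ρ : Representation ℂ K V) (hφ : Function.Surjective φ)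
    (hW : ∀ w : φ.ker, ρ w = (l w : ℂ) • (1 : Module.End ℂ V))
    (P : Subgroup (SL F)) (hP : IsPGroup p P) : ∀ a b, φ a ∈ P → φ b ∈ P → ρ a * ρ b = ρ b * ρ a := by
  obtain ⟨c, hc⟩ := (cyclic_odd hp2 P hP).exists_generator
  obtain ⟨k, hk⟩ := hφ c
  have key : ∀ a, φ a ∈ P → ∃ (i : ℤ) (z : ℂ), ρ a = z • ρ (k ^ i) := by
    intro a ha
    obtain ⟨i, hi⟩ := Subgroup.mem_zpowers_iff.1 (hc ⟨φ a, ha⟩)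
    have hi' : φ k ^ i = φ a := by rw [hk]; simpa using congrArg Subtype.val hi
    have hw : (k ^ i)⁻¹ * a ∈ φ.ker := by
      rw [MonoidHom.mem_ker, map_mul, map_inv, map_zpow, hi', inv_mul_cancel]
    refine ⟨i, l ⟨_, hw⟩, ?_⟩
    have := hW ⟨_, hw⟩
    calc ρ a = ρ (k ^ i) * ρ ((k ^ i)⁻¹ * a) := by rw [← map_mul, mul_inv_cancel_left]
      _ = _ := by rw [this, mul_smul_comm, mul_one]
  intro a b ha hb
  obtain ⟨i, z, h1⟩ := key a ha
  obtain ⟨j, y, h2⟩ := key b hb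
  rw [h1, h2, smul_mul_smul_comm, smul_mul_smul_comm, mul_comm z, ← map_mul, ← map_mul, ← zpow_add, ← zpow_add, add_comm]

theorem comm_two (h8 : 8 ≤ Nat.card F) (l : φ.ker →* ℂˣ) (hl2 : ∀ w, l w ^ 2 = 1)
    {V : Type} [AddCommGroup V] [Module ℂ V] [Nontrivial V] (ρ : Representation ℂ K V) (hφ : Function.Surjective φ)
    (hW : ∀ w : φ.ker, ρ w = (l w : ℂ) • (1 : Module.End ℂ V)) :
    ∀ a b, φ a ∈ UU F → φ b ∈ UU F → ρ a * ρ b = ρ b * ρ a := by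
  have := Fintype.ofFinite F
  choose s hs using fun x : F => hφ (uu x)
  have hl2' : ∀ w : φ.ker, (l w : ℂ) * l w = 1 := fun w => by
    have := congrArg Units.val (hl2 w)
    rw [pow_two] at this
    exact this
  have hs2 : ∀ x, s x * s x ∈ φ.ker := fun x => by
    rw [MonoidHom.mem_ker, map_mul, hs, ← uu_add, CharTwo.add_self_eq_zero, uu_zero]
  let Q : F → ℂ := fun x => l ⟨_, hs2 x⟩
  have hQ : ∀ k x, φ k = uu x → ρ k * ρ k = Q x • (1 : Module.End ℂ V) := by
    intro k x hk
    have hw : (s x)⁻¹ * k ∈ φ.ker := by rw [MonoidHom.mem_ker, map_mul, map_inv, hs, hk, inv_mul_cancel]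
    have h1 : ρ k = (l ⟨_, hw⟩ : ℂ) • ρ (s x) := by
      calc ρ k = ρ (s x) * ρ ((s x)⁻¹ * k) := by rw [← map_mul, mul_inv_cancel_left]
        _ = _ := by rw [hW ⟨_, hw⟩, mul_smul_comm, mul_one]
    rw [h1, smul_mul_smul_comm, hl2', one_smul, ← map_mul]
    exact hW ⟨_, hs2 x⟩
  have inj : ∀ a b : ℂ, a • (1 : Module.End ℂ V) = b • (1 : Module.End ℂ V) → a = b :=
    fun a b hab => smul_left_injective ℂ one_ne_zero hab
  have hQc : ∀ x, x ≠ 0 → Q x = Q 1 := by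
    intro x hx
    obtain ⟨r, hr⟩ := sq_surj x
    have hr0 : r ≠ 0 := by rintro rfl; simp at hr; exact hx hr.symm
    obtain ⟨t, ht⟩ := hφ (tt (Units.mk0 r hr0))
    apply inj
    rw [← hQ (t * s 1 * t⁻¹) x]
    · have e : t * s 1 * t⁻¹ * (t * s 1 * t⁻¹) = t * (s 1 * s 1) * t⁻¹ := by group
      rw [← map_mul, e, map_mul, map_mul, map_mul ρ (s 1), hQ (s 1) 1 (hs 1), mul_smul_comm, mul_one, smul_mul_assoc,
        ← map_mul, mul_inv_cancel, map_one]
    · rw [map_mul, map_mul, map_inv, hs, ht, tt_uu, mul_assoc, mul_inv_cancel, mul_one]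
      simp [hr]
  have hQ0 : Q 0 = 1 := by
    apply inj
    rw [← hQ 1 0 (by rw [map_one, uu_zero])]; simp
  have hε : Q 1 = 1 ∨ Q 1 = -1 := mul_self_eq_one_iff.1 (hl2' _)
  rcases hε with hε | hε
  · have hQ1 : ∀ k, φ k ∈ UU F → ρ k * ρ k = 1 := by
      rintro k ⟨x, hx⟩
      rw [hQ k x hx.symm]
      rcases eq_or_ne x 0 with rfl | h
      · rw [hQ0, one_smul]
      · rw [hQc x h, hε, one_smul]
    intro a b ha hb
    have h1 := hQ1 a ha
    have h2 := hQ1 b hb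
    have h3 := hQ1 (a * b) (by rw [map_mul]; exact (UU F).mul_mem ha hb)
    rw [map_mul] at h3
    calc ρ a * ρ b = ρ a * (ρ a * ρ b * (ρ a * ρ b)) * ρ b := by rw [h3, mul_one]
      _ = (ρ a * ρ a) * (ρ b * ρ a) * (ρ b * ρ b) := by simp only [mul_assoc]
      _ = _ := by rw [h1, h2, one_mul, mul_one]
  · exfalso
    have hQ1 : ∀ k x, x ≠ 0 → φ k = uu x → ρ k * ρ k = -1 := by
      intro k x hx hk
      rw [hQ k x hk, hQc x hx, hε, neg_one_smul]
    have anti : ∀ a b x y, x ≠ 0 → y ≠ 0 → x ≠ y → φ a = uu x → φ b = uu y → ρ b * ρ a = - (ρ a * ρ b) := by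
      intro a b x y hx hy hxy ha hb
      have h1 := hQ1 a x hx ha
      have h2 := hQ1 b y hy hb
      have h3 := hQ1 (a * b) (x + y) (fun h => hxy (CharTwo.add_eq_zero.1 h)) (by rw [map_mul, ha, hb, uu_add])
      rw [map_mul] at h3
      calc ρ b * ρ a = (ρ a * ρ a) * (ρ b * ρ a) * (ρ b * ρ b) := by rw [h1, h2]; simp
        _ = ρ a * (ρ a * ρ b * (ρ a * ρ b)) * ρ b := by simp only [mul_assoc]
        _ = _ := by rw [h3]; simp
    classical
    rw [Nat.card_eq_fintype_card] at h8
    obtain ⟨y, hy⟩ : ∃ y : F, y ∉ ({0, 1} : Finset F) := by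
      by_contra! hh
      have := Finset.card_le_card (fun y _ => hh y : (Finset.univ : Finset F) ⊆ {0, 1})
      have h2 := Finset.card_le_two (a := (0 : F)) (b := 1)
      rw [Finset.card_univ] at this
      omega
    obtain ⟨z, hz⟩ : ∃ z : F, z ∉ ({0, 1, y, 1 + y} : Finset F) := by
      by_contra! hh
      have := Finset.card_le_card (fun y _ => hh y : (Finset.univ : Finset F) ⊆ {0, 1, y, 1 + y})
      have h2 := Finset.card_le_four (a := (0 : F)) (b := 1) (c := y) (d := 1 + y)
      rw [Finset.card_univ] at this
      omega
    simp only [Finset.mem_insert, Finset.mem_singleton, not_or] at hy hz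
    have hyz : y + z ≠ 0 := fun h => hz.2.2.1 (CharTwo.add_eq_zero.1 h).symm
    have h1yz : (1 : F) ≠ y + z := by
      intro h
      apply hz.2.2.2
      rw [h, add_right_comm, CharTwo.add_self_eq_zero, zero_add]
    have a1 := anti (s 1) (s y) 1 y one_ne_zero hy.1 (Ne.symm hy.2) (hs _) (hs _)
    have a2 := anti (s 1) (s z) 1 z one_ne_zero hz.1 (Ne.symm hz.2.1) (hs _) (hs _)
    have a3 := anti (s 1) (s y * s z) 1 (y + z) one_ne_zero hyz h1yz (hs _) (by rw [map_mul, hs, hs, uu_add])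
    rw [map_mul, mul_assoc, a2, mul_neg, ← mul_assoc, a1, neg_mul, neg_neg, ← mul_assoc, ← map_mul, ← map_mul] at a3
    obtain ⟨v, hv⟩ := exists_ne (0 : V)
    have h1 := LinearMap.congr_fun a3 (ρ (s 1 * s y * s z)⁻¹ v)
    rw [LinearMap.neg_apply, ← Module.End.mul_apply, ← map_mul, mul_inv_cancel, map_one, Module.End.one_apply] at h1
    have h2 : (2 : ℂ) • v = 0 := by rw [two_smul]; nth_rewrite 1 [h1]; exact neg_add_cancel v
    exact hv ((smul_eq_zero.1 h2).resolve_left two_ne_zero)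

theorem UU_index : (UU F).index = (Nat.card F + 1) * (Nat.card F - 1) := by
  have h1 := (UU F).card_mul_index
  rw [UU_card, SL_card] at h1
  have : 0 < Nat.card F := Nat.card_pos
  apply Nat.eq_of_mul_eq_mul_left this
  rw [h1]; ring

theorem even_q : 2 ∣ Nat.card F := by
  rw [← UU_card (F := F)]
  have h : orderOf (⟨uu 1, uu_mem 1⟩ : UU F) = 2 := by
    rw [orderOf_eq_prime_iff]
    refine ⟨Subtype.ext ?_, fun h => ?_⟩
    · change uu (1 : F) ^ 2 = 1
      rw [pow_two, ← uu_add, CharTwo.add_self_eq_zero, uu_zero]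
    · have := uu_inj ((congrArg Subtype.val h).trans uu_zero.symm)
      exact one_ne_zero this
  have := orderOf_dvd_natCard (⟨uu 1, uu_mem 1⟩ : UU F)
  rwa [h] at this

theorem multiplier (h8 : 8 ≤ Nat.card F) (hK : commutator K = ⊤) (hφ : Function.Surjective φ) (l : φ.ker →* ℂˣ)
    (hinv : ∀ (k : K) (w w' : φ.ker), (w' : K) = k * w * k⁻¹ → l w' = l w) : l = 1 := by
  by_contra hl
  have hex : ∃ n, 0 < n ∧ ∀ w, l w ^ n = 1 :=
    ⟨Nat.card φ.ker, Nat.card_pos, fun w => by rw [← map_pow, pow_card_eq_one', map_one]⟩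
  classical
  let n := Nat.find hex
  obtain ⟨hn0, hn⟩ : 0 < n ∧ ∀ w, l w ^ n = 1 := Nat.find_spec hex
  have h1 : n ≠ 1 := fun h => hl (by ext w; have := hn w; rw [h, pow_one] at this; rw [this]; rfl)
  obtain ⟨p, hp, hpd⟩ := Nat.exists_prime_and_dvd h1
  have : Fact p.Prime := ⟨hp⟩
  obtain ⟨m, hm⟩ : ∃ m : φ.ker →* ℂˣ, ∀ w, m w = l w ^ (n / p) := ⟨(powMonoidHom (n / p)).comp l, fun w => rfl⟩
  have hmp : ∀ w, m w ^ p = 1 := fun w => by rw [hm, ← pow_mul, Nat.div_mul_cancel hpd, hn]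
  have hm1 : ¬ ∀ w, m w = 1 := fun h => by
    have h2 := Nat.find_min' hex (m := n / p) ⟨Nat.div_pos (Nat.le_of_dvd hn0 hpd) hp.pos, fun w => by rw [← hm, h]⟩
    have h3 := Nat.div_lt_self hn0 hp.one_lt
    exact absurd h2 (not_le.2 h3)
  have hfinal : ∀ k, (∀ w, m w ^ k = 1) → p ∣ k := fun k hk => by
    by_contra hpk
    apply hm1
    intro w
    have h2 := Nat.dvd_gcd (orderOf_dvd_of_pow_eq_one (hmp w)) (orderOf_dvd_of_pow_eq_one (hk w))
    rw [(Nat.Prime.coprime_iff_not_dvd hp).2 hpk, Nat.dvd_one] at h2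
    exact orderOf_eq_one_iff.1 h2
  have hinv' : ∀ (k : K) (w w' : φ.ker), (w' : K) = k * w * k⁻¹ → m w' = m w := by
    intro k w w' h
    rw [hm, hm, hinv k w w' h]
  obtain ⟨V, _, _, _, ρ, v, hρ, hv0, hv⟩ := over_char φ.ker m
  have := hρ.nontrivial
  let E : Submodule ℂ V :=
    { carrier := {v | ∀ w : φ.ker, ρ w v = (m w : ℂ) • v}
      add_mem' := fun ha hb w => by rw [map_add, ha w, hb w, smul_add]
      zero_mem' := fun w => by simp
      smul_mem' := fun c v hv w => by rw [map_smul, hv w, smul_comm] }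
  have hE : E = ⊤ := by
    apply hρ.eq
    · intro k v hv w
      have hw' : k⁻¹ * w * k⁻¹⁻¹ ∈ φ.ker := (MonoidHom.normal_ker φ).conj_mem w w.2 k⁻¹
      have h2 := hv ⟨_, hw'⟩
      rw [hinv' k⁻¹ w ⟨_, hw'⟩ rfl] at h2
      have : (w : K) * k = k * (k⁻¹ * w * k⁻¹⁻¹) := by group
      rw [← Module.End.mul_apply, ← map_mul, this, map_mul, Module.End.mul_apply, h2, map_smul]
    · exact fun h => hv0 ((Submodule.mem_bot ℂ).1 (h ▸ (hv : v ∈ E)))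
  have hW : ∀ w : φ.ker, ρ w = (m w : ℂ) • (1 : Module.End ℂ V) := fun w => by
    ext u
    exact (hE ▸ Submodule.mem_top : u ∈ E) w
  rcases eq_or_ne p 2 with rfl | hp2
  · have h2 := mult_core hK hφ m hinv' ρ hW (UU F) (comm_two h8 m hmp ρ hφ hW)
    have h3 := hfinal _ h2
    rw [UU_index, Nat.prime_two.dvd_mul] at h3
    have := even_q (F := F)
    omega
  · let P : Sylow p (SL F) := default
    have h2 := mult_core hK hφ m hinv' ρ hW P (comm_odd hp2 m ρ hφ hW P P.isPGroup')
    exact P.not_dvd_index (hfinal _ h2)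

end mult
end ModH2

section ModH3

section grp
variable {F : Type} [Field F] [Finite F] [CharP F 2]

theorem orb_count (T : Subgroup (SL F)) : ∃ m, m + 1 ≤ Nat.card F + 1 ∧ Nat.card ↥(T ⊓ UU F) ∣ m ∧
    Nat.card T = (m + 1) * Nat.card ↥(T ⊓ BB F) := by
  classical
  let e : SL F ⧸ BB F := ((1 : SL F) : SL F ⧸ BB F)
  let X : Set (SL F ⧸ BB F) := MulAction.orbit T e \ {e}
  have hsm : ∀ a ∈ T ⊓ UU F, ∀ x ∈ X, a • x ∈ X := by
    rintro a ⟨haT, haU⟩ x ⟨⟨t, ht⟩, hxe⟩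
    refine ⟨⟨⟨a, haT⟩ * t, ?_⟩, fun h => hxe ?_⟩
    · rw [← ht]; exact mul_smul (⟨a, haT⟩ : T) t e
    · have h1 : x = a⁻¹ • e := by rw [eq_inv_smul_iff]; exact h
      rw [Set.mem_singleton_iff, h1]
      change ((a⁻¹ * 1 : SL F) : SL F ⧸ BB F) = _
      rw [eq_comm, QuotientGroup.eq]
      simpa using UU_le_BB haU
  let _ : MulAction ↥(T ⊓ UU F) X :=
    { smul := fun a x => ⟨(a : SL F) • (x : SL F ⧸ BB F), hsm a a.2 x x.2⟩
      one_smul := fun x => Subtype.ext (one_smul (SL F) (x : SL F ⧸ BB F))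
      mul_smul := fun a b x => Subtype.ext (mul_smul (a : SL F) (b : SL F) (x : SL F ⧸ BB F)) }
  have hfree : ∀ x : X, MulAction.stabilizer ↥(T ⊓ UU F) x = ⊥ := by
    intro x
    rw [eq_bot_iff]
    intro a ha
    have h1 : (a : SL F) • (x : SL F ⧸ BB F) = x := congrArg Subtype.val ha
    obtain ⟨y, hy⟩ := a.2.2
    rw [← hy] at h1
    rcases u_fix h1 with h | h
    · exact absurd h x.2.2
    · rw [Subgroup.mem_bot]; apply Subtype.ext; rw [← hy, h]; exact uu_zero
  have h1 := Nat.card_congr (MulAction.selfEquivOrbitsQuotientProd hfree)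
  rw [Nat.card_prod] at h1
  have hX : X.ncard + 1 = (MulAction.orbit T e).ncard :=
    Set.ncard_sdiff_singleton_add_one (MulAction.mem_orbit_self e) (Set.toFinite _)
  refine ⟨X.ncard, ?_, ?_, ?_⟩
  · rw [hX, ← BB_index, Subgroup.index, ← Set.ncard_univ]
    exact Set.ncard_le_ncard (Set.subset_univ _)
  · rw [← Nat.card_coe_set_eq, h1]; exact dvd_mul_left _ _
  · have h2 := (MulAction.stabilizer T e).card_mul_index
    rw [MulAction.index_stabilizer, ← hX] at h2
    rw [← h2, mul_comm]
    congr 1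
    have : MulAction.stabilizer T e = (BB F).subgroupOf T := by
      ext t
      rw [MulAction.mem_stabilizer_iff, Subgroup.mem_subgroupOf]
      change (((t : SL F) * 1 : SL F) : SL F ⧸ BB F) = _ ↔ _
      rw [eq_comm, QuotientGroup.eq]
      simp
    rw [this, inf_comm, Nat.card_congr (Subgroup.subgroupOfEquivOfLe (inf_le_right : BB F ⊓ T ≤ T)).toEquiv.symm, Subgroup.inf_subgroupOf_right]

theorem free_count (T : Subgroup (SL F)) {p : ℕ} (hp : p.Prime) (hp2 : p ≠ 2) (hd : p ∣ Nat.card ↥(T ⊓ BB F)) :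
    p ∣ Nat.card ↥(T ⊓ UU F) - 1 := by
  classical
  have := Fintype.ofFinite F
  have : Fact p.Prime := ⟨hp⟩
  obtain ⟨⟨b, hbT, hbB⟩, hb⟩ := exists_prime_orderOf_dvd_card' p hd
  have hb' : orderOf b = p := by rw [← hb]; exact (Subgroup.orderOf_mk _ _).symm
  obtain ⟨a, x, rfl⟩ := BB_decomp hbB
  let σ : Function.End ↥(T ⊓ UU F) :=
    fun u => ⟨(uu x * tt a) * u * (uu x * tt a)⁻¹, T.mul_mem (T.mul_mem hbT u.2.1) (T.inv_mem hbT), BB_norm hbB u.2.2⟩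
  have hσ : ∀ n (u : ↥(T ⊓ UU F)), (((σ ^ n) u : ↥(T ⊓ UU F)) : SL F) = (uu x * tt a) ^ n * u * ((uu x * tt a) ^ n)⁻¹ := by
    intro n
    induction n with
    | zero => intro u; rw [pow_zero, pow_zero, one_mul, inv_one, mul_one]; rfl
    | succ n ih =>
      intro u
      rw [pow_succ']
      change (uu x * tt a) * (((σ ^ n) u : ↥(T ⊓ UU F)) : SL F) * (uu x * tt a)⁻¹ = _
      rw [ih, pow_succ']; simp only [mul_inv_rev, mul_assoc]
  have hσp : σ ^ p ^ 1 = 1 := by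
    funext u
    apply Subtype.ext
    rw [hσ, pow_one, ← hb', pow_orderOf_eq_one, one_mul, inv_one, mul_one]; rfl
  have := Fintype.ofFinite ↥(T ⊓ UU F)
  have h1 := Equiv.Perm.card_fixedPoints_modEq hσp
  have ha : a ≠ 1 := by
    rintro rfl
    rw [tt_one, mul_one] at hb'
    have : uu x ^ 2 = 1 := by rw [pow_two, ← uu_add, CharTwo.add_self_eq_zero, uu_zero]
    have h2 := orderOf_dvd_of_pow_eq_one this
    rw [hb'] at h2
    exact hp2 ((Nat.prime_dvd_prime_iff_eq hp Nat.prime_two).1 h2)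
  have h2 : Fintype.card (Function.fixedPoints σ) = 1 := by
    rw [Fintype.card_eq_one_iff]
    refine ⟨⟨1, ?_⟩, ?_⟩
    · apply Subtype.ext
      change (uu x * tt a) * 1 * (uu x * tt a)⁻¹ = 1
      group
    · rintro ⟨⟨u, huT, ⟨y, rfl⟩⟩, hu⟩
      have h3 : (uu x * tt a) * uu y * (uu x * tt a)⁻¹ = uu y := congrArg Subtype.val hu
      rw [mul_inv_eq_iff_eq_mul, mul_assoc, tt_uu, ← mul_assoc, ← mul_assoc, mul_left_inj, ← uu_add, ← uu_add] at h3
      have h4 := uu_inj h3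
      have h5 : ((a : F) ^ 2 - 1) * y = 0 := by linear_combination h4
      rcases mul_eq_zero.1 h5 with h | h
      · exact absurd (sub_eq_zero.1 h) (sq_ne_one ha)
      · apply Subtype.ext; apply Subtype.ext
        change uu y = 1
        rw [h, uu_zero]
  rw [h2, ← Nat.card_eq_fintype_card] at h1
  exact (Nat.modEq_iff_dvd' Nat.card_pos).1 h1.symm

theorem T_eq_top (T : Subgroup (SL F)) (hT : Nat.card ↥(T ⊓ UU F) = Nat.card F ∨ 2 * Nat.card ↥(T ⊓ UU F) = Nat.card F)
    {p r : ℕ} (hp : p.Prime) (hr : r.Prime) (hpq : p ∣ Nat.card F - 1) (hrq : r ∣ Nat.card F + 1)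
    (hpT : p ∣ Nat.card T) (hrT : r ∣ Nat.card T) (h8 : 8 ≤ Nat.card F) : T = ⊤ := by
  have he := even_q (F := F)
  obtain ⟨m, hm, hdm, hTm⟩ := orb_count T
  have hBd : Nat.card ↥(T ⊓ BB F) ∣ Nat.card F * (Nat.card F - 1) := by
    rw [← BB_card]; exact Subgroup.card_dvd_of_le inf_le_right
  have hp2 : p ≠ 2 := by rintro rfl; omega
  have hr2 : r ≠ 2 := by rintro rfl; omega
  have hpp : ∀ k, p ∣ Nat.card F - 1 → p ∣ k → Nat.card F - 1 + 1 = k → False := fun k h1 h2 h3 => by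
    rw [← h3] at h2
    exact hp.one_lt.ne' (Nat.dvd_one.1 ((Nat.dvd_add_right h1).1 h2))
  have hrB : ¬ r ∣ Nat.card ↥(T ⊓ BB F) := by
    intro h
    rcases (hr.dvd_mul).1 (h.trans hBd) with h | h
    · exact hr.one_lt.ne' (Nat.dvd_one.1 ((Nat.dvd_add_right h).1 hrq))
    · have : Nat.card F + 1 = (Nat.card F - 1) + 2 := by omega
      rw [this] at hrq
      exact hr2 ((Nat.prime_dvd_prime_iff_eq hr Nat.prime_two).1 ((Nat.dvd_add_right h).1 hrq))
  have hrm : r ∣ m + 1 := by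
    rw [hTm] at hrT
    exact ((hr.dvd_mul).1 hrT).resolve_right hrB
  have hA0 : 0 < Nat.card ↥(T ⊓ UU F) := Nat.card_pos
  obtain ⟨j, hj⟩ := hdm
  have hm0 : m ≠ 0 := by
    rintro rfl
    exact hr.one_lt.ne' (Nat.dvd_one.1 hrm)
  have hmq : m = Nat.card F := by
    have hj0 : j ≠ 0 := by rintro rfl; simp at hj; exact hm0 hj
    rcases hT with h | h
    · rw [h] at hj
      have : Nat.card F ≤ m := by rw [hj]; exact Nat.le_mul_of_pos_right _ (by omega)
      omega
    · have hj2 : j ≤ 2 := by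
        by_contra hh
        have : Nat.card ↥(T ⊓ UU F) * 3 ≤ m := by rw [hj]; exact Nat.mul_le_mul_left _ (by omega)
        omega
      have : j = 2 := by
        by_contra hh
        have : j = 1 := by omega
        subst this
        have h3 : r ∣ (Nat.card F + 1) + 1 := by
          have := hrm.mul_left 2
          rw [hj] at this
          have h4 : 2 * (Nat.card ↥(T ⊓ UU F) * 1 + 1) = (Nat.card F + 1) + 1 := by omega
          rwa [h4] at this
        exact hr.one_lt.ne' (Nat.dvd_one.1 ((Nat.dvd_add_right hrq).1 h3))
      subst this
      omega
  have hpB : p ∣ Nat.card ↥(T ⊓ BB F) := by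
    rw [hTm, hmq] at hpT
    refine ((hp.dvd_mul).1 hpT).resolve_left fun h => ?_
    have : Nat.card F + 1 = (Nat.card F - 1) + 2 := by omega
    rw [this] at h
    exact hp2 ((Nat.prime_dvd_prime_iff_eq hp Nat.prime_two).1 ((Nat.dvd_add_right hpq).1 h))
  have hfc := free_count T hp hp2 hpB
  have hA : Nat.card ↥(T ⊓ UU F) = Nat.card F := by
    refine hT.resolve_right fun h => ?_
    have h2 := hfc.mul_left 2
    have h3 : Nat.card F - 1 = 2 * (Nat.card ↥(T ⊓ UU F) - 1) + 1 := by omega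
    rw [h3] at hpq
    exact hp.one_lt.ne' (Nat.dvd_one.1 ((Nat.dvd_add_right h2).1 hpq))
  have hU : UU F ≤ T := by
    have : T ⊓ UU F = UU F := Subgroup.eq_of_le_of_card_ge inf_le_right (by rw [hA, UU_card])
    rw [← this]; exact inf_le_left
  apply gen_U hU
  intro hB
  rw [inf_eq_left.2 hB] at hrB
  exact hrB hrT

end grp
end ModH3

section ModH4

/-- linear characters of a subgroup -/
def Ch {K : Type} [Group K] (N : Subgroup K) : Type := N →* ℂˣ

section ch
variable {K : Type} [Group K] {N : Subgroup K}

instance : CommGroup (Ch N) := inferInstanceAs (CommGroup (N →* ℂˣ))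
instance : CoeFun (Ch N) (fun _ => N → ℂˣ) := ⟨fun l => @DFunLike.coe (N →* ℂˣ) _ _ _ l⟩

theorem Ch.ext {l m : Ch N} (h : ∀ w, l w = m w) : l = m := MonoidHom.ext h
theorem Ch.mul_apply (l m : Ch N) (w : N) : (l * m) w = l w * m w := rfl
theorem Ch.one_apply (w : N) : (1 : Ch N) w = 1 := rfl
theorem Ch.inv_apply (l : Ch N) (w : N) : (l⁻¹) w = (l w)⁻¹ := rfl

theorem exists_Ch [Finite K] [Group.IsSolvable N] (hne : N ≠ ⊥) : ∃ l : Ch N, l ≠ 1 := by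
  have : Nontrivial N := N.nontrivial_iff_ne_bot.2 hne
  have h1 : commutator N < ⊤ := Group.IsSolvable.commutator_lt_top_of_nontrivial N
  obtain ⟨x, -, hx⟩ := SetLike.exists_of_lt h1
  have hx' : (Abelianization.of x : Abelianization N) ≠ 1 := by
    intro h
    apply hx
    rw [← Abelianization.ker_of]; exact h
  have : NeZero (Monoid.exponent (Abelianization N)) := ⟨Monoid.exponent_ne_zero_of_finite⟩
  obtain ⟨m, hm⟩ := CommGroup.exists_apply_ne_one_of_hasEnoughRootsOfUnity (Abelianization N) ℂ hx'
  refine ⟨(show Ch N from m.comp Abelianization.of), fun h => hm ?_⟩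
  exact DFunLike.congr_fun (show m.comp Abelianization.of = (1 : N →* ℂˣ) from h) x

variable [hN : N.Normal]

/-- conjugation of an element of a normal subgroup -/
def cj (k : K) (w : N) : N := ⟨k⁻¹ * w * k, by simpa using hN.conj_mem w w.2 k⁻¹⟩

instance chAct : MulDistribMulAction K (Ch N) where
  smul k l := show N →* ℂˣ from
    { toFun := fun w => l (cj k w)
      map_one' := by
        have : cj k (1 : N) = 1 := Subtype.ext (by simp [cj])
        rw [this]; exact map_one (show N →* ℂˣ from l)
      map_mul' := fun a b => by
        have : cj k (a * b) = cj k a * cj k b := Subtype.ext (by simp only [cj, Subgroup.coe_mul]; group)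
        rw [this]; exact map_mul (show N →* ℂˣ from l) _ _ }
  one_smul l := Ch.ext fun w => by
    change l (cj 1 w) = l w
    congr 1
    exact Subtype.ext (by simp [cj])
  mul_smul a b l := Ch.ext fun w => by
    change l (cj (a * b) w) = l (cj b (cj a w))
    congr 1
    exact Subtype.ext (by simp [cj, mul_assoc])
  smul_mul _ _ _ := rfl
  smul_one _ := rfl

theorem Ch.smul_apply (k : K) (l : Ch N) (w : N) : (k • l) w = l (cj k w) := rfl

theorem Ch.smul_of_mem {k : K} (hk : k ∈ N) (l : Ch N) : k • l = l := Ch.ext fun w => by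
  rw [Ch.smul_apply]
  have : cj k w = (⟨k, hk⟩ : N)⁻¹ * w * ⟨k, hk⟩ := rfl
  rw [this]
  change (show N →* ℂˣ from l) _ = (show N →* ℂˣ from l) _
  rw [map_mul, map_mul, mul_right_comm, ← map_mul, inv_mul_cancel, map_one, one_mul]

theorem Ch.le_stab (l : Ch N) : N ≤ MulAction.stabilizer K l := fun _ hk => Ch.smul_of_mem hk l

theorem Ch.smul_congr {k k' : K} (h : k⁻¹ * k' ∈ N) (l : Ch N) : k • l = k' • l := by
  rw [← mul_inv_cancel_left k k', mul_smul, Ch.smul_of_mem h]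

variable {V : Type} [AddCommGroup V] [Module ℂ V]

/-- eigenspaces -/
def Eig (ρ : Representation ℂ K V) (l : Ch N) : Submodule ℂ V where
  carrier := {v | ∀ w : N, ρ w v = (l w : ℂ) • v}
  add_mem' := fun ha hb w => by rw [map_add, ha w, hb w, smul_add]
  zero_mem' := fun w => by simp
  smul_mem' := fun c v hv w => by rw [map_smul, hv w, smul_comm]

theorem rho_Eig (ρ : Representation ℂ K V) (k : K) (l : Ch N) (v : V) (hv : v ∈ Eig ρ l) : ρ k v ∈ Eig ρ (k • l) := by
  intro w
  have h := hv (cj k w)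
  have e : (w : K) * k = k * (cj k w : N) := by simp [cj, mul_assoc]
  rw [← Module.End.mul_apply, ← map_mul, e, map_mul, Module.End.mul_apply, h, map_smul]; rfl

theorem Eig_indep [Finite K] (ρ : Representation ℂ K V) : iSupIndep (fun l : Ch N => Eig ρ l) := by
  have := Fintype.ofFinite N
  intro l
  rw [Submodule.disjoint_def]
  let e : V →ₗ[ℂ] V := ∑ w : N, ((l w)⁻¹ : ℂˣ).val • ρ w
  intro x hx hx'
  have h1 : e x = (Fintype.card N : ℂ) • x := by
    simp only [e, LinearMap.sum_apply, LinearMap.smul_apply]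
    rw [Finset.sum_congr rfl (g := fun _ => x), Finset.sum_const, Finset.card_univ, Nat.cast_smul_eq_nsmul]
    intro w _
    rw [hx w, smul_smul, Units.inv_mul, one_smul]
  have h2 : (⨆ j, ⨆ (_ : j ≠ l), Eig ρ j) ≤ LinearMap.ker e := by
    refine iSup_le fun j => iSup_le fun hj => fun y hy => ?_
    rw [LinearMap.mem_ker]
    simp only [e, LinearMap.sum_apply, LinearMap.smul_apply]
    let χ : N →* ℂ := (Units.coeHom ℂ).comp (show N →* ℂˣ from l⁻¹ * j)
    rw [Finset.sum_congr rfl (g := fun w => χ w • y), ← Finset.sum_smul, sum_hom_units_eq_zero χ, zero_smul]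
    · intro h
      apply hj
      have : l⁻¹ * j = 1 := Ch.ext fun w => Units.ext (DFunLike.congr_fun h w)
      exact (inv_mul_eq_one.1 this).symm
    · intro w _
      rw [hy w, smul_smul]; rfl
  have h3 := LinearMap.mem_ker.1 (h2 hx')
  rw [h1] at h3
  exact (smul_eq_zero.1 h3).resolve_left (Nat.cast_ne_zero.2 Fintype.card_ne_zero)

theorem ch_orbit [Finite K] [FiniteDimensional ℂ V] {ρ : Representation ℂ K V} (hρ : Irr ρ) (l : Ch N) (X : Submodule ℂ V)
    (hXE : X ≤ Eig ρ l) (hX0 : X ≠ ⊥) (hX : ∀ h ∈ MulAction.stabilizer K l, ∀ v ∈ X, ρ h v ∈ X) :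
    Module.finrank ℂ V = (MulAction.stabilizer K l).index * Module.finrank ℂ X :=
  orbit_lemma hρ (fun l : Ch N => Eig ρ l) (Eig_indep ρ) (fun g j v hv => rho_Eig ρ g j v hv) l X hXE hX0 hX

theorem exists_Eig [Finite K] (l : Ch N) :
    ∃ (V : Type) (_ : AddCommGroup V) (_ : Module ℂ V) (_ : FiniteDimensional ℂ V) (ρ : Representation ℂ K V),
      Irr ρ ∧ Eig ρ l ≠ ⊥ := by
  obtain ⟨V, _, _, _, ρ, v, hρ, hv0, hv⟩ := over_char N (show N →* ℂˣ from l)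
  exact ⟨V, _, _, inferInstance, ρ, hρ, fun h => hv0 ((Submodule.mem_bot ℂ).1 (h ▸ (hv : v ∈ Eig ρ l)))⟩

theorem Ch.Eig_le_stab [Finite K] (ρ : Representation ℂ K V) (l : Ch N) :
    ∀ h ∈ MulAction.stabilizer K l, ∀ v ∈ Eig ρ l, ρ h v ∈ Eig ρ l := fun h hh v hv => by
  have := rho_Eig ρ h l v hv
  rwa [MulAction.mem_stabilizer_iff.1 hh] at this
end ch
end ModH4

section ModH5

section h5
variable {F : Type} [Field F] [Finite F] [CharP F 2]

theorem UU_comm {a b : SL F} (ha : a ∈ UU F) (hb : b ∈ UU F) : a * b = b * a := by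
  obtain ⟨x, rfl⟩ := ha
  obtain ⟨y, rfl⟩ := hb
  rw [← uu_add, ← uu_add, add_comm]

theorem UU_sq {a : SL F} (ha : a ∈ UU F) : a * a = 1 := by
  obtain ⟨x, rfl⟩ := ha
  rw [← uu_add, CharTwo.add_self_eq_zero, uu_zero]

theorem BB_comm {b c : SL F} (hb : b ∈ BB F) (hc : c ∈ BB F) : (b * c)⁻¹ * (c * b) ∈ UU F := by
  obtain ⟨a, x, rfl⟩ := BB_decomp hb
  obtain ⟨d, y, rfl⟩ := BB_decomp hc
  have h1 : ∀ (a d : Fˣ) (x y : F), uu x * tt a * (uu y * tt d) = uu (x + a ^ 2 * y) * tt (a * d) := by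
    intro a d x y
    rw [uu_add, tt_mul, mul_assoc, ← mul_assoc (tt a), tt_uu]; simp only [mul_assoc]
  rw [h1, h1, mul_comm d a, mul_inv_rev, mul_assoc, ← mul_assoc (uu _)⁻¹, ← mul_assoc (tt (a * d))⁻¹]
  have := BB_norm ((BB F).inv_mem (tt_mem_BB (a * d))) ((UU F).mul_mem ((UU F).inv_mem (uu_mem (x + a ^ 2 * y))) (uu_mem (y + d ^ 2 * x)))
  rwa [inv_inv] at this

theorem exists_nu : ∃ ν : UU F →* ℂˣ, ν ≠ 1 := by
  have : IsMulCommutative (UU F) := ⟨⟨fun a b => Subtype.ext (UU_comm a.2 b.2)⟩⟩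
  have : Group.IsSolvable (UU F) := Group.isSolvable_of_comm fun a b => Subtype.ext (UU_comm a.2 b.2)
  refine exists_Ch (N := UU F) fun h => ?_
  have h1 := uu_mem (1 : F)
  rw [h, Subgroup.mem_bot, ← uu_zero] at h1
  exact one_ne_zero (uu_inj h1)

variable {I : Type} [Group I] [Finite I] {ψ : I →* SL F}

theorem U_normal (hB : ∀ i, ψ i ∈ BB F) : ((UU F).comap ψ).Normal := ⟨fun w hw i => by
  rw [Subgroup.mem_comap, map_mul, map_mul, map_inv]
  exact BB_norm (hB i) hw⟩

theorem fixed_trivial (hB : ∀ i, ψ i ∈ BB F) (hU : ∀ x, ∃ i, ψ i = uu x) [hn : ((UU F).comap ψ).Normal]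
    (κ : Ch ((UU F).comap ψ)) (hκ : ∀ w : (UU F).comap ψ, ψ w = 1 → κ w = 1) (i : I) (hi : i ∉ (UU F).comap ψ) (hfix : i • κ = κ) : κ = 1 := by
  have := Fintype.ofFinite F
  obtain ⟨a, x, hax⟩ := BB_decomp (hB i)
  have ha : a ≠ 1 := by
    rintro rfl
    rw [tt_one, mul_one] at hax
    exact hi (Subgroup.mem_comap.2 (hax ▸ uu_mem x))
  have ha2 : (a : F) ^ 2 - 1 ≠ 0 := sub_ne_zero.2 (sq_ne_one ha)
  apply Ch.ext
  intro w
  obtain ⟨y, hy⟩ := w.2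
  obtain ⟨w', hw'⟩ := hU (y / ((a : F) ^ 2 - 1))
  have hw'U : w' ∈ (UU F).comap ψ := Subgroup.mem_comap.2 (hw' ▸ uu_mem _)
  have hfix' : i⁻¹ • κ = κ := by rw [inv_smul_eq_iff, hfix]
  let K' : ((UU F).comap ψ) →* ℂˣ := κ
  have h1 : K' (cj i⁻¹ ⟨w', hw'U⟩) = K' ⟨w', hw'U⟩ := by
    have := Ch.smul_apply i⁻¹ κ ⟨w', hw'U⟩
    rw [hfix'] at this
    exact this.symm
  have h2 : K' (w⁻¹ * (cj i⁻¹ ⟨w', hw'U⟩ * ⟨w', hw'U⟩⁻¹)) = 1 := by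
    apply hκ
    change ψ ((w : I)⁻¹ * ((i⁻¹⁻¹ * w' * i⁻¹) * w'⁻¹)) = 1
    simp only [map_mul, map_inv]
    rw [inv_inv, hax, hw', ← hy, mul_assoc (uu x), tt_uu,
      mul_inv_rev, ← tt_inv, ← uu_neg, ← uu_neg, ← uu_neg]
    have : uu x * (uu ((a : F) ^ 2 * (y / ((a : F) ^ 2 - 1))) * tt a) * (tt a⁻¹ * uu (-x)) = uu (x + (a : F) ^ 2 * (y / ((a : F) ^ 2 - 1)) + -x) := by
      rw [uu_add, uu_add]
      simp only [mul_assoc]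
      rw [← mul_assoc (tt a), ← tt_mul, mul_inv_cancel, tt_one, one_mul]
    rw [this, ← uu_add, ← uu_add, ← uu_zero]
    congr 1
    field_simp
    ring
  rw [map_mul, map_mul, h1, map_inv, map_inv, mul_inv_cancel, mul_one, inv_eq_one] at h2
  exact h2

theorem ext_free (hB : ∀ i, ψ i ∈ BB F) (hU : ∀ x, ∃ i, ψ i = uu x) [hn : ((UU F).comap ψ).Normal]
    (μ : Ch ((UU F).comap ψ)) (hμ : ∀ (i : I) (w : (UU F).comap ψ), ψ w = 1 → (i • μ) w = μ w) :
    ∃ μ' : Ch ((UU F).comap ψ), (∀ w : (UU F).comap ψ, ψ w = 1 → μ' w = μ w) ∧ MulAction.stabilizer I μ' = (UU F).comap ψ := by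
  have key : ∃ μ' : Ch ((UU F).comap ψ), (∀ w : (UU F).comap ψ, ψ w = 1 → μ' w = μ w) ∧ ∀ i, i • μ' = μ' → i ∈ (UU F).comap ψ := by
    by_cases h0 : ∀ i, i • μ = μ → i ∈ (UU F).comap ψ
    · exact ⟨μ, fun _ _ => rfl, h0⟩
    push Not at h0
    obtain ⟨i, hi, hiU⟩ := h0
    obtain ⟨ν, hν⟩ := exists_nu (F := F)
    let ν' : Ch ((UU F).comap ψ) := ν.comp ((ψ.comp ((UU F).comap ψ).subtype).codRestrict (UU F) fun w => w.2)
    have hν' : ∀ w : ((UU F).comap ψ), ν' w = ν ⟨ψ w, w.2⟩ := fun w => rfl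
    have hνW : ∀ w : ((UU F).comap ψ), ψ w = 1 → ν' w = 1 := by
      intro w hw
      rw [hν']
      have : (⟨ψ w, w.2⟩ : UU F) = 1 := Subtype.ext hw
      rw [this, map_one]
    refine ⟨μ * ν', fun w hw => by rw [Ch.mul_apply, hνW w hw, mul_one], ?_⟩
    intro j hj
    by_contra hjU
    have hij : i • j • μ = j • μ := by
      rw [smul_smul, Ch.smul_congr (k' := j * i), mul_smul, hi]
      rw [Subgroup.mem_comap, map_mul, map_inv, map_mul, map_mul]
      exact BB_comm (hB i) (hB j)
    have h1 : μ⁻¹ * (j • μ) = 1 := by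
      refine fixed_trivial hB hU _ ?_ i hiU ?_
      · intro w hw
        rw [Ch.mul_apply, Ch.inv_apply, hμ j w hw, inv_mul_cancel]
      · rw [smul_mul', smul_inv', hi, hij]
    have h2 : j • μ = μ := (inv_mul_eq_one.1 h1).symm
    rw [smul_mul', h2] at hj
    have h3 := fixed_trivial hB hU ν' hνW j hjU (mul_left_cancel hj)
    apply hν
    ext u
    obtain ⟨x, hx⟩ := u.2
    obtain ⟨k, hk⟩ := hU x
    have hkU : k ∈ (UU F).comap ψ := Subgroup.mem_comap.2 (hk ▸ uu_mem _)
    have h4 := hν' ⟨k, hkU⟩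
    rw [h3] at h4
    have : (⟨ψ k, hkU⟩ : UU F) = u := Subtype.ext (hk.trans hx)
    rw [← this]
    exact congrArg Units.val h4.symm
  obtain ⟨μ', h1, h2⟩ := key
  exact ⟨μ', h1, le_antisymm (fun i hi => h2 i hi) (Ch.le_stab μ')⟩

theorem exists_Y (hB : ∀ i, ψ i ∈ BB F) (hU : ∀ x, ∃ i, ψ i = uu x) 
    (μ : ((UU F).comap ψ) →* ℂˣ) (hμ : ∀ (i : I) (w w' : (UU F).comap ψ), ψ w = 1 → (w' : I) = i⁻¹ * w * i → μ w' = μ w) :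
    ∃ (V : Type) (_ : AddCommGroup V) (_ : Module ℂ V) (_ : FiniteDimensional ℂ V) (ρ : Representation ℂ I V),
      Irr ρ ∧ (∀ w : (UU F).comap ψ, ψ w = 1 → ∀ v, ρ w v = (μ w : ℂ) • v) ∧ ((UU F).comap ψ).index ∣ Module.finrank ℂ V := by
  have hn := U_normal hB
  obtain ⟨μ', h1, h2⟩ := ext_free hB hU (show Ch ((UU F).comap ψ) from μ) (fun i w hw => by
    rw [Ch.smul_apply]
    exact hμ i w _ hw rfl)
  obtain ⟨V, _, _, _, ρ, hρ, hE⟩ := exists_Eig μ'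
  refine ⟨V, _, _, inferInstance, ρ, hρ, ?_, ?_⟩
  · let E : Submodule ℂ V :=
      { carrier := {v | ∀ w : (UU F).comap ψ, ψ w = 1 → ρ w v = (μ w : ℂ) • v}
        add_mem' := fun ha hb w hw => by rw [map_add, ha w hw, hb w hw, smul_add]
        zero_mem' := fun w _ => by simp
        smul_mem' := fun c v hv w hw => by rw [map_smul, hv w hw, smul_comm] }
    have hE' : E = ⊤ := by
      apply hρ.eq
      · intro k v hv w hw
        have h3 := hv (cj k w) (by
          change ψ (k⁻¹ * w * k) = 1
          rw [map_mul, map_mul, hw, mul_one, ← map_mul, inv_mul_cancel, map_one])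
        rw [hμ k w _ hw rfl] at h3
        have e : (w : I) * k = k * (cj k w : (UU F).comap ψ) := by simp [cj, mul_assoc]
        rw [← Module.End.mul_apply, ← map_mul, e, map_mul, Module.End.mul_apply, h3, map_smul]
      · obtain ⟨v, hv, hv0⟩ := (Submodule.ne_bot_iff _).1 hE
        refine (Submodule.ne_bot_iff _).2 ⟨v, fun w hw => ?_, hv0⟩
        rw [hv w, h1 w hw]
    intro w hw v
    exact (hE' ▸ Submodule.mem_top : v ∈ E) w hw
  · have h3 := ch_orbit hρ μ' (Eig ρ μ') le_rfl hE (Ch.Eig_le_stab ρ μ')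
    rw [h3, h2]
    exact dvd_mul_right _ _

end h5
end ModH5

section ModH6

theorem odd_commute {I : Type} [Group I] {E : Type} [AddCommGroup E] [Module ℂ E] [FiniteDimensional ℂ E] [Nontrivial E]
    (σ : Representation ℂ I E) (hodd : ¬ 2 ∣ Module.finrank ℂ E) (a b : I) (c s : ℂ)
    (hc : σ (a⁻¹ * b⁻¹ * a * b) = c • (1 : Module.End ℂ E)) (hs : σ (a * a) = s • (1 : Module.End ℂ E)) :
    σ a * σ b = σ b * σ a := by
  have h1 : σ a * σ b = c • (σ b * σ a) := by
    have e : a * b = b * a * (a⁻¹ * b⁻¹ * a * b) := by group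
    rw [← map_mul, e, map_mul, hc, mul_smul_comm, mul_one, map_mul]
  have hdet : ∀ g, LinearMap.det (σ g) ≠ 0 := fun g h => by
    have : LinearMap.det (σ g) * LinearMap.det (σ g⁻¹) = 1 := by
      rw [← map_mul, ← map_mul, mul_inv_cancel, map_one, map_one]
    rw [h, zero_mul] at this
    exact zero_ne_one this
  have h2 : c ^ Module.finrank ℂ E = 1 := by
    have := congrArg LinearMap.det h1
    rw [LinearMap.det_smul, map_mul, map_mul, mul_comm (LinearMap.det (σ b))] at this
    exact mul_right_cancel₀ (mul_ne_zero (hdet a) (hdet b)) (by rw [one_mul]; exact this.symm)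
  have hinj : ∀ g, σ g ≠ 0 := fun g h => by
    apply hdet g
    rw [h, LinearMap.det_zero, zero_pow Module.finrank_pos.ne']
  have h3 : c ^ 2 = 1 := by
    have h4 : σ a * σ a * σ b = c ^ 2 • (σ b * (σ a * σ a)) := by
      rw [mul_assoc, h1, mul_smul_comm, ← mul_assoc, h1, smul_mul_assoc, smul_smul, pow_two, mul_assoc]
    rw [← map_mul, hs, smul_mul_assoc, one_mul, mul_smul_comm, mul_one, smul_smul] at h4
    have h5 := smul_left_injective ℂ (hinj b) h4
    have hs0 : s ≠ 0 := by
      rintro rfl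
      rw [zero_smul] at hs
      exact hinj _ hs
    exact mul_right_cancel₀ hs0 (by rw [one_mul]; exact h5.symm)
  have h4 : c = 1 := by
    obtain ⟨k, hk⟩ : ∃ k, Module.finrank ℂ E = 2 * k + 1 := ⟨Module.finrank ℂ E / 2, by omega⟩
    rwa [hk, pow_succ, pow_mul, h3, one_pow, one_mul] at h2
  rw [h1, h4, one_smul]

section h6
variable {F : Type} [Field F] [Finite F] [CharP F 2] {K : Type} [Group K] [Finite K] {φ : K →* SL F}

/-- image of the stabilizer of a character -/
def TT (l : Ch φ.ker) : Subgroup (SL F) := (MulAction.stabilizer K l).map φ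

theorem mem_TT {l : Ch φ.ker} {k : K} : φ k ∈ TT l ↔ k • l = l := by
  constructor
  · rintro ⟨k', hk', h⟩
    rw [← Ch.smul_congr (k := k') (k' := k)]
    · exact hk'
    · rw [MonoidHom.mem_ker, map_mul, map_inv, h, inv_mul_cancel]
  · exact fun h => ⟨k, h, rfl⟩

theorem TT_index (hφ : Function.Surjective φ) (l : Ch φ.ker) : (MulAction.stabilizer K l).index = (TT l).index := by
  rw [← Subgroup.index_comap_of_surjective _ hφ]
  congr 1
  ext k
  rw [Subgroup.mem_comap, mem_TT]; rfl

theorem card_subgroupOf {G : Type*} [Group G] (H T : Subgroup G) : Nat.card (H.subgroupOf T) = Nat.card ↥(H ⊓ T) := by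
  rw [← Subgroup.inf_subgroupOf_right, Nat.card_congr (Subgroup.subgroupOfEquivOfLe (inf_le_right : H ⊓ T ≤ T)).toEquiv]

theorem max_l (hφ : Function.Surjective φ) (hex : ∃ l : Ch φ.ker, l ≠ 1) :
    ∃ l : Ch φ.ker, l ≠ 1 ∧ (Nat.card ↥(TT l ⊓ UU F) = Nat.card F ∨ 2 * Nat.card ↥(TT l ⊓ UU F) = Nat.card F) := by
  obtain ⟨l0, hl0⟩ := hex
  obtain ⟨l, hl, hmin⟩ := WellFounded.has_min (InvImage.wf (fun l : Ch φ.ker => Nat.card (UU F) - Nat.card ↥(TT l ⊓ UU F)) wellFounded_lt)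
    {l | l ≠ 1} ⟨l0, hl0⟩
  refine ⟨l, hl, ?_⟩
  have hmin' : ∀ m : Ch φ.ker, TT l ⊓ UU F < TT m ⊓ UU F → m = 1 := by
    intro m hm
    by_contra hm1
    apply hmin m hm1
    have h1 : Nat.card ↥(TT l ⊓ UU F) < Nat.card ↥(TT m ⊓ UU F) := by
      refine lt_of_le_of_ne (Subgroup.card_le_of_le hm.le) fun h => hm.ne (Subgroup.eq_of_le_of_card_ge hm.le h.ge)
    have h2 : Nat.card ↥(TT m ⊓ UU F) ≤ Nat.card (UU F) := Subgroup.card_le_of_le inf_le_right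
    change Nat.card (UU F) - Nat.card ↥(TT m ⊓ UU F) < Nat.card (UU F) - Nat.card ↥(TT l ⊓ UU F)
    omega
  have hinv : ∀ k, φ k ∈ UU F → φ k ∉ TT l → k • l = l⁻¹ := by
    intro k hk hkT
    have h1 : l * (k • l) = 1 := by
      apply hmin'
      refine lt_of_le_of_ne ?_ ?_
      · rintro _ ⟨⟨x, hx, rfl⟩, hxU⟩
        refine ⟨mem_TT.2 ?_, hxU⟩
        have hx' : x • l = l := hx
        rw [smul_mul', hx', smul_smul, Ch.smul_congr (k' := k * x), mul_smul, hx']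
        rw [MonoidHom.mem_ker, map_mul, map_inv, map_mul, map_mul, UU_comm hxU hk, inv_mul_cancel]
      · intro h
        have : φ k ∈ TT l ⊓ UU F := by
          rw [h]
          refine ⟨mem_TT.2 ?_, hk⟩
          rw [smul_mul', smul_smul, Ch.smul_of_mem (k := k * k), mul_comm]
          rw [MonoidHom.mem_ker, map_mul, UU_sq hk]
        exact hkT this.1
    exact (inv_eq_of_mul_eq_one_right h1).symm
  by_cases hU : UU F ≤ TT l
  · left; rw [inf_eq_right.2 hU, UU_card]
  · right
    obtain ⟨u, huU, huT⟩ := SetLike.not_le_iff_exists.1 hU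
    obtain ⟨k, rfl⟩ := hφ u
    have h1 : (TT l).relIndex (UU F) = 2 := by
      rw [Subgroup.relIndex_eq_two_iff]
      refine ⟨φ k, huU, fun b hb => ?_⟩
      obtain ⟨x, rfl⟩ := hφ b
      by_cases hx : φ x ∈ TT l
      · refine Or.inr ⟨hx, fun h => huT ?_⟩
        exact (Subgroup.mul_mem_cancel_left _ hx).1 h
      · refine Or.inl ⟨?_, hx⟩
        rw [← map_mul, mem_TT, mul_smul, hinv k huU huT, smul_inv', hinv x hb hx, inv_inv]
    have h2 := ((TT l).subgroupOf (UU F)).card_mul_index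
    rw [card_subgroupOf, UU_card] at h2
    change _ * (TT l).relIndex (UU F) = _ at h2
    rw [h1] at h2
    omega

theorem TT_ne_top (h8 : 8 ≤ Nat.card F) (hK : commutator K = ⊤) (hφ : Function.Surjective φ) (l : Ch φ.ker) (hl : l ≠ 1) :
    TT l ≠ ⊤ := by
  intro h
  apply hl
  refine multiplier h8 hK hφ l fun k w w' hww => ?_
  have h1 : k⁻¹ • l = l := mem_TT.1 (h ▸ Subgroup.mem_top _)
  have h2 := Ch.smul_apply k⁻¹ l w
  rw [h1] at h2
  have : w' = cj k⁻¹ w := Subtype.ext (by rw [hww]; simp [cj])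
  rw [this]
  exact h2.symm

theorem odd_case (h8 : 8 ≤ Nat.card F) (hK : commutator K = ⊤) (hφ : Function.Surjective φ) (l : Ch φ.ker) (hl : l ≠ 1)
    (hUT : UU F ≤ TT l) {V : Type} [AddCommGroup V] [Module ℂ V] [FiniteDimensional ℂ V] {ρ : Representation ℂ K V}
    (hρ : Irr ρ) (hE : Eig ρ l ≠ ⊥) (hodd : ¬ 2 ∣ Module.finrank ℂ V) :
    ∃ n, Deg K n ∧ (Nat.card F + 1) * (Nat.card F - 1) ∣ n := by
  let I := MulAction.stabilizer K l
  let ψ : I →* SL F := φ.comp I.subtype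
  have hTB : TT l ≤ BB F := by
    by_contra h
    exact TT_ne_top h8 hK hφ l hl (gen_U hUT h)
  have hB : ∀ i, ψ i ∈ BB F := fun i => hTB ⟨i, i.2, rfl⟩
  have hU : ∀ x, ∃ i, ψ i = uu x := fun x => by
    obtain ⟨i, hi, h⟩ := hUT (uu_mem x)
    exact ⟨⟨i, hi⟩, h⟩
  have hEI : RInv (res ρ I) (Eig ρ l) := fun g v hv => Ch.Eig_le_stab ρ l g g.2 v hv
  let σ := subrep (res ρ I) (Eig ρ l) hEI
  have : Nontrivial (Eig ρ l) := Submodule.nontrivial_iff_ne_bot.2 hE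
  have hodd' : ¬ 2 ∣ Module.finrank ℂ (Eig ρ l) := fun h => hodd (by
    rw [ch_orbit hρ l (Eig ρ l) le_rfl hE (Ch.Eig_le_stab ρ l)]
    exact h.mul_left _)
  have hσ : ∀ (i : I) (hi : φ i = 1), σ i = (l ⟨i, hi⟩ : ℂ) • (1 : Module.End ℂ (Eig ρ l)) := by
    intro i hi
    ext v
    exact v.2 ⟨i, hi⟩
  have hcomm : ∀ a b : (UU F).comap ψ, σ a * σ b = σ b * σ a := by
    intro a b
    refine odd_commute σ hodd' a b _ _ (hσ _ ?_) (hσ _ ?_)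
    · change ψ ((a : I)⁻¹ * (b : I)⁻¹ * a * b) = 1
      rw [map_mul, map_mul, map_mul, map_inv, map_inv, ← mul_inv_rev, mul_assoc, UU_comm a.2 b.2, inv_mul_cancel]
    · change ψ ((a : I) * a) = 1
      rw [map_mul]
      exact UU_sq a.2
  obtain ⟨v, -, hv0, hv⟩ := exists_eigenvector (res σ ((UU F).comap ψ)) (p := ⊤) top_ne_bot (RInv.top _) (fun a b v _ => by
    exact LinearMap.congr_fun (hcomm a b) v)
  obtain ⟨μ, hμ⟩ := exists_char _ hv0 hv
  have hμl : ∀ (w : (UU F).comap ψ) (hw : φ (w : I) = 1), μ w = l ⟨(w : I), hw⟩ := by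
    intro w hw
    have h1 := hμ w
    have h2 := LinearMap.congr_fun (hσ w hw) v
    exact Units.ext (smul_left_injective ℂ hv0 (h1.symm.trans h2))
  have hconj : ∀ (i : I) (w w' : (UU F).comap ψ), ψ w = 1 → (w' : I) = i⁻¹ * w * i → μ w' = μ w := by
    intro i w w' hw hww
    have hw' : φ (w' : I) = 1 := by
      change ψ w' = 1
      rw [hww, map_mul, map_mul, hw, mul_one, ← map_mul, inv_mul_cancel, map_one]
    rw [hμl w hw, hμl w' hw']
    have h1 : (i : K) • l = l := i.2
    have h2 := Ch.smul_apply (i : K) l ⟨(w : I), hw⟩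
    rw [h1] at h2
    rw [h2]
    congr 1
    exact Subtype.ext (congrArg (fun z : I => (z : K)) hww)
  obtain ⟨Y, _, _, _, τ, hτ, hW, hd⟩ := exists_Y hB hU μ hconj
  obtain ⟨V', _, _, _, ρ', f, hρ', hf, hfτ⟩ := exists_over I hτ
  have := hτ.nontrivial
  have h1 := ch_orbit hρ' l (LinearMap.range f) (by
    rintro _ ⟨y, rfl⟩ w
    have hwI : (w : K) ∈ I := Ch.le_stab l w.2
    have hwU : (⟨w, hwI⟩ : I) ∈ (UU F).comap ψ := by
      rw [Subgroup.mem_comap]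
      have : ψ ⟨w, hwI⟩ = 1 := w.2
      rw [this]; exact (UU F).one_mem
    have h2 := hW ⟨_, hwU⟩ w.2 y
    rw [hμl ⟨_, hwU⟩ w.2] at h2
    have h3 := hfτ ⟨w, hwI⟩ y
    rw [h2, map_smul] at h3
    exact h3.symm) (fun h => by
      obtain ⟨y, hy⟩ := exists_ne (0 : Y)
      have h2 : f y ∈ LinearMap.range f := ⟨y, rfl⟩
      rw [h, Submodule.mem_bot] at h2
      exact hy (hf (h2.trans (map_zero f).symm))) (by
    rintro i hi _ ⟨y, rfl⟩
    exact ⟨τ ⟨i, hi⟩ y, hfτ ⟨i, hi⟩ y⟩)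
  refine ⟨_, ⟨V', _, _, inferInstance, ρ', hρ', rfl⟩, ?_⟩
  rw [h1, LinearMap.finrank_range_of_inj hf, ← UU_index, ← Subgroup.index_comap_of_surjective (UU F) hφ,
    ← Subgroup.relIndex_mul_index (H := (UU F).comap φ) (K := I), mul_comm]
  · exact mul_dvd_mul_left _ hd
  · intro k hk
    exact mem_TT.1 (hUT hk)

theorem ker_trivial (h8 : 8 ≤ Nat.card F) (hK : commutator K = ⊤) (hφ : Function.Surjective φ) [Group.IsSolvable φ.ker]
    (hd2 : ∀ n, Deg K n → 2 ∣ n → (∃ p, p.Prime ∧ p ∣ Nat.card F - 1 ∧ ¬ p ∣ n) ∧ (∃ r, r.Prime ∧ r ∣ Nat.card F + 1 ∧ ¬ r ∣ n))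
    (hd1 : ∀ n, Deg K n → ¬ (Nat.card F + 1) * (Nat.card F - 1) ∣ n) : φ.ker = ⊥ := by
  by_contra hne
  obtain ⟨l, hl, hlU⟩ := max_l hφ (exists_Ch hne)
  obtain ⟨V, _, _, _, ρ, hρ, hE⟩ := exists_Eig l
  have hdim := ch_orbit hρ l (Eig ρ l) le_rfl hE (Ch.Eig_le_stab ρ l)
  rw [TT_index hφ] at hdim
  have hcard := (TT l).card_mul_index
  by_cases h2 : 2 ∣ Module.finrank ℂ V
  · obtain ⟨⟨p, hp, hpq, hpn⟩, ⟨r, hr, hrq, hrn⟩⟩ := hd2 _ ⟨V, _, _, inferInstance, ρ, hρ, rfl⟩ h2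
    apply TT_ne_top h8 hK hφ l hl
    refine T_eq_top (TT l) hlU hp hr hpq hrq ?_ ?_ h8
    · have h3 : p ∣ Nat.card (TT l) * (TT l).index := by
        rw [hcard, SL_card]; exact (hpq.mul_left _).mul_left _
      exact ((hp.dvd_mul).1 h3).resolve_right fun h => hpn (hdim ▸ h.mul_right _)
    · have h3 : r ∣ Nat.card (TT l) * (TT l).index := by
        rw [hcard, SL_card]; exact hrq.mul_right _
      exact ((hr.dvd_mul).1 h3).resolve_right fun h => hrn (hdim ▸ h.mul_right _)
  · have hp : IsPGroup 2 (UU F) := fun u => ⟨1, Subtype.ext (by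
      rw [pow_one, pow_two]; exact UU_sq u.2)⟩
    have : Fact (Nat.Prime 2) := ⟨Nat.prime_two⟩
    obtain ⟨c, hc⟩ := hp.nonempty_fixed_point_of_prime_not_dvd_card (SL F ⧸ TT l) (fun h => h2 (hdim ▸ Dvd.dvd.mul_right h _))
    obtain ⟨g, rfl⟩ := QuotientGroup.mk_surjective c
    obtain ⟨k, rfl⟩ := hφ g
    have hl' : k • l ≠ 1 := fun h => hl (by rw [smul_eq_iff_eq_inv_smul, smul_one] at h; exact h)
    obtain ⟨n, hn, hdn⟩ := odd_case h8 hK hφ (k • l) hl' (fun u hu => by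
      obtain ⟨x, rfl⟩ := hφ u
      have h3 : ((φ x * φ k : SL F) : SL F ⧸ TT l) = (φ k : SL F) := hc ⟨φ x, hu⟩
      rw [eq_comm, QuotientGroup.eq, ← map_inv, ← map_mul, ← map_mul, mem_TT] at h3
      rw [mem_TT, smul_smul, ← inv_smul_eq_iff, smul_smul]
      exact h3) hρ (by
      obtain ⟨v, hv, hv0⟩ := (Submodule.ne_bot_iff _).1 hE
      refine (Submodule.ne_bot_iff _).2 ⟨ρ k v, rho_Eig ρ k l v hv, fun h => hv0 ?_⟩
      have : ρ k⁻¹ (ρ k v) = v := by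
        rw [← Module.End.mul_apply, ← map_mul, inv_mul_cancel, map_one]; rfl
      rw [← this, h, map_zero]) h2
    exact hd1 n hn hdn
end h6
end ModH6

section ModI1

section aut
variable {F : Type} [Field F] [Finite F] [CharP F 2]

theorem mem_UU_of_sq {x : SL F} (hx : x ∈ BB F) (h : x * x = 1) : x ∈ UU F := by
  have := Fintype.ofFinite F
  obtain ⟨a, y, rfl⟩ := BB_decomp hx
  have h1 : (a : F) ^ 2 = 1 := by
    have := congrArg (fun g : SL F => g 0 0) h
    simp only [SL.mul00, SL.mul01, SL.mul10, SL.mul11, uu00, uu01, uu10, uu11, tt00, tt01, tt10, tt11, SL.one00] at this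
    linear_combination this
  have ha : a = 1 := by
    by_contra ha
    exact sq_ne_one ha h1
  rw [ha, tt_one, mul_one]; exact uu_mem y

theorem aut_U (α : SL F →* SL F) : ∃ g : SL F, ∀ x, g⁻¹ * α (uu x) * g ∈ UU F := by
  have : Fact (Nat.Prime 2) := ⟨Nat.prime_two⟩
  have hp : IsPGroup 2 ((UU F).map α) := by
    rintro ⟨_, u, hu, rfl⟩
    refine ⟨1, Subtype.ext ?_⟩
    rw [pow_one, pow_two]
    change α u * α u = 1
    rw [← map_mul, UU_sq hu, map_one]
  have he := even_q (F := F)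
  obtain ⟨c, hc⟩ := hp.nonempty_fixed_point_of_prime_not_dvd_card (SL F ⧸ BB F) (by
    change ¬ 2 ∣ (BB F).index
    rw [BB_index]; omega)
  obtain ⟨g, rfl⟩ := QuotientGroup.mk_surjective c
  refine ⟨g, fun x => mem_UU_of_sq ?_ ?_⟩
  · have h3 : ((α (uu x) * g : SL F) : SL F ⧸ BB F) = g := hc ⟨α (uu x), Subgroup.mem_map_of_mem α (uu_mem x)⟩
    rw [eq_comm, QuotientGroup.eq, ← mul_assoc] at h3
    exact h3
  · have : g⁻¹ * α (uu x) * g * (g⁻¹ * α (uu x) * g) = g⁻¹ * (α (uu x) * α (uu x)) * g := by group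
    rw [this, ← map_mul, UU_sq (uu_mem x), map_one]; group

theorem ll_eq (x : F) : ll x = nn 1 * uu x * (nn 1)⁻¹ := by
  rw [nn_uu, mul_inv_cancel_right]
  congr 1
  rw [Units.val_one, CharTwo.neg_eq]; ring

theorem aut1 (α : SL F →* SL F) (hα : Function.Injective α) :
    ∃ g : SL F, ∀ x, (∃ y, g⁻¹ * α (uu x) * g = uu y) ∧ (∃ y, g⁻¹ * α (ll x) * g = ll y) := by
  obtain ⟨g, hg⟩ := aut_U α
  choose A hA using hg
  have hAi : Function.Injective A := by
    intro x y h
    have h1 : g⁻¹ * α (uu x) * g = g⁻¹ * α (uu y) * g := by rw [← hA, ← hA, h]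
    exact uu_inj (hα (mul_left_cancel (mul_right_cancel h1)))
  have hAs := Finite.surjective_of_injective hAi
  have hn : g⁻¹ * α (nn 1) * g ∉ BB F := by
    intro h
    have h1 : g⁻¹ * α (ll 1) * g ∈ UU F := by
      have := BB_norm h (uu_mem (A 1))
      rw [hA, ] at this
      have e : g⁻¹ * α (nn 1) * g * (g⁻¹ * α (uu 1) * g) * (g⁻¹ * α (nn 1) * g)⁻¹ = g⁻¹ * (α (nn 1) * α (uu 1) * (α (nn 1))⁻¹) * g := by group
      rw [e, ← map_inv, ← map_mul, ← map_mul, ← ll_eq] at this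
      exact this
    obtain ⟨y, hy⟩ := h1
    obtain ⟨z, rfl⟩ := hAs y
    rw [hA] at hy
    have h2 := hα (mul_left_cancel (mul_right_cancel hy))
    have := congrArg (fun g : SL F => g 1 0) h2
    simp at this
  have hn' : (g⁻¹ * α (nn 1) * g) 1 0 ≠ 0 := hn
  have hbr := bruhat' (g := g⁻¹ * α (nn 1) * g) (Units.mk0 _ hn') (Units.val_mk0 hn').symm
  generalize hc : Units.mk0 _ hn' = c at hbr
  generalize (g⁻¹ * α (nn 1) * g) 0 0 / (c : F) = y at hbr
  generalize (g⁻¹ * α (nn 1) * g) 1 1 / (c : F) = z at hbr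
  refine ⟨g * uu y, fun x => ⟨⟨A x, ?_⟩, ⟨-(c : F) ^ 2 * A x, ?_⟩⟩⟩
  · have e : (g * uu y)⁻¹ * α (uu x) * (g * uu y) = (uu y)⁻¹ * (g⁻¹ * α (uu x) * g) * uu y := by group
    rw [e, ← hA, mul_assoc, UU_comm (uu_mem (A x)) (uu_mem y), inv_mul_cancel_left]
  · have e : (g * uu y)⁻¹ * α (ll x) * (g * uu y) = (uu y)⁻¹ * (g⁻¹ * α (nn 1) * g * (g⁻¹ * α (uu x) * g) * (g⁻¹ * α (nn 1) * g)⁻¹) * uu y := by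
      rw [ll_eq, map_mul, map_mul, map_inv]; group
    rw [e, hbr, ← hA]
    have e2 : (uu y)⁻¹ * (uu y * nn c * uu z * uu (A x) * (uu y * nn c * uu z)⁻¹) * uu y = nn c * (uu z * uu (A x) * (uu z)⁻¹) * (nn c)⁻¹ := by group
    rw [e2, UU_comm (uu_mem z) (uu_mem (A x)), mul_inv_cancel_right, nn_uu, mul_inv_cancel_right]

theorem conj_l_entry (g : SL F) (x : F) : (g⁻¹ * ll x * g) 0 1 = x * (g 0 1) ^ 2 := by
  have h2 := SL.det' g
  simp only [SL.mul00, SL.mul01, SL.mul10, SL.mul11, SL.inv00, SL.inv01, SL.inv10, SL.inv11, ll00, ll01, ll10, ll11]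
  have h3 : (2 : F) = 0 := CharTwo.two_eq_zero
  linear_combination (- x * (g 0 1)^2) * h3

theorem aut2 (α : SL F →* SL F) (A D : F → F) (hA : ∀ x, α (uu x) = uu (A x)) (hD : ∀ x, α (ll x) = ll (D x)) (hA1 : A 1 = 1)
    (hα : Function.Injective α) :
    ∃ τ : F ≃+* F, ∀ x, α x = Matrix.SpecialLinearGroup.map (τ : F →+* F) x := by
  have := Fintype.ofFinite F
  have hAadd : ∀ x y, A (x + y) = A x + A y := fun x y => uu_inj (by rw [← hA, uu_add, map_mul, hA, hA, uu_add])
  have hDadd : ∀ x y, D (x + y) = D x + D y := fun x y => ll_inj (by rw [← hD, ll_add, map_mul, hD, hD, ll_add])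
  have hAi : Function.Injective A := fun x y h => uu_inj (hα (by rw [hA, hA, h]))
  have hDi : Function.Injective D := fun x y h => ll_inj (hα (by rw [hD, hD, h]))
  have hA0 : A 0 = 0 := uu_inj (by rw [← hA, uu_zero, map_one])
  have hD0 : D 0 = 0 := ll_inj (by rw [← hD, ll_zero, map_one])
  have htt : ∀ a, ∃ b : Fˣ, α (tt a) = tt b := by
    intro a
    have h1 : tt a * uu 1 * (tt a)⁻¹ = uu ((a : F) ^ 2) := by rw [tt_uu, mul_inv_cancel_right, mul_one]
    have h2 : tt a * ll ((a : F) ^ 2) * (tt a)⁻¹ = ll 1 := by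
      have := tt_ll a 1
      rw [mul_one] at this
      rw [this, mul_inv_cancel_right]
    have h3 := congrArg α h1
    have h4 := congrArg α h2
    rw [map_mul, map_mul, map_inv, hA, hA] at h3
    rw [map_mul, map_mul, map_inv, hD, hD] at h4
    have h10 : (α (tt a)) 1 0 = 0 := by
      have h5 := conj_u_entry (α (tt a))⁻¹ (A 1)
      rw [inv_inv, h3, uu10, SL.inv10, hA1] at h5
      simpa using h5.symm
    have h01 : (α (tt a)) 0 1 = 0 := by
      have h5 := conj_l_entry (α (tt a))⁻¹ (D ((a : F) ^ 2))
      rw [inv_inv, h4, ll01, SL.inv01] at h5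
      have h6 : D ((a : F) ^ 2) ≠ 0 := fun h => pow_ne_zero 2 a.ne_zero (hDi (h.trans hD0.symm))
      simpa [h6] using h5.symm
    have hdet := SL.det' (α (tt a))
    rw [h10, mul_zero, sub_zero] at hdet
    refine ⟨⟨(α (tt a)) 0 0, (α (tt a)) 1 1, hdet, by rw [mul_comm]; exact hdet⟩, ?_⟩
    apply SL.ext'
    · rfl
    · exact h01
    · exact h10
    · rfl
  choose μ hμ using htt
  have hAm : ∀ (a : Fˣ) x, A ((a : F) ^ 2 * x) = (μ a : F) ^ 2 * A x := by
    intro a x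
    have h1 := congrArg α (tt_uu a x)
    rw [map_mul, map_mul, hμ, hA, hA, tt_uu] at h1
    exact (uu_inj (mul_right_cancel h1)).symm
  have hDm : ∀ (a : Fˣ) x, (μ a : F) ^ 2 * D x = D ((a : F) ^ 2 * x) := by
    intro a x
    have h1 := congrArg α (tt_ll a x)
    rw [map_mul, map_mul, hμ, hD, hD] at h1
    have h2 := tt_ll (μ a) (((μ a : F) ^ 2)⁻¹ * D ((a : F) ^ 2 * x))
    rw [mul_inv_cancel_left₀ (pow_ne_zero 2 (μ a).ne_zero), h1] at h2
    rw [ll_inj (mul_right_cancel h2), mul_inv_cancel_left₀ (pow_ne_zero 2 (μ a).ne_zero)]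
  have hmu : ∀ a : Fˣ, (μ a : F) ^ 2 = A ((a : F) ^ 2) := fun a => by
    have := hAm a 1
    rw [mul_one, hA1, mul_one] at this
    exact this.symm
  have hsq : ∀ y : F, y ≠ 0 → ∃ a : Fˣ, y = (a : F) ^ 2 := fun y hy => by
    obtain ⟨r, hr⟩ := sq_surj y
    exact ⟨Units.mk0 r (by rintro rfl; simp at hr; exact hy hr.symm), hr.symm⟩
  have hAmul : ∀ x y, A (x * y) = A x * A y := by
    intro x y
    rcases eq_or_ne x 0 with rfl | hx
    · rw [zero_mul, hA0, zero_mul]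
    · obtain ⟨a, rfl⟩ := hsq x hx
      rw [hAm, hmu]
  have hDA : ∀ x, D x = A x * D 1 := by
    intro x
    rcases eq_or_ne x 0 with rfl | hx
    · rw [hA0, hD0, zero_mul]
    · obtain ⟨a, rfl⟩ := hsq x hx
      rw [← hmu, hDm, mul_one]
  have hD1 : D 1 = 1 := by
    have h3 : (2 : F) = 0 := CharTwo.two_eq_zero
    have h1 : (uu (1 : F) * ll 1) ^ 3 = 1 := by
      apply SL.ext' <;> simp only [pow_succ, pow_zero, one_mul, SL.mul00, SL.mul01, SL.mul10, SL.mul11, uu00, uu01, uu10, uu11, ll00, ll01, ll10, ll11, SL.one00, SL.one01, SL.one10, SL.one11]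
      · linear_combination 6 * h3
      · linear_combination 4 * h3
      · linear_combination 4 * h3
      · linear_combination 2 * h3
    have h2 := congrArg α h1
    rw [map_pow, map_mul, hA, hD, hA1, map_one] at h2
    have h4 := congrArg (fun g : SL F => g 0 1) h2
    simp only [pow_succ, pow_zero, one_mul, SL.mul00, SL.mul01, SL.mul10, SL.mul11, uu00, uu01, uu10, uu11, ll00, ll01, ll10, ll11, SL.one00, SL.one01, SL.one10, SL.one11] at h4
    have h5 : (D 1 - 1) ^ 2 = 0 := by
      linear_combination h4 - (3 * D 1 + 1) * h3
    exact sub_eq_zero.1 (pow_eq_zero_iff two_ne_zero |>.1 h5)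
  let τ : F ≃+* F := RingEquiv.ofBijective ({ toFun := A, map_one' := hA1, map_mul' := hAmul, map_zero' := hA0, map_add' := hAadd } : F →+* F)
    ⟨hAi, Finite.surjective_of_injective hAi⟩
  refine ⟨τ, fun x => ?_⟩
  have htop : MonoidHom.eqLocus α (Matrix.SpecialLinearGroup.map (τ : F →+* F)) = ⊤ := by
    refine gen_UL (fun x => ?_) (fun x => ?_)
    · change α (uu x) = Matrix.SpecialLinearGroup.map (τ : F →+* F) (uu x)
      rw [hA]
      apply SL.ext'
      · exact (map_one τ).symm
      · rfl
      · exact (map_zero τ).symm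
      · exact (map_one τ).symm
    · change α (ll x) = Matrix.SpecialLinearGroup.map (τ : F →+* F) (ll x)
      rw [hD, hDA, hD1, mul_one]
      apply SL.ext'
      · exact (map_one τ).symm
      · exact (map_zero τ).symm
      · rfl
      · exact (map_one τ).symm
  exact (htop ▸ Subgroup.mem_top x : x ∈ MonoidHom.eqLocus α (Matrix.SpecialLinearGroup.map (τ : F →+* F)))

theorem aut_SL (α : SL F →* SL F) (hα : Function.Injective α) :
    ∃ (τ : F ≃+* F) (s : SL F), ∀ x, α x = s * Matrix.SpecialLinearGroup.map (τ : F →+* F) x * s⁻¹ := by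
  have := Fintype.ofFinite F
  obtain ⟨g, hg⟩ := aut1 α hα
  choose A hA using fun x => (hg x).1
  choose D hD using fun x => (hg x).2
  have hA1 : A 1 ≠ 0 := by
    intro h
    have h1 := hA 1
    rw [h, uu_zero] at h1
    have h2 : α (uu 1) = 1 := by
      have e : g⁻¹ * α (uu 1) * g = g⁻¹ * 1 * g := by rw [h1]; group
      exact mul_left_cancel (mul_right_cancel e)
    exact one_ne_zero (uu_inj (hα (h2.trans (by rw [uu_zero, map_one]))))
  obtain ⟨d, hd⟩ := sq_surj (A 1)⁻¹
  have hd0 : d ≠ 0 := by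
    rintro rfl
    simp at hd
    exact hA1 hd.symm
  let t := tt (Units.mk0 d hd0)
  let β : SL F →* SL F := (MulAut.conj (t * g⁻¹)).toMonoidHom.comp α
  have hβ : ∀ x, β x = t * (g⁻¹ * α x * g) * t⁻¹ := fun x => by
    change t * g⁻¹ * α x * (t * g⁻¹)⁻¹ = _
    group
  obtain ⟨τ, hτ⟩ := aut2 β (fun x => d ^ 2 * A x) (fun x => (d ^ 2)⁻¹ * D x) (fun x => by
      rw [hβ, hA, tt_uu, mul_inv_cancel_right]; rfl) (fun x => by
      have h2 := tt_ll (Units.mk0 d hd0) ((d ^ 2)⁻¹ * D x)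
      rw [Units.val_mk0, mul_inv_cancel_left₀ (pow_ne_zero 2 hd0)] at h2
      rw [hβ, hD, h2, mul_inv_cancel_right]) (by
      change d ^ 2 * A 1 = 1
      rw [hd, inv_mul_cancel₀ hA1]) ((MulAut.conj (t * g⁻¹)).injective.comp hα)
  refine ⟨τ, (t * g⁻¹)⁻¹, fun x => ?_⟩
  rw [← hτ, hβ]; group

end aut
end ModI1

section ModJ1

theorem nt_sub {x n : ℕ} (hx : Even x) (hx2 : 2 ≤ x) (hn : 2 ≤ n) :
    ∃ l, l.Prime ∧ l ∣ x ^ n - 1 ∧ ¬ l ∣ x - 1 := by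
  by_contra hc
  push Not at hc
  have hpow : 1 < x ^ n := Nat.one_lt_pow (by omega) (by omega)
  have h1 : x ^ n - 1 ∣ (x - 1) * n := by
    rw [← Nat.factorization_le_iff_dvd (by omega) (by apply Nat.mul_ne_zero <;> omega)]
    intro l
    by_cases hl : l.Prime ∧ l ∣ x ^ n - 1
    · obtain ⟨hl, hd⟩ := hl
      have := Fact.mk hl
      have hd' := hc l hl hd
      have hlx : ¬ l ∣ x := fun h => hl.one_lt.ne' (Nat.dvd_one.1 ((Nat.dvd_sub_iff_right (by omega) h).1 hd'))
      have hlo : Odd l := by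
        rcases hl.eq_two_or_odd' with rfl | h
        · exact absurd hx.two_dvd hlx
        · exact h
      have := padicValNat.pow_sub_pow hlo (y := 1) (by omega) hd' hlx (n := n) (by omega)
      rw [one_pow] at this
      rw [Nat.factorization_mul (by omega) (by omega), Finsupp.add_apply, Nat.factorization_def _ hl, Nat.factorization_def _ hl, Nat.factorization_def _ hl, this]
    · rw [Nat.factorization_eq_zero_iff _ _ |>.2 (by tauto)]; exact Nat.zero_le _
  have h2 := Nat.le_of_dvd (by apply Nat.mul_pos <;> omega) h1
  obtain ⟨y, rfl⟩ : ∃ y, x = y + 1 := ⟨x - 1, by omega⟩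
  rw [Nat.add_sub_cancel] at h2
  have h3 : 1 + n * y + y * y ≤ (y + 1) ^ n := by
    clear h2 h1 hpow hc
    induction n, hn using Nat.le_induction with
    | base => nlinarith
    | succ n hn ih => rw [pow_succ]; nlinarith
  have : y * n = n * y := mul_comm _ _
  have : 0 < y * y := Nat.mul_pos (by omega) (by omega)
  omega

theorem nt_add {x n : ℕ} (hx : Even x) (hn : Odd n) (hs : (x + 1) * n < x ^ n + 1) :
    ∃ l, l.Prime ∧ l ∣ x ^ n + 1 ∧ ¬ l ∣ x + 1 := by
  by_contra hc
  push Not at hc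
  have hn0 : n ≠ 0 := by rintro rfl; simp at hn
  have h1 : x ^ n + 1 ∣ (x + 1) * n := by
    rw [← Nat.factorization_le_iff_dvd (by omega) (by apply Nat.mul_ne_zero <;> omega)]
    intro l
    by_cases hl : l.Prime ∧ l ∣ x ^ n + 1
    · obtain ⟨hl, hd⟩ := hl
      have := Fact.mk hl
      have hd' := hc l hl hd
      have hlx : ¬ l ∣ x := fun h => hl.one_lt.ne' (Nat.dvd_one.1 ((Nat.dvd_add_right h).1 hd'))
      have hlo : Odd l := by
        rcases hl.eq_two_or_odd' with rfl | h
        · exact absurd hx.two_dvd hlx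
        · exact h
      have := padicValNat.pow_add_pow hlo (y := 1) hd' hlx (n := n) hn
      rw [one_pow] at this
      rw [Nat.factorization_mul (by omega) (by omega), Finsupp.add_apply, Nat.factorization_def _ hl, Nat.factorization_def _ hl, Nat.factorization_def _ hl, this]
    · rw [Nat.factorization_eq_zero_iff _ _ |>.2 (by tauto)]; exact Nat.zero_le _
  have h2 := Nat.le_of_dvd (by apply Nat.mul_pos <;> omega) h1
  omega

theorem three_primes {N a b c : ℕ} (hN : N.primeFactors.card = 2) (ha : a.Prime) (hb : b.Prime) (hc : c.Prime)
    (da : a ∣ N) (db : b ∣ N) (dc : c ∣ N) (hab : a ≠ b) : c = a ∨ c = b := by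
  by_contra h
  push Not at h
  have hN0 : N ≠ 0 := by rintro rfl; simp at hN
  have hs : ({a, b, c} : Finset ℕ) ⊆ N.primeFactors := by
    intro x hx
    simp only [Finset.mem_insert, Finset.mem_singleton] at hx
    rcases hx with rfl | rfl | rfl <;> simp_all
  have := Finset.card_le_card hs
  rw [Finset.card_eq_three.2 ⟨a, b, c, hab, h.1.symm, h.2.symm, rfl⟩] at this
  omega

theorem even_two_pow {n : ℕ} (h : n ≠ 0) : Even (2 ^ n) := (even_two).pow_of_ne_zero h
theorem two_le_pow {n : ℕ} (h : n ≠ 0) : 2 ≤ 2 ^ n := by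
  calc 2 = 2 ^ 1 := rfl
    _ ≤ 2 ^ n := Nat.pow_le_pow_right (by norm_num) (by omega)

theorem pow_sub_dvd (x a b : ℕ) : x ^ a - 1 ∣ x ^ (a * b) - 1 := by
  rw [pow_mul]; simpa using Nat.sub_dvd_pow_sub_pow (x ^ a) 1 b

theorem nt_three {a b c : ℕ} (ha : 2 ≤ a) (hb : 2 ≤ b) (hc : 2 ≤ c) : (2 ^ (a * b * c) - 1).primeFactors.card ≠ 2 := by
  intro h
  obtain ⟨l1, p1, d1, n1⟩ := nt_sub (x := 2) even_two le_rfl ha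
  obtain ⟨l2, p2, d2, n2⟩ := nt_sub (x := 2 ^ a) (even_two_pow (by omega)) (two_le_pow (by omega)) hb
  have hab : a * b ≠ 0 := Nat.mul_ne_zero (by omega) (by omega)
  obtain ⟨l3, p3, d3, n3⟩ := nt_sub (x := 2 ^ (a * b)) (even_two_pow hab) (two_le_pow hab) hc
  rw [← pow_mul] at d2 d3
  have e1 := d1.trans (pow_sub_dvd 2 a b)
  have := three_primes h p1 p2 p3 (e1.trans (pow_sub_dvd 2 _ c)) (d2.trans (pow_sub_dvd 2 _ c)) d3 (by rintro rfl; exact n2 d1)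
  rcases this with rfl | rfl
  · exact n3 e1
  · exact n3 d2

theorem nt_ab {a b : ℕ} (ha : a.Prime) (hb : b.Prime) (hab : a < b) (h6 : a * b ≠ 6) : (2 ^ (a * b) - 1).primeFactors.card ≠ 2 := by
  intro h
  have a2 := ha.two_le
  have b2 := hb.two_le
  have eb := pow_sub_dvd 2 b a
  rw [mul_comm b a] at eb
  have ea := pow_sub_dvd 2 a b
  obtain ⟨P, pP, dP, -⟩ := nt_sub (x := 2) even_two le_rfl a2
  obtain ⟨Q, pQ, dQ, -⟩ := nt_sub (x := 2) even_two le_rfl b2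
  have hPQ : P ≠ Q := by
    rintro rfl
    have := Nat.dvd_gcd dP dQ
    rw [Nat.pow_sub_one_gcd_pow_sub_one, (Nat.coprime_primes ha hb).2 hab.ne] at this
    exact pP.one_lt.ne' (Nat.dvd_one.1 this)
  have hall : ∀ l, l.Prime → l ∣ 2 ^ (a * b) - 1 → l ∣ 2 ^ a - 1 ∨ l ∣ 2 ^ b - 1 := by
    intro l hl hd
    rcases three_primes h pP pQ hl (dP.trans ea) (dQ.trans eb) hd hPQ with rfl | rfl
    · exact Or.inl dP
    · exact Or.inr dQ
  have key : ∀ {l c d : ℕ}, l.Prime → 2 ≤ c → 2 ≤ d → l ∣ 2 ^ c - 1 → padicValNat l (2 ^ (c * d) - 1) = padicValNat l (2 ^ c - 1) + padicValNat l d := by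
    intro l c d hl hc hd h
    have := Fact.mk hl
    have h2c := two_le_pow (n := c) (by omega)
    have hlx : ¬ l ∣ 2 ^ c := fun h' => hl.one_lt.ne' (Nat.dvd_one.1 ((Nat.dvd_sub_iff_right (by omega) h').1 h))
    have hlo : Odd l := by
      rcases hl.eq_two_or_odd' with rfl | h
      · exact absurd (even_two_pow (by omega)).two_dvd hlx
      · exact h
    have := padicValNat.pow_sub_pow hlo (y := 1) (by omega) h hlx (n := d) (by omega)
    rwa [one_pow, ← pow_mul] at this
  have hab0 : a * b ≠ 0 := Nat.mul_ne_zero (by omega) (by omega)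
  have ga := two_le_pow (n := a) (by omega)
  have gb := two_le_pow (n := b) (by omega)
  have gab := two_le_pow hab0
  have hne : (2 ^ a - 1) * (2 ^ b - 1) ≠ 0 := Nat.mul_ne_zero (by omega) (by omega)
  have h1 : 2 ^ (a * b) - 1 ∣ (2 ^ a - 1) * (2 ^ b - 1) * (a * b) := by
    rw [← Nat.factorization_le_iff_dvd (by omega) (Nat.mul_ne_zero hne hab0)]
    intro l
    by_cases hl : l.Prime ∧ l ∣ 2 ^ (a * b) - 1
    · obtain ⟨hl, hd⟩ := hl
      rw [Nat.factorization_mul hne hab0, Nat.factorization_mul (by omega) (by omega), Nat.factorization_mul (by omega) (by omega)]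
      simp only [Finsupp.add_apply, Nat.factorization_def _ hl]
      rcases hall l hl hd with h | h
      · rw [key hl a2 b2 h]; omega
      · rw [mul_comm a b, key hl b2 a2 h]; omega
    · rw [Nat.factorization_eq_zero_iff _ _ |>.2 (by tauto)]; exact Nat.zero_le _
  have h2 := Nat.le_of_dvd (Nat.pos_of_ne_zero (Nat.mul_ne_zero hne hab0)) h1
  rcases a2.eq_or_lt with rfl | a3
  · have b5 : 5 ≤ b := by
      by_contra hb5
      have : b = 3 ∨ b = 4 := by omega
      rcases this with rfl | rfl
      · exact h6 rfl
      · revert hb; norm_num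
    have h3 : 6 * b < 2 ^ b + 1 := by
      clear * - b5
      induction b, b5 using Nat.le_induction with
      | base => norm_num
      | succ n hn ih => rw [pow_succ]; omega
    rw [mul_comm 2 b, pow_mul] at h2
    obtain ⟨y, hy⟩ : ∃ y, 2 ^ b = y + 1 := ⟨2 ^ b - 1, by omega⟩
    rw [hy] at h2 h3
    have e : (y + 1) ^ 2 - 1 = y * (y + 2) := by
      have : (y + 1) ^ 2 = y * (y + 2) + 1 := by ring
      omega
    rw [e, Nat.add_sub_cancel] at h2
    have y0 : 0 < y := by omega
    have e2 : (2 ^ 2 - 1) * y * (b * 2) = y * (6 * b) := by norm_num; ring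
    rw [e2] at h2
    have := Nat.le_of_mul_le_mul_left h2 y0
    omega
  · have la : ∀ n, 1 ≤ n → n ≤ 2 ^ (n - 1) := fun n hn => by
      have := Nat.lt_two_pow_self (n := n - 1); omega
    have h3 : a * b ≤ 2 ^ (a - 1 + (b - 1)) := by
      rw [pow_add]; exact Nat.mul_le_mul (la a (by omega)) (la b (by omega))
    have h4 : (2 ^ a - 1) * (2 ^ b - 1) * (a * b) < 2 ^ (a + b + (a - 1 + (b - 1))) - 1 := by
      rw [pow_add 2 (a + b), pow_add 2 a b]
      obtain ⟨y, hy⟩ : ∃ y, 2 ^ a = y + 1 := ⟨2 ^ a - 1, by omega⟩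
      obtain ⟨z, hz⟩ : ∃ y, 2 ^ b = y + 1 := ⟨2 ^ b - 1, by omega⟩
      rw [hy, hz]
      simp only [Nat.add_sub_cancel]
      have h5 : y * z * (a * b) ≤ y * z * 2 ^ (a - 1 + (b - 1)) := Nat.mul_le_mul le_rfl h3
      have h6 : 1 ≤ 2 ^ (a - 1 + (b - 1)) := Nat.one_le_two_pow
      have : y * z * 2 ^ (a - 1 + (b - 1)) + 1 < (y + 1) * (z + 1) * 2 ^ (a - 1 + (b - 1)) := by
        have : 0 < y := by omega
        have : 0 < z := by omega
        nlinarith [Nat.zero_le (y * z)]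
      omega
    have h5 : a + b + (a - 1 + (b - 1)) ≤ a * b := by
      obtain ⟨c, rfl⟩ : ∃ c, a = c + 3 := ⟨a - 3, by omega⟩
      obtain ⟨d, rfl⟩ : ∃ d, b = d + 4 := ⟨b - 4, by omega⟩
      have e : (c + 3) * (d + 4) = c * d + 4 * c + 3 * d + 12 := by ring
      rw [e]
      have := Nat.zero_le (c * d)
      omega
    have := Nat.pow_le_pow_right (n := 2) (by norm_num) h5
    omega

theorem nt_sq {p : ℕ} (hp : p.Prime) (h5 : 5 ≤ p) : (2 ^ (p * p) + 1).primeFactors.card ≠ 2 := by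
  intro h
  have ho : Odd p := hp.odd_of_ne_two (by omega)
  have hs1 : (2 + 1) * p < 2 ^ p + 1 := by
    clear * - h5
    induction p, h5 using Nat.le_induction with
    | base => norm_num
    | succ n hn ih => rw [pow_succ]; omega
  obtain ⟨l1, p1, d1, n1⟩ := nt_add even_two ho hs1
  have hs2 : (2 ^ p + 1) * p < (2 ^ p) ^ p + 1 := by
    obtain ⟨k, hk⟩ : ∃ k, p = k + 2 := ⟨p - 2, by omega⟩
    have h1 : p < 2 ^ p := Nat.lt_two_pow_self
    have h2 : (2 ^ p) ^ 3 ≤ (2 ^ p) ^ p := Nat.pow_le_pow_right (by omega) (by omega)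
    generalize 2 ^ p = y at *
    have h3 : (y + 1) * p ≤ (y + 1) * y := Nat.mul_le_mul le_rfl h1.le
    have h4 : (y + 1) * y ≤ y ^ 3 := by
      have : y + 1 ≤ y * y := by nlinarith
      calc (y + 1) * y ≤ y * y * y := Nat.mul_le_mul this le_rfl
        _ = y ^ 3 := by ring
    omega
  obtain ⟨l2, p2, d2, n2⟩ := nt_add (even_two_pow (by omega)) ho hs2
  have e1 : 2 ^ p + 1 ∣ 2 ^ (p * p) + 1 := by
    rw [pow_mul]; simpa using Odd.nat_add_dvd_pow_add_pow (2 ^ p) 1 ho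
  have e0 : 3 ∣ 2 ^ p + 1 := by simpa using Odd.nat_add_dvd_pow_add_pow 2 1 ho
  rw [← pow_mul] at d2
  rcases three_primes h Nat.prime_three p1 p2 (e0.trans e1) (d1.trans e1) d2 (by rintro rfl; exact n1 (by norm_num)) with rfl | rfl
  · exact n2 e0
  · exact n2 d1

theorem nt_main {f : ℕ} (hf : 2 ≤ f) (hm : (2 ^ f - 1).primeFactors.card = 2) (hp : (2 ^ f + 1).primeFactors.card = 2) :
    f = 6 ∨ f = 9 ∨ f.Prime := by
  by_contra hc
  push Not at hc
  obtain ⟨h6, h9, hnp⟩ := hc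
  have ha := Nat.minFac_prime (n := f) (by omega)
  obtain ⟨m, hm'⟩ := Nat.minFac_dvd f
  have hm2 : 2 ≤ m := by
    by_contra h
    have : m = 0 ∨ m = 1 := by omega
    rcases this with rfl | rfl
    · omega
    · rw [mul_one] at hm'; rw [hm'] at hnp; exact hnp ha
  generalize f.minFac = a at *
  by_cases hmp : m.Prime
  · rcases lt_trichotomy a m with h | h | h
    · subst hm'; exact nt_ab ha hmp h h6 hm
    · subst h
      subst hm'
      by_cases h5 : 5 ≤ a
      · exact nt_sq ha h5 hp
      · have := ha.two_le
        interval_cases a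
        · rw [show 2 ^ (2 * 2) + 1 = 17 by norm_num, Nat.Prime.primeFactors (by norm_num)] at hp
          simp at hp
        · exact h9 rfl
        · revert ha; norm_num
    · rw [mul_comm] at hm'; subst hm'; exact nt_ab hmp ha h h6 hm
  · have hb := Nat.minFac_prime (n := m) (by omega)
    obtain ⟨c, hc⟩ := Nat.minFac_dvd m
    have hc2 : 2 ≤ c := by
      by_contra h
      have : c = 0 ∨ c = 1 := by omega
      rcases this with rfl | rfl
      · omega
      · rw [mul_one] at hc; rw [hc] at hmp; exact hmp hb
    rw [hm', hc, ← mul_assoc] at hm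
    exact nt_three ha.two_le hb.two_le hc2 hm

theorem nt_three_le {f : ℕ} (hf : 2 ≤ f) (hm : (2 ^ f - 1).primeFactors.card = 2) : 3 ≤ f := by
  by_contra h
  obtain rfl : f = 2 := by omega
  rw [show 2 ^ 2 - 1 = 3 by norm_num, Nat.Prime.primeFactors (by norm_num)] at hm
  simp at hm

/-- at most one prime divisor of `f` lies outside the primes of `q (q^2-1)` -/
theorem nt_pi {f : ℕ} (h : f = 6 ∨ f = 9 ∨ f.Prime) : ∃ s, ∀ p, p.Prime → p ∣ f → p = s ∨ p = 2 ∨ p ∣ 2 ^ f - 1 ∨ p ∣ 2 ^ f + 1 := by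
  rcases h with rfl | rfl | h
  · refine ⟨2, fun p hp hd => ?_⟩
    have : p ∣ 2 * 3 := hd
    rcases hp.dvd_mul.1 this with h | h
    · exact Or.inl ((Nat.prime_dvd_prime_iff_eq hp Nat.prime_two).1 h)
    · exact Or.inr (Or.inr (Or.inl (h.trans (by norm_num))))
  · refine ⟨2, fun p hp hd => ?_⟩
    have : p ∣ 3 * 3 := hd
    rcases hp.dvd_mul.1 this with h | h <;>
    exact Or.inr (Or.inr (Or.inr (h.trans (by norm_num))))
  · exact ⟨f, fun p hp hd => Or.inl ((Nat.prime_dvd_prime_iff_eq hp h).1 hd)⟩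
end ModJ1

section ModK1

theorem comp_irr {G H V : Type*} [Group G] [Group H] [AddCommGroup V] [Module ℂ V] {ρ : Representation ℂ H V} (hρ : Irr ρ)
    (φ : G →* H) (hφ : Function.Surjective φ) : Irr (ρ.comp φ : Representation ℂ G V) := by
  have := hρ.nontrivial
  refine Irr.of_forall fun q hq => ?_
  by_cases h : q = ⊥
  · exact Or.inl h
  · refine Or.inr (hρ.eq ?_ h)
    intro g v hv
    obtain ⟨g, rfl⟩ := hφ g
    exact hq g v hv

theorem Deg.surj {G H : Type} [Group G] [Group H] {n : ℕ} (h : Deg H n) (φ : G →* H) (hφ : Function.Surjective φ) : Deg G n := by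
  obtain ⟨V, _, _, _, ρ, hρ, hn⟩ := h
  exact ⟨V, _, _, inferInstance, _, comp_irr hρ φ hφ, hn⟩

theorem over_data {G : Type} [Group G] [Finite G] (N : Subgroup G) {A : Type} [AddCommGroup A] [Module ℂ A]
    [FiniteDimensional ℂ A] {σ : Representation ℂ N A} (hσ : Irr σ) :
    ∃ (V : Type) (_ : AddCommGroup V) (_ : Module ℂ V) (_ : FiniteDimensional ℂ V)
      (ρ : Representation ℂ G V) (B : Submodule ℂ V) (e : A ≃ₗ[ℂ] B), Irr ρ ∧ Simp (res ρ N) B ∧ ∀ (n : N) a, (e (σ n a) : V) = ρ n (e a) := by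
  obtain ⟨V, _, _, _, ρ, f, hρ, hf, hfe⟩ := exists_over N hσ
  refine ⟨V, _, _, inferInstance, ρ, LinearMap.range f, LinearEquiv.ofInjective f hf, hρ, ⟨?_, ?_, ?_⟩, hfe⟩
  · have := hσ.nontrivial
    rw [Ne, LinearMap.range_eq_bot]
    rintro rfl
    obtain ⟨x, y, hxy⟩ := exists_pair_ne A
    exact hxy (hf rfl)
  · exact RInv.range (σ := res ρ N) f hfe
  · intro q hq hqi
    have h1 : RInv σ (q.comap f) := by
      intro n a ha
      rw [Submodule.mem_comap, hfe]
      exact hqi n _ ha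
    have h2 : (q.comap f).map f = q := by rw [Submodule.map_comap_eq, inf_eq_right.2 hq]
    rcases hσ.2.2 _ le_top h1 with h | h
    · left; rw [← h2, h, Submodule.map_bot]
    · right; rw [← h2, h, LinearMap.range_eq_map]

theorem Deg.over {G : Type} [Group G] [Finite G] {N : Subgroup G} [N.Normal] {n : ℕ} (h : Deg N n) : ∃ m, Deg G m ∧ n ∣ m := by
  obtain ⟨A, _, _, _, σ, hσ, rfl⟩ := h
  obtain ⟨V, _, _, _, ρ, B, e, hρ, hB, -⟩ := over_data N hσ
  exact ⟨_, ⟨V, _, _, inferInstance, ρ, hρ, rfl⟩, by rw [e.finrank_eq]; exact clifford_dvd hρ hB⟩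

/-- if `g` stabilises the constituent then characters agree on conjugates -/
theorem stab_trace {G V A : Type} [Group G] [AddCommGroup V] [Module ℂ V] [FiniteDimensional ℂ V] [AddCommGroup A] [Module ℂ A]
    [FiniteDimensional ℂ A] {N : Subgroup G} [N.Normal] {σ : Representation ℂ N A} {ρ : Representation ℂ G V} {B : Submodule ℂ V}
    (e : A ≃ₗ[ℂ] B) (he : ∀ (n : N) a, (e (σ n a) : V) = ρ n (e a)) (g : G) (h : SIso (res ρ N) B (B.map (ρ g))) (n n' : N)
    (hn : (n : G) * g = g * n') : LinearMap.trace ℂ A (σ n) = LinearMap.trace ℂ A (σ n') := by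
  obtain ⟨E, hE⟩ := h
  let T : A ≃ₗ[ℂ] B.map (ρ g) := e ≪≫ₗ E
  let T' : A →ₗ[ℂ] B.map (ρ g) := ((ρ g).comp B.subtype).codRestrict (B.map (ρ g)) (fun b => ⟨b, b.2, rfl⟩) ∘ₗ e.toLinearMap
  have hT'b : Function.Bijective T' := by
    constructor
    · intro a b hab
      have h1 : ρ g (e a) = ρ g (e b) := congrArg Subtype.val hab
      have h2 := congrArg (ρ g⁻¹) h1
      rw [← Module.End.mul_apply, ← Module.End.mul_apply, ← map_mul, inv_mul_cancel, map_one] at h2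
      exact e.injective (Subtype.ext h2)
    · rintro ⟨_, b, hb, rfl⟩
      exact ⟨e.symm ⟨b, hb⟩, Subtype.ext (by
        change ρ g (e (e.symm ⟨b, hb⟩) : B) = ρ g b
        rw [LinearEquiv.apply_symm_apply])⟩
  let T2 := LinearEquiv.ofBijective T' hT'b
  have h1 : ∀ a, (T (σ n a) : V) = ρ n (T a) := fun a => hE n (e a) (e (σ n a)) (he n a)
  have h2 : ∀ a, (T2 (σ n' a) : V) = ρ n (T2 a) := fun a => by
    change ρ g (e (σ n' a)) = ρ n (ρ g (e a))
    rw [he, ← Module.End.mul_apply, ← Module.End.mul_apply, ← map_mul, ← map_mul, hn]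
  have h3 : (T ≪≫ₗ T2.symm).conj (σ n) = σ n' := by
    ext a
    rw [LinearEquiv.conj_apply_apply]
    simp only [LinearEquiv.trans_apply, LinearEquiv.symm_trans_apply, LinearEquiv.symm_symm]
    rw [LinearEquiv.symm_apply_eq]
    apply Subtype.ext
    rw [h1, h2, LinearEquiv.apply_symm_apply]
  rw [← h3, LinearMap.trace_conj']

theorem Deg.prod {K R : Type} [Group K] [Group R] [Finite K] [Finite R] {m n : ℕ} (h : Deg K m) (h' : Deg R n) : Deg (K × R) (m * n) := by
  obtain ⟨V, _, _, _, ρ, hρ, rfl⟩ := h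
  obtain ⟨W, _, _, _, σ, hσ, rfl⟩ := h'
  exact ⟨_, _, _, inferInstance, _, tens_irr hρ hσ, Module.finrank_tensorProduct⟩

theorem Deg.of_prod {K R : Type} [Group K] [Group R] [Finite K] [Finite R] {n : ℕ} (h : Deg (K × R) n) : ∃ a b, Deg K a ∧ Deg R b ∧ n = a * b := by
  obtain ⟨A, _, _, _, σ, hσ, rfl⟩ := h
  obtain ⟨B, _, _, _, C, _, _, _, β, γ, hβ, hγ, hd, -⟩ := prod_decomp hσ
  exact ⟨_, _, ⟨B, _, _, inferInstance, β, hβ, rfl⟩, ⟨C, _, _, inferInstance, γ, hγ, rfl⟩, hd⟩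

theorem Deg.one (G : Type) [Group G] : Deg G 1 := by
  refine ⟨ℂ, _, _, inferInstance, (1 : G →* (ℂ →ₗ[ℂ] ℂ)), Irr.of_forall fun q _ => ?_, Module.finrank_self ℂ⟩
  exact eq_bot_or_eq_top q

section
variable {F : Type} [Field F] [Finite F] [CharP F 2]

theorem fix_bound (h8 : 8 ≤ Nat.card F) (σ : F ≃+* F) (X : Set F) (hX : ∀ x ∈ X, σ x = x) (hc : 2 * X.ncard = Nat.card F) (c : F) : σ c = c := by
  by_contra hne
  have hinj : Function.Injective (fun z : X × X => (z.1 : F) + c * z.2) := by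
    rintro ⟨⟨x, hx⟩, ⟨y, hy⟩⟩ ⟨⟨x', hx'⟩, ⟨y', hy'⟩⟩ h
    have h : x + c * y = x' + c * y' := h
    have hyy : y = y' := by
      by_contra hyy
      have h1 := congrArg σ h
      simp only [map_add, map_mul, hX x hx, hX y hy, hX x' hx', hX y' hy'] at h1
      have : (σ c - c) * (y - y') = 0 := by linear_combination h1 - h
      rcases mul_eq_zero.1 this with h | h
      · exact hne (sub_eq_zero.1 h)
      · exact hyy (sub_eq_zero.1 h)
    subst hyy
    have := add_right_cancel h
    subst this
    rfl
  have := Nat.card_le_card_of_injective _ hinj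
  rw [Nat.card_prod, Nat.card_coe_set_eq] at this
  nlinarith

abbrev mapS (σ : F ≃+* F) : SL F →* SL F := Matrix.SpecialLinearGroup.map (σ : F →+* F)

theorem mapS_apply (σ : F ≃+* F) (g : SL F) (i j : Fin 2) : (mapS σ g) i j = σ (g i j) := rfl

theorem sep_sub (h8 : 8 ≤ Nat.card F) (σ : F ≃+* F) (c : F) (hσ : σ c ≠ c) :
    ∃ (x : SL F) (V : Type) (_ : AddCommGroup V) (_ : Module ℂ V) (_ : FiniteDimensional ℂ V) (ρ : Representation ℂ (SL F) V), Irr ρ ∧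
      LinearMap.trace ℂ V (ρ x) ≠ LinearMap.trace ℂ V (ρ (mapS σ x)) ∧ Module.finrank ℂ V = Nat.card F - 1 := by
  have hex : ∃ s, s ∉ Sp F ∧ σ s ≠ s := by
    by_contra! hh
    refine hσ (fix_bound h8 σ (Sp F)ᶜ (fun x hx => hh x hx) ?_ c)
    have h1 := Sp_card (F := F)
    have h2 : (Sp F)ᶜ.ncard = Nat.card F - (Sp F).ncard := Set.ncard_compl _
    omega
  obtain ⟨s, hs, hσs⟩ := hex
  have hs' : σ s ∉ Sp F := by
    rintro ⟨a, ha⟩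
    refine hs ⟨Units.map (σ.symm : F →* F) a, ?_⟩
    rw [← map_inv]
    have := congrArg σ.symm ha
    rw [map_add, RingEquiv.symm_apply_apply] at this
    exact this
  have hm : mapS σ (ofTr s) = ofTr (σ s) := by
    apply SL.ext' <;> rw [mapS_apply] <;> simp [ofTr, SL.mk4]
  refine ⟨ofTr s, ?_⟩
  rw [hm]
  exact sep_nsp (by omega) (by simpa [ofTr] using hσs.symm) (NSp_of_trace (by simpa [ofTr] using hs)) (NSp_of_trace (by simpa [ofTr] using hs'))

theorem sep_add (h8 : 8 ≤ Nat.card F) (σ : F ≃+* F) (c : F) (hσ : σ c ≠ c) :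
    ∃ (x : SL F) (V : Type) (_ : AddCommGroup V) (_ : Module ℂ V) (_ : FiniteDimensional ℂ V) (ρ : Representation ℂ (SL F) V), Irr ρ ∧
      LinearMap.trace ℂ V (ρ x) ≠ LinearMap.trace ℂ V (ρ (mapS σ x)) ∧ Module.finrank ℂ V = Nat.card F + 1 := by
  have hex : ∃ s, s ∈ Sp F ∧ σ s ≠ s := by
    by_contra! hh
    exact hσ (fix_bound h8 σ (Sp F) (fun x hx => hh x hx) Sp_card c)
  obtain ⟨s, ⟨a, rfl⟩, hσs⟩ := hex
  let b : Fˣ := Units.map (σ : F →* F) a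
  have hb : σ ((a : F) + (a⁻¹ : Fˣ)) = b + (b⁻¹ : Fˣ) := by
    rw [map_add, ← map_inv]; rfl
  have hm : mapS σ (tt a) = tt b := by
    apply SL.ext' <;> rw [mapS_apply] <;> simp [tt, SL.mk4, b]
  have ha1 : a ≠ 1 := by rintro rfl; simp at hσs
  have hb1 : b ≠ 1 := fun h => ha1 (Units.ext (σ.injective (by rw [Units.val_one, map_one]; exact congrArg Units.val h)))
  refine ⟨tt a, ?_⟩
  rw [hm]
  exact sep_sp (by omega) (by rw [← hb]; exact hσs.symm) ha1 hb1
end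
end ModK1

section ModK2

theorem sup_solvable {G : Type*} [Group G] (N L : Subgroup G) [hN : N.Normal] [Group.IsSolvable N] [Group.IsSolvable L] :
    Group.IsSolvable ↥(N ⊔ L) := by
  have hmem : ∀ x : ↥(N ⊔ L), QuotientGroup.mk' N x ∈ L.map (QuotientGroup.mk' N) := by
    rintro ⟨x, hx⟩
    obtain ⟨y, hy, z, hz, rfl⟩ := Subgroup.mem_sup_of_normal_left.1 hx
    refine ⟨z, hz, ?_⟩
    have h : QuotientGroup.mk' N y = 1 := (QuotientGroup.eq_one_iff y).2 hy
    change QuotientGroup.mk' N z = QuotientGroup.mk' N (y * z)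
    rw [map_mul, h, one_mul]
  let g : ↥(N ⊔ L) →* L.map (QuotientGroup.mk' N) := ((QuotientGroup.mk' N).comp (N ⊔ L).subtype).codRestrict _ hmem
  have : Group.IsSolvable (L.map (QuotientGroup.mk' N)) :=
    Group.isSolvable_of_surjective (f := (QuotientGroup.mk' N).subgroupMap L) ((QuotientGroup.mk' N).subgroupMap_surjective L)
  refine Group.isSolvable_of_ker_le_range (Subgroup.inclusion (le_sup_left : N ≤ N ⊔ L)) g ?_
  intro x hx
  have h1 : QuotientGroup.mk' N x = 1 := congrArg Subtype.val hx
  have h2 : (x : G) ∈ N := (QuotientGroup.eq_one_iff _).1 h1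
  exact ⟨⟨x, h2⟩, rfl⟩

theorem radical_solvable (G : Type*) [Group G] [Finite G] : Group.IsSolvable (solvableRadical G) := by
  obtain ⟨N, hN⟩ := Set.Finite.exists_maximal (s := {N : Subgroup G | N.Normal ∧ Group.IsSolvable N}) (Set.toFinite _)
    ⟨⊥, inferInstance, inferInstance⟩
  have h1 := hN.1.1
  have h2 : Group.IsSolvable N := hN.1.2
  have : solvableRadical G = N := by
    apply le_antisymm
    · refine iSup_le ?_
      rintro ⟨L, hL, hLs⟩
      have : Group.IsSolvable L := hLs
      exact le_sup_right.trans (hN.2 ⟨inferInstance, sup_solvable N L⟩ (le_sup_left (b := L)))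
    · exact le_iSup (fun N : { N : Subgroup G // N.Normal ∧ IsSolvable ↥N } => (N : Subgroup G)) ⟨N, hN.1⟩
  rw [this]; exact h2

theorem center_SL {F : Type} [Field F] [CharP F 2] : Subgroup.center (SL F) = ⊥ := by
  rw [eq_bot_iff]
  intro g hg
  obtain ⟨r, hr, h⟩ := Matrix.SpecialLinearGroup.mem_center_iff.1 hg
  have : r = 1 := by
    simp at hr
    rcases hr with hr | hr
    · exact hr
    · rw [hr, CharTwo.neg_eq]
  rw [Subgroup.mem_bot]
  apply Subtype.ext
  rw [← h, this]; simp

theorem psl_equiv (F : Type) [Field F] [CharP F 2] : Nonempty (PSL2 F ≃* SL F) :=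
  ⟨(QuotientGroup.quotientMulEquivOfEq center_SL).trans QuotientGroup.quotientBot⟩

theorem setup {G : Type} [Group G] [Finite G] {F : Type} [Field F] [Finite F] [CharP F 2] (h8 : 8 ≤ Nat.card F)
    (M : Subgroup G) (hM : M.Normal) (hRM : solvableRadical G ≤ M) (ε : radicalQuotImage M ≃* SL F)
    (hd2 : ∀ n, Deg G n → 2 ∣ n → (∃ p, p.Prime ∧ p ∣ Nat.card F - 1 ∧ ¬ p ∣ n) ∧ (∃ r, r.Prime ∧ r ∣ Nat.card F + 1 ∧ ¬ r ∣ n))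
    (hd1 : ∀ n, Deg G n → ¬ (Nat.card F + 1) * (Nat.card F - 1) ∣ n) :
    ∃ K : Subgroup G, K.Normal ∧ K ⊓ solvableRadical G = ⊥ ∧ K ⊔ solvableRadical G = M ∧ Nonempty (K ≃* SL F) := by
  set R := solvableRadical G with hR
  have hRs : Group.IsSolvable R := radical_solvable G
  obtain ⟨K, hK⟩ := Set.Finite.exists_minimal (s := {N : Subgroup G | N.Normal ∧ N ⊔ R = M}) (Set.toFinite _)
    ⟨M, hM, sup_eq_left.2 hRM⟩
  obtain ⟨hKn, hKR⟩ := hK.1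
  let π := QuotientGroup.mk' R
  have hmapR : R.map π = ⊥ := by
    rw [Subgroup.map_eq_bot_iff, QuotientGroup.ker_mk']
  have hmap : K.map π = radicalQuotImage M := by
    change _ = M.map π
    rw [← hKR, Subgroup.map_sup, hmapR, sup_bot_eq]
  have hperf : commutator (radicalQuotImage M) = ⊤ := by
    have := perfect_SL (F := F) (by omega)
    rw [commutator_def, ← Subgroup.map_top_of_surjective ε.symm.toMonoidHom ε.symm.surjective, ← Subgroup.map_commutator, ← commutator_def, this]
  have hcomm : ⁅K, K⁆ ⊔ R = M := by
    have h1 : (⁅K, K⁆).map π = M.map π := by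
      rw [Subgroup.map_commutator, hmap, ← Subgroup.map_subtype_commutator, hperf, ← MonoidHom.range_eq_map, Subgroup.range_subtype]
      rfl
    have h2 := congrArg (Subgroup.comap π) h1
    rw [Subgroup.comap_map_eq, Subgroup.comap_map_eq, QuotientGroup.ker_mk'] at h2
    rw [h2, sup_eq_left.2 hRM]
  have hKK : ⁅K, K⁆ = K := le_antisymm (Subgroup.commutator_le_left K K) (hK.2 ⟨inferInstance, hcomm⟩ (Subgroup.commutator_le_left K K))
  have hKp : commutator K = ⊤ := by
    apply Subgroup.map_injective K.subtype_injective
    rw [Subgroup.map_subtype_commutator, hKK, ← MonoidHom.range_eq_map, Subgroup.range_subtype]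
  let φ0 : K →* radicalQuotImage M := (π.comp K.subtype).codRestrict _ (fun x => by rw [← hmap]; exact ⟨x, x.2, rfl⟩)
  have hφ0 : Function.Surjective φ0 := by
    rintro ⟨y, hy⟩
    rw [← hmap] at hy
    obtain ⟨x, hx, rfl⟩ := hy
    exact ⟨⟨x, hx⟩, rfl⟩
  let φ : K →* SL F := ε.toMonoidHom.comp φ0
  have hker : ∀ x : K, φ x = 1 ↔ (x : G) ∈ R := by
    intro x
    change ε (φ0 x) = 1 ↔ _
    rw [map_eq_one_iff ε ε.injective, Subtype.ext_iff]
    exact QuotientGroup.eq_one_iff _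
  have hsol : Group.IsSolvable φ.ker := by
    let j : φ.ker →* R := (K.subtype.comp φ.ker.subtype).codRestrict _ (fun x => (hker x).1 x.2)
    refine Group.isSolvable_of_isSolvable_injective (f := j) ?_
    intro x y h
    exact Subtype.ext (Subtype.ext (congrArg (Subtype.val : R → G) h))
  have hk := ker_trivial h8 hKp (φ := φ) (ε.surjective.comp hφ0) (by
    intro n hn h2
    obtain ⟨m, hm, hnm⟩ := Deg.over hn
    obtain ⟨⟨p, hp, hpd, hpn⟩, r, hr, hrd, hrn⟩ := hd2 m hm (h2.trans hnm)
    exact ⟨⟨p, hp, hpd, fun h => hpn (h.trans hnm)⟩, r, hr, hrd, fun h => hrn (h.trans hnm)⟩) (by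
    intro n hn h
    obtain ⟨m, hm, hnm⟩ := Deg.over hn
    exact hd1 m hm (h.trans hnm))
  refine ⟨K, hKn, ?_, hKR, ⟨MulEquiv.ofBijective φ ⟨(MonoidHom.ker_eq_bot_iff φ).1 hk, ε.surjective.comp hφ0⟩⟩⟩
  rw [eq_bot_iff]
  rintro x ⟨hx, hxR⟩
  have : (⟨x, hx⟩ : K) ∈ φ.ker := (hker ⟨x, hx⟩).2 hxR
  rw [hk, Subgroup.mem_bot] at this
  exact congrArg Subtype.val this
end ModK2

section ModK3

section
variable {F : Type} [Field F] [Finite F] [CharP F 2]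

def trS (x : SL F) : F := x 0 0 + x 1 1

theorem trS_conj (s x : SL F) : trS (s * x * s⁻¹) = trS x := by
  have := trace_conj_SL s⁻¹ x
  rwa [inv_inv] at this

theorem trS_map (τ : F ≃+* F) (x : SL F) : trS (mapS τ x) = τ (trS x) := by
  unfold trS
  rw [mapS_apply, mapS_apply, map_add]

theorem trS_ofTr (s : F) : trS (ofTr s : SL F) = s := by simp [trS, ofTr]

theorem quot_field {G : Type} [Group G] {K : Subgroup G} [K.Normal] (e : K ≃* SL F) :
    ∃ T : G →* RingAut F, T.ker = K ⊔ Subgroup.centralizer (K : Set G) ∧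
      ∀ g, ∃ s : SL F, ∀ x : K, e (MulAut.conjNormal g x) = s * mapS (T g) (e x) * s⁻¹ := by
  have hex : ∀ g : G, ∃ (τ : F ≃+* F) (s : SL F), ∀ x : K, e (MulAut.conjNormal g x) = s * mapS τ (e x) * s⁻¹ := by
    intro g
    let α : SL F →* SL F := e.toMonoidHom.comp ((MulAut.conjNormal g).toMonoidHom.comp e.symm.toMonoidHom)
    obtain ⟨τ, s, h⟩ := aut_SL α (e.injective.comp ((MulAut.conjNormal g).injective.comp e.symm.injective))
    refine ⟨τ, s, fun x => ?_⟩
    rw [← h]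
    change _ = e (MulAut.conjNormal g (e.symm (e x)))
    rw [MulEquiv.symm_apply_apply]
  choose τ s hs using hex
  have htr : ∀ g x, trS (e (MulAut.conjNormal g x)) = τ g (trS (e x)) := by
    intro g x
    rw [hs, trS_conj, trS_map]
  let T : G →* RingAut F := MonoidHom.mk' τ (by
    intro g h
    refine RingEquiv.ext fun c => ?_
    have h1 := htr (g * h) (e.symm (ofTr c))
    rw [map_mul, MulAut.mul_apply, htr, htr, MulEquiv.apply_symm_apply, trS_ofTr] at h1
    exact h1.symm)
  refine ⟨T, le_antisymm ?_ (sup_le ?_ ?_), fun g => ⟨s g, hs g⟩⟩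
  · intro g hg
    have hτ : τ g = RingEquiv.refl F := hg
    obtain ⟨k, hk⟩ := e.surjective (s g)
    have hkg : (k⁻¹ : G) * g ∈ Subgroup.centralizer (K : Set G) := by
      rw [Subgroup.mem_centralizer_iff]
      intro x hx
      have h1 := hs g ⟨x, hx⟩
      have h2 : ∀ y : SL F, mapS (RingEquiv.refl F) y = y := fun y => by
        apply SL.ext' <;> rw [mapS_apply] <;> rfl
      rw [hτ, h2, ← hk, ← map_inv, ← map_mul, ← map_mul] at h1
      have h3 := congrArg (Subtype.val : K → G) (e.injective h1)
      rw [MulAut.conjNormal_apply] at h3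
      have h4 : g * x * g⁻¹ = k * x * (k : G)⁻¹ := h3
      have h5 : g * x = k * x * (k : G)⁻¹ * g := by rw [← h4]; group
      rw [mul_assoc, h5]; group
    have : g = k * ((k⁻¹ : G) * g) := by group
    rw [this]
    exact Subgroup.mul_mem_sup k.2 hkg
  · intro g hg
    rw [MonoidHom.mem_ker]
    refine RingEquiv.ext fun c => ?_
    have h1 := htr g (e.symm (ofTr c))
    have h2 : (MulAut.conjNormal g : MulAut K) (e.symm (ofTr c)) = ⟨g, hg⟩ * (e.symm (ofTr c)) * ⟨g, hg⟩⁻¹ := by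
      apply Subtype.ext; rw [MulAut.conjNormal_apply]; rfl
    rw [h2, map_mul, map_mul, map_inv, trS_conj, MulEquiv.apply_symm_apply, trS_ofTr] at h1
    exact h1.symm
  · intro g hg
    rw [MonoidHom.mem_ker]
    refine RingEquiv.ext fun c => ?_
    have h1 := htr g (e.symm (ofTr c))
    have h2 : (MulAut.conjNormal g : MulAut K) (e.symm (ofTr c)) = (e.symm (ofTr c)) := by
      apply Subtype.ext; rw [MulAut.conjNormal_apply]
      have := Subgroup.mem_centralizer_iff.1 hg _ (e.symm (ofTr c)).2
      rw [← this, mul_inv_cancel_right]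
    rw [h2, MulEquiv.apply_symm_apply, trS_ofTr] at h1
    exact h1.symm

/-- internal direct product -/
theorem prod_equiv {G : Type} [Group G] (K C : Subgroup G) [hK : K.Normal] [hC : C.Normal] (h : K ⊓ C = ⊥) :
    ∃ ψ : K × C ≃* ↥(K ⊔ C), ∀ k c, ((ψ (k, c) : ↥(K ⊔ C)) : G) = k * c := by
  have hd : Disjoint K C := disjoint_iff.2 h
  have hcomm : ∀ (k : K) (c : C), Commute (K.subtype k) (C.subtype c) := fun k c =>
    Subgroup.commute_of_normal_of_disjoint K C hK hC hd k c k.2 c.2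
  let p := MonoidHom.noncommCoprod K.subtype C.subtype hcomm
  have hp : Function.Injective p := by
    rw [MonoidHom.noncommCoprod_injective]
    exact ⟨K.subtype_injective, C.subtype_injective, by rwa [Subgroup.range_subtype, Subgroup.range_subtype]⟩
  have hr : p.range = K ⊔ C := by
    rw [MonoidHom.noncommCoprod_range, Subgroup.range_subtype, Subgroup.range_subtype]
  exact ⟨(MonoidHom.ofInjective hp).trans (MulEquiv.subgroupCongr hr), fun k c => rfl⟩

theorem stab_deg {G : Type} [Group G] [Finite G] {K C : Subgroup G} [K.Normal] [C.Normal] (hKC : K ⊓ C = ⊥) (e : K ≃* SL F)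
    (hcyc : IsCyclic (G ⧸ (K ⊔ C))) {V : Type} [AddCommGroup V] [Module ℂ V] [FiniteDimensional ℂ V] {χ : Representation ℂ (SL F) V}
    (hχ : Irr χ) {b : ℕ} (hb : Deg C b) {p : ℕ} (hp : p.Prime) (g : G) (hg : g ^ p ∈ K ⊔ C) (σ : F ≃+* F) (s : SL F)
    (hs : ∀ x : K, e (MulAut.conjNormal g⁻¹ x) = s * mapS σ (e x) * s⁻¹) (x : SL F)
    (hx : LinearMap.trace ℂ V (χ x) ≠ LinearMap.trace ℂ V (χ (mapS σ x))) :
    ∃ n, Deg G n ∧ p ∣ n ∧ Module.finrank ℂ V ∣ n ∧ b ∣ n := by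
  obtain ⟨W, _, _, _, θ, hθ, rfl⟩ := hb
  obtain ⟨ψ, hψ⟩ := prod_equiv K C hKC
  let χ' : Representation ℂ K V := χ.comp e.toMonoidHom
  have hχ' : Irr χ' := comp_irr hχ _ e.surjective
  let η := tens χ' θ
  have hη : Irr η := tens_irr hχ' hθ
  let σ' : Representation ℂ ↥(K ⊔ C) (TensorProduct ℂ V W) := η.comp ψ.symm.toMonoidHom
  have hσ' : Irr σ' := comp_irr hη _ ψ.symm.surjective
  have htr : ∀ k : K, LinearMap.trace ℂ _ (σ' (ψ (k, 1))) = LinearMap.trace ℂ V (χ (e k)) * Module.finrank ℂ W := by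
    intro k
    change η.character (ψ.symm (ψ (k, 1))) = _
    rw [MulEquiv.symm_apply_apply]
    change (tens χ' θ).character _ = _
    unfold tens
    rw [Representation.char_tensor]
    change LinearMap.trace ℂ V (χ (e k)) * LinearMap.trace ℂ W (θ 1) = _
    rw [map_one, Module.End.one_eq_id, LinearMap.trace_id]
  obtain ⟨U, _, _, _, ρ, B, E, hρ, hB, hE⟩ := over_data (K ⊔ C) hσ'
  obtain ⟨I, hI, hst, hdim⟩ := cyclic_ext hcyc hρ hB
  have hfin : Module.finrank ℂ B = Module.finrank ℂ V * Module.finrank ℂ W := by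
    rw [← E.finrank_eq, Module.finrank_tensorProduct]
  have hgI : g ∉ I := by
    intro hgI
    obtain ⟨k, rfl⟩ := e.surjective x
    have h1 := stab_trace E hE g (hst g hgI) (ψ (k, 1)) (ψ (MulAut.conjNormal g⁻¹ k, 1)) (by
      rw [hψ, hψ, MulAut.conjNormal_apply]; simp; group)
    rw [htr, htr, hs] at h1
    have hW : (Module.finrank ℂ W : ℂ) ≠ 0 := by
      have := hθ.nontrivial
      exact_mod_cast Module.finrank_pos.ne'
    have h2 := mul_right_cancel₀ hW h1
    apply hx
    rw [h2, map_mul χ, LinearMap.trace_mul_comm, ← map_mul χ, ← mul_assoc, inv_mul_cancel, one_mul]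
  have hIn : I.Normal := by
    constructor
    intro n hn h
    have : IsMulCommutative (G ⧸ (K ⊔ C)) := IsCyclic.isMulCommutative
    have h1 : ((h * n * h⁻¹ * n⁻¹ : G) : G ⧸ (K ⊔ C)) = 1 := by
      have := mul_comm' (h : G ⧸ (K ⊔ C)) (n : G ⧸ (K ⊔ C))
      rw [QuotientGroup.mk_mul, QuotientGroup.mk_mul, QuotientGroup.mk_mul, this]; simp
    have h2 := hI ((QuotientGroup.eq_one_iff _).1 h1)
    have := I.mul_mem h2 hn
    rwa [inv_mul_cancel_right] at this
  have hpI : p ∣ I.index := by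
    by_contra hnp
    have hco : IsCoprime (p : ℤ) (I.index : ℤ) := by
      rw [Nat.isCoprime_iff_coprime]; exact (hp.coprime_iff_not_dvd).2 hnp
    obtain ⟨u, v, huv⟩ := hco
    apply hgI
    have e1 : g = (g ^ p) ^ u * (g ^ I.index) ^ v := by
      rw [← zpow_natCast, ← zpow_natCast, ← zpow_mul, ← zpow_mul, ← zpow_add, mul_comm (p : ℤ), mul_comm (I.index : ℤ), huv, zpow_one]
    rw [e1]
    exact I.mul_mem (I.zpow_mem (hI hg) u) (I.zpow_mem (I.pow_index_mem g) v)
  refine ⟨_, ⟨U, _, _, inferInstance, ρ, hρ, rfl⟩, ?_, ?_, ?_⟩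
  · rw [hdim]; exact hpI.mul_right _
  · rw [hdim, hfin]; exact (Dvd.intro _ rfl : _ ∣ _ * _).mul_left _
  · rw [hdim, hfin]; exact (Dvd.intro_left _ rfl : _ ∣ _ * _).mul_left _
end
end ModK3

section ModK4

theorem ringaut_gal (F : Type) [Field F] [CharP F 2] [Algebra (ZMod 2) F] : Nonempty (RingAut F ≃* (F ≃ₐ[ZMod 2] F)) := by
  refine ⟨{ toFun := fun σ => AlgEquiv.ofRingEquiv (f := σ) (fun r => ?_), invFun := fun σ => σ.toRingEquiv, left_inv := fun σ => rfl, right_inv := fun σ => rfl, map_mul' := fun _ _ => rfl }⟩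
  have : (σ : F →+* F).comp (algebraMap (ZMod 2) F) = algebraMap (ZMod 2) F := Subsingleton.elim _ _
  exact RingHom.congr_fun this r

theorem ringaut_cyclic (f : ℕ) : IsCyclic (RingAut (GaloisField 2 f)) := by
  obtain ⟨e⟩ := ringaut_gal (GaloisField 2 f)
  exact isCyclic_of_injective e.toMonoidHom e.injective

theorem ringaut_card {f : ℕ} (hf : f ≠ 0) : Nat.card (RingAut (GaloisField 2 f)) = f := by
  obtain ⟨e⟩ := ringaut_gal (GaloisField 2 f)
  rw [Nat.card_congr e.toEquiv, IsGalois.card_aut_eq_finrank, GaloisField.finrank 2 hf]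

section
variable {F : Type} [Field F] [Finite F] [CharP F 2] {G : Type} [Group G] [Finite G]

instance ringaut_finite : Finite (RingAut F) := Finite.of_injective (fun σ : RingAut F => (σ : F → F)) (fun a b h => RingEquiv.ext (congrFun h))

theorem quot_cyc (hcyc : IsCyclic (RingAut F)) {N : Subgroup G} [N.Normal] (T : G →* RingAut F) (hT : T.ker = N) :
    IsCyclic (G ⧸ N) ∧ N.index ∣ Nat.card (RingAut F) := by
  subst hT
  exact ⟨isCyclic_of_injective (QuotientGroup.kerLift T) (QuotientGroup.kerLift_injective T), by
    rw [Subgroup.index_ker]; exact Subgroup.card_subgroup_dvd_card _⟩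

theorem top_of (h8 : 8 ≤ Nat.card F) (hcyc : IsCyclic (RingAut F)) {K : Subgroup G} [K.Normal] (e : K ≃* SL F) {C : Subgroup G} [C.Normal]
    (hC : Subgroup.centralizer (K : Set G) = C) (hKC : K ⊓ C = ⊥) {t b : ℕ} (hb : Deg C b) (htb : t ∣ b)
    (hno : ∀ n p, Deg G n → p.Prime → p ∣ Nat.card (RingAut F) → p ∣ n → t ∣ n →
      (Nat.card F - 1 ∣ n → p ∣ Nat.card F - 1) ∧ (Nat.card F + 1 ∣ n → p ∣ Nat.card F + 1)) : K ⊔ C = ⊤ := by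
  obtain ⟨T, hker, hT⟩ := quot_field e
  rw [hC] at hker
  obtain ⟨hc, hind⟩ := quot_cyc hcyc T hker
  by_contra hne
  have h1 : Nat.card (G ⧸ (K ⊔ C)) ≠ 1 := fun h => hne (Subgroup.index_eq_one.1 h)
  obtain ⟨p, hp, hpd⟩ := Nat.exists_prime_and_dvd h1
  have := Fact.mk hp
  obtain ⟨y, hy⟩ := exists_prime_orderOf_dvd_card' p hpd
  obtain ⟨g, rfl⟩ := QuotientGroup.mk_surjective y
  have hgp : g ^ p ∈ K ⊔ C := by
    rw [← QuotientGroup.eq_one_iff, QuotientGroup.mk_pow, ← hy, pow_orderOf_eq_one]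
  have hg1 : g ∉ K ⊔ C := by
    intro h
    rw [(QuotientGroup.eq_one_iff g).2 h, orderOf_one] at hy
    exact hp.one_lt.ne hy
  have hTg : ∃ c, T g⁻¹ c ≠ c := by
    by_contra! h
    apply hg1
    rw [← hker, ← Subgroup.inv_mem_iff, MonoidHom.mem_ker]
    exact RingEquiv.ext h
  obtain ⟨c, hTc⟩ := hTg
  obtain ⟨s, hs⟩ := hT g⁻¹
  have hpf : p ∣ Nat.card (RingAut F) := hpd.trans hind
  have d1 : p ∣ Nat.card F - 1 := by
    obtain ⟨x, V, _, _, _, χ, hχ, hx, hd⟩ := sep_sub h8 (T g⁻¹) c hTc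
    obtain ⟨n, hn, hpn, hdn, hbn⟩ := stab_deg hKC e hc hχ hb hp g hgp (T g⁻¹) s hs x hx
    exact (hno n p hn hp hpf hpn (htb.trans hbn)).1 (hd ▸ hdn)
  have d2 : p ∣ Nat.card F + 1 := by
    obtain ⟨x, V, _, _, _, χ, hχ, hx, hd⟩ := sep_add h8 (T g⁻¹) c hTc
    obtain ⟨n, hn, hpn, hdn, hbn⟩ := stab_deg hKC e hc hχ hb hp g hgp (T g⁻¹) s hs x hx
    exact (hno n p hn hp hpf hpn (htb.trans hbn)).2 (hd ▸ hdn)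
  have h2 := even_q (F := F)
  have h3 : p ∣ 2 := by
    have := Nat.dvd_sub d2 d1
    rwa [show Nat.card F + 1 - (Nat.card F - 1) = 2 by omega] at this
  rw [(Nat.prime_dvd_prime_iff_eq hp Nat.prime_two).1 h3] at d1
  omega

theorem deg_C (h8 : 8 ≤ Nat.card F) (hcyc : IsCyclic (RingAut F)) {K : Subgroup G} [K.Normal] (e : K ≃* SL F) {C : Subgroup G} [C.Normal]
    (hC : Subgroup.centralizer (K : Set G) = C) (hKC : K ⊓ C = ⊥) {t n : ℕ} (ht : t.Prime) (hn : Deg G n) (htn : t ∣ n)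
    (h1 : ¬ t ∣ Nat.card (RingAut F)) (h2 : ¬ t ∣ Nat.card F) (h3 : ¬ t ∣ Nat.card F - 1) (h4 : ¬ t ∣ Nat.card F + 1) :
    ∃ b, Deg C b ∧ t ∣ b := by
  obtain ⟨T, hker, -⟩ := quot_field e
  rw [hC] at hker
  obtain ⟨hc, hind⟩ := quot_cyc hcyc T hker
  obtain ⟨V, _, _, _, ρ, hρ, rfl⟩ := hn
  have := hρ.nontrivial
  obtain ⟨A, -, hA⟩ := exists_simp (res ρ (K ⊔ C)) (top_ne_bot) (RInv.top _)
  obtain ⟨I, hI, -, hdim⟩ := cyclic_ext hc hρ hA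
  have hDA : Deg ↥(K ⊔ C) (Module.finrank ℂ A) := ⟨A, _, _, inferInstance, _, hA.irr, rfl⟩
  obtain ⟨ψ, -⟩ := prod_equiv K C hKC
  obtain ⟨a, b, ha, hb, hab⟩ := (hDA.surj ψ.toMonoidHom ψ.surjective).of_prod
  refine ⟨b, hb, ?_⟩
  rw [hdim, hab] at htn
  rcases ht.dvd_mul.1 htn with h | h
  · exact absurd (h.trans ((Subgroup.index_dvd_of_le hI).trans hind)) h1
  · rcases ht.dvd_mul.1 h with h | h
    · have ha' : Deg (SL F) a := ha.surj e.symm.toMonoidHom e.symm.surjective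
      rcases deg_SL (by omega) ha' with rfl | rfl | rfl | rfl
      · exact absurd (Nat.dvd_one.1 h) ht.one_lt.ne'
      all_goals tauto
    · exact h
end
end ModK4

section ModK5

def EE (G : Type) [Group G] (a b : ℕ) : Prop := ∃ n, Deg G n ∧ a * b ∣ n

theorem EE.symm {G : Type} [Group G] {a b : ℕ} (h : EE G a b) : EE G b a := by
  obtain ⟨n, hn, hd⟩ := h
  exact ⟨n, hn, by rwa [mul_comm]⟩

theorem EE.of {G : Type} [Group G] {a b n : ℕ} (ha : a.Prime) (hb : b.Prime) (hab : a ≠ b) (hn : Deg G n) (h1 : a ∣ n) (h2 : b ∣ n) : EE G a b :=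
  ⟨n, hn, ((Nat.coprime_primes ha hb).2 hab).mul_dvd_of_dvd_of_dvd h1 h2⟩

theorem adj_iff {G : Type} [Group G] [Finite G] (x y : charPrimes G) : (charGraph G).Adj x y ↔ (x : ℕ) ≠ y ∧ EE G x y := by
  unfold EE
  simp only [← mem_charDegrees]
  rfl

theorem mem_cp {G : Type} [Group G] [Finite G] {p : ℕ} : p ∈ charPrimes G ↔ p.Prime ∧ ∃ n, Deg G n ∧ p ∣ n := by
  simp only [← mem_charDegrees]
  rfl

theorem EE.left {G : Type} [Group G] [Finite G] {a b : ℕ} (h : EE G a b) (ha : a.Prime) : a ∈ charPrimes G := by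
  obtain ⟨n, hn, hd⟩ := h
  exact mem_cp.2 ⟨ha, n, hn, (Dvd.intro _ rfl).trans hd⟩

theorem noK4 {G : Type} [Group G] [Finite G] (h4 : (charGraph G).CliqueFree 4) {a b c d : ℕ} (ha : a.Prime) (hb : b.Prime)
    (hc : c.Prime) (hd : d.Prime) (nab : a ≠ b) (nac : a ≠ c) (nad : a ≠ d) (nbc : b ≠ c) (nbd : b ≠ d) (ncd : c ≠ d)
    (eab : EE G a b) (eac : EE G a c) (ead : EE G a d) (ebc : EE G b c) (ebd : EE G b d) (ecd : EE G c d) : False := by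
  classical
  let A : charPrimes G := ⟨a, eab.left ha⟩
  let B : charPrimes G := ⟨b, ebc.left hb⟩
  let C : charPrimes G := ⟨c, ecd.left hc⟩
  let D : charPrimes G := ⟨d, ecd.symm.left hd⟩
  have AB : (charGraph G).Adj A B := (adj_iff A B).2 ⟨nab, eab⟩
  have AC : (charGraph G).Adj A C := (adj_iff A C).2 ⟨nac, eac⟩
  have AD : (charGraph G).Adj A D := (adj_iff A D).2 ⟨nad, ead⟩
  have BC : (charGraph G).Adj B C := (adj_iff B C).2 ⟨nbc, ebc⟩
  have BD : (charGraph G).Adj B D := (adj_iff B D).2 ⟨nbd, ebd⟩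
  have CD : (charGraph G).Adj C D := (adj_iff C D).2 ⟨ncd, ecd⟩
  have h3 : (charGraph G).IsNClique 3 {B, C, D} := SimpleGraph.is3Clique_triple_iff.2 ⟨BC, BD, CD⟩
  refine h4 (insert A {B, C, D}) (h3.insert ?_)
  intro x hx
  simp only [Finset.mem_insert, Finset.mem_singleton] at hx
  rcases hx with rfl | rfl | rfl <;> assumption

theorem noK4' {G : Type} [Group G] [Finite G] (h4 : (charGraph G).CliqueFree 4) {a b c d n : ℕ} (ha : a.Prime) (hb : b.Prime)
    (hc : c.Prime) (hd : d.Prime) (nab : a ≠ b) (nac : a ≠ c) (nad : a ≠ d) (nbc : b ≠ c) (nbd : b ≠ d) (ncd : c ≠ d)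
    (hn : Deg G n) (da : a ∣ n) (db : b ∣ n) (dc : c ∣ n) (dd : d ∣ n) : False :=
  noK4 h4 ha hb hc hd nab nac nad nbc nbd ncd (.of ha hb nab hn da db) (.of ha hc nac hn da dc) (.of ha hd nad hn da dd)
    (.of hb hc nbc hn db dc) (.of hb hd nbd hn db dd) (.of hc hd ncd hn dc dd)

/-- arithmetic data -/
structure Ar (q p1 p2 r1 r2 : ℕ) : Prop where
  h8 : 8 ≤ q
  two : 2 ∣ q
  q2 : ∀ x, x.Prime → x ∣ q → x = 2
  pp1 : p1.Prime
  pp2 : p2.Prime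
  pr1 : r1.Prime
  pr2 : r2.Prime
  hp : p1 ≠ p2
  hr : r1 ≠ r2
  dp1 : p1 ∣ q - 1
  dp2 : p2 ∣ q - 1
  dr1 : r1 ∣ q + 1
  dr2 : r2 ∣ q + 1
  ap : ∀ x, x.Prime → x ∣ q - 1 → x = p1 ∨ x = p2
  ar : ∀ x, x.Prime → x ∣ q + 1 → x = r1 ∨ x = r2

namespace Ar
variable {q p1 p2 r1 r2 : ℕ} (h : Ar q p1 p2 r1 r2)
include h

theorem d0 {x : ℕ} (hx : x.Prime) (h1 : x ∣ q - 1) (h2 : x ∣ q) : False := by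
  have h8 := h.h8
  have := Nat.dvd_sub h2 h1
  rw [show q - (q - 1) = 1 by omega] at this
  exact hx.one_lt.ne' (Nat.dvd_one.1 this)

theorem d1 {x : ℕ} (hx : x.Prime) (h1 : x ∣ q + 1) (h2 : x ∣ q) : False :=
  hx.one_lt.ne' (Nat.dvd_one.1 ((Nat.dvd_add_right h2).1 h1))

theorem d2 {x : ℕ} (hx : x.Prime) (h1 : x ∣ q - 1) (h2 : x ∣ q + 1) : False := by
  have h8 := h.h8
  have := Nat.dvd_sub h2 h1
  rw [show q + 1 - (q - 1) = 2 by omega] at this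
  have := (Nat.prime_dvd_prime_iff_eq hx Nat.prime_two).1 this
  subst this
  exact h.d0 hx h1 h.two

theorem npr {x y : ℕ} (hx : x.Prime) (h1 : x ∣ q - 1) (h2 : y ∣ q + 1) : x ≠ y := by
  rintro rfl; exact h.d2 hx h1 h2

theorem np2 {x : ℕ} (h1 : x ∣ q - 1) : x ≠ 2 := by
  rintro rfl; exact h.d0 Nat.prime_two h1 h.two

theorem nr2 {x : ℕ} (h1 : x ∣ q + 1) : x ≠ 2 := by
  rintro rfl; exact h.d1 Nat.prime_two h1 h.two

end Ar
end ModK5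

section ModK6

theorem final_graph {G R : Type} [Group G] [Finite G] [Group R] [Finite R] (h4 : (charGraph G).CliqueFree 4)
    (h7 : Nat.card ↥(charPrimes G) = 7) {q p1 p2 r1 r2 : ℕ} (ar : Ar q p1 p2 r1 r2)
    (hD : ∀ n, Deg G n ↔ ∃ a b, (a = 1 ∨ a = q - 1 ∨ a = q ∨ a = q + 1) ∧ Deg R b ∧ n = a * b)
    {t b : ℕ} (ht : t.Prime) (hb : Deg R b) (htb : t ∣ b) (t0 : ¬ t ∣ q) (t1 : ¬ t ∣ q - 1) (t2 : ¬ t ∣ q + 1) :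
    Nat.card ↥(charPrimes R) = 2 ∧ charGraph R = ⊥ ∧
    Nonempty (charGraph G ≃g
      graphJoin (((⊤ : SimpleGraph (Fin 2)) ⊕g (⊤ : SimpleGraph (Fin 1))) ⊕g (⊤ : SimpleGraph (Fin 2))) (⊥ : SimpleGraph (Fin 2))) := by
  have h8 := ar.h8
  have dm : ∀ {b}, Deg R b → Deg G ((q - 1) * b) := fun {b} h => (hD _).2 ⟨_, b, by tauto, h, rfl⟩
  have dq : ∀ {b}, Deg R b → Deg G (q * b) := fun {b} h => (hD _).2 ⟨_, b, by tauto, h, rfl⟩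
  have dp : ∀ {b}, Deg R b → Deg G ((q + 1) * b) := fun {b} h => (hD _).2 ⟨_, b, by tauto, h, rfl⟩
  have em : ∀ {x y}, x.Prime → x ∣ q - 1 → y ∈ charPrimes R → EE G x y := by
    intro x y hx h hy
    obtain ⟨hyp, n, hn, hd⟩ := mem_cp.1 hy
    exact ⟨_, dm hn, mul_dvd_mul h hd⟩
  have eq : ∀ {x y}, x.Prime → x ∣ q → y ∈ charPrimes R → EE G x y := by
    intro x y hx h hy
    obtain ⟨hyp, n, hn, hd⟩ := mem_cp.1 hy
    exact ⟨_, dq hn, mul_dvd_mul h hd⟩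
  have ep : ∀ {x y}, x.Prime → x ∣ q + 1 → y ∈ charPrimes R → EE G x y := by
    intro x y hx h hy
    obtain ⟨hyp, n, hn, hd⟩ := mem_cp.1 hy
    exact ⟨_, dp hn, mul_dvd_mul h hd⟩
  have d1 := Deg.one R
  have epp : EE G p1 p2 := .of ar.pp1 ar.pp2 ar.hp (dm d1) (ar.dp1.mul_right _) (ar.dp2.mul_right _)
  have err : EE G r1 r2 := .of ar.pr1 ar.pr2 ar.hr (dp d1) (ar.dr1.mul_right _) (ar.dr2.mul_right _)
  have htR : t ∈ charPrimes R := mem_cp.2 ⟨ht, b, hb, htb⟩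
  have n0 : ∀ x ∈ charPrimes R, ¬ x ∣ q := by
    intro x hx h
    have hxp := (mem_cp.1 hx).1
    exact noK4 h4 hxp ht ar.pr1 ar.pr2 (by rintro rfl; exact t0 h) (by rintro rfl; exact ar.d1 hxp ar.dr1 h)
      (by rintro rfl; exact ar.d1 hxp ar.dr2 h) (by rintro rfl; exact t2 ar.dr1) (by rintro rfl; exact t2 ar.dr2) ar.hr
      (eq hxp h htR) (ep ar.pr1 ar.dr1 hx).symm (ep ar.pr2 ar.dr2 hx).symm (ep ar.pr1 ar.dr1 htR).symm (ep ar.pr2 ar.dr2 htR).symm err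
  have n1 : ∀ x ∈ charPrimes R, ¬ x ∣ q - 1 := by
    intro x hx h
    have hxp := (mem_cp.1 hx).1
    exact noK4 h4 hxp ht ar.pr1 ar.pr2 (by rintro rfl; exact t1 h) (ar.npr hxp h ar.dr1)
      (ar.npr hxp h ar.dr2) (by rintro rfl; exact t2 ar.dr1) (by rintro rfl; exact t2 ar.dr2) ar.hr
      (em hxp h htR) (ep ar.pr1 ar.dr1 hx).symm (ep ar.pr2 ar.dr2 hx).symm (ep ar.pr1 ar.dr1 htR).symm (ep ar.pr2 ar.dr2 htR).symm err
  have n2 : ∀ x ∈ charPrimes R, ¬ x ∣ q + 1 := by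
    intro x hx h
    have hxp := (mem_cp.1 hx).1
    exact noK4 h4 hxp ht ar.pp1 ar.pp2 (by rintro rfl; exact t2 h) (ar.npr ar.pp1 ar.dp1 h).symm
      (ar.npr ar.pp2 ar.dp2 h).symm (by rintro rfl; exact t1 ar.dp1) (by rintro rfl; exact t1 ar.dp2) ar.hp
      (ep hxp h htR) (em ar.pp1 ar.dp1 hx).symm (em ar.pp2 ar.dp2 hx).symm (em ar.pp1 ar.dp1 htR).symm (em ar.pp2 ar.dp2 htR).symm epp
  have eRR : ∀ {x y}, EE R x y → EE G x y := by
    rintro x y ⟨n, hn, hd⟩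
    exact ⟨_, dp hn, hd.mul_left _⟩
  have nRR : ∀ {x y}, x ∈ charPrimes R → y ∈ charPrimes R → x ≠ y → ¬ EE G x y := by
    intro x y hx hy hxy h
    have hxp := (mem_cp.1 hx).1
    have hyp := (mem_cp.1 hy).1
    exact noK4 h4 hxp hyp ar.pr1 ar.pr2 hxy (by rintro rfl; exact n2 _ hx ar.dr1)
      (by rintro rfl; exact n2 _ hx ar.dr2) (by rintro rfl; exact n2 _ hy ar.dr1) (by rintro rfl; exact n2 _ hy ar.dr2) ar.hr
      h (ep ar.pr1 ar.dr1 hx).symm (ep ar.pr2 ar.dr2 hx).symm (ep ar.pr1 ar.dr1 hy).symm (ep ar.pr2 ar.dr2 hy).symm err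
  have hS : ∀ {x y}, x.Prime → y.Prime → x ∉ charPrimes R → y ∉ charPrimes R → EE G x y →
      (x ∣ q - 1 ∧ y ∣ q - 1) ∨ (x ∣ q ∧ y ∣ q) ∨ (x ∣ q + 1 ∧ y ∣ q + 1) := by
    rintro x y hx hy hxR hyR ⟨n, hn, hd⟩
    obtain ⟨a, b, ha, hb, rfl⟩ := (hD n).1 hn
    have h1 : x ∣ a := ((hx.dvd_mul.1 ((Dvd.intro _ rfl).trans hd))).resolve_right fun h => hxR (mem_cp.2 ⟨hx, b, hb, h⟩)
    have h2 : y ∣ a := ((hy.dvd_mul.1 ((Dvd.intro_left _ rfl).trans hd))).resolve_right fun h => hyR (mem_cp.2 ⟨hy, b, hb, h⟩)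
    rcases ha with rfl | rfl | rfl | rfl
    · exact absurd (Nat.dvd_one.1 h1) hx.one_lt.ne'
    · tauto
    · tauto
    · tauto
  have p2R : 2 ∉ charPrimes R := fun h => n0 _ h ar.two
  -- cardinality
  have hset : charPrimes G = (({p1, p2, 2, r1, r2} : Finset ℕ) : Set ℕ) ∪ charPrimes R := by
    ext x
    simp only [Finset.coe_insert, Finset.coe_singleton, Set.mem_union, Set.mem_insert_iff, Set.mem_singleton_iff]
    constructor
    · intro hx
      obtain ⟨hxp, n, hn, hd⟩ := mem_cp.1 hx
      obtain ⟨a, b, ha, hb, rfl⟩ := (hD n).1 hn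
      rcases hxp.dvd_mul.1 hd with h | h
      · rcases ha with rfl | rfl | rfl | rfl
        · exact absurd (Nat.dvd_one.1 h) hxp.one_lt.ne'
        · rcases ar.ap x hxp h with h | h <;> tauto
        · have := ar.q2 x hxp h; tauto
        · rcases ar.ar x hxp h with h | h <;> tauto
      · exact .inr (mem_cp.2 ⟨hxp, b, hb, h⟩)
    · rintro ((rfl | rfl | rfl | rfl | rfl) | h)
      · exact mem_cp.2 ⟨ar.pp1, _, dm d1, ar.dp1.mul_right _⟩
      · exact mem_cp.2 ⟨ar.pp2, _, dm d1, ar.dp2.mul_right _⟩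
      · exact mem_cp.2 ⟨Nat.prime_two, _, dq d1, ar.two.mul_right _⟩
      · exact mem_cp.2 ⟨ar.pr1, _, dp d1, ar.dr1.mul_right _⟩
      · exact mem_cp.2 ⟨ar.pr2, _, dp d1, ar.dr2.mul_right _⟩
      · obtain ⟨hxp, n, hn, hd⟩ := mem_cp.1 h
        exact mem_cp.2 ⟨hxp, _, dm hn, hd.mul_left _⟩
  have hdis : Disjoint (({p1, p2, 2, r1, r2} : Finset ℕ) : Set ℕ) (charPrimes R) := by
    rw [Set.disjoint_left]
    intro x hx hxR
    simp only [Finset.coe_insert, Finset.coe_singleton, Set.mem_insert_iff, Set.mem_singleton_iff] at hx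
    rcases hx with rfl | rfl | rfl | rfl | rfl
    · exact n1 _ hxR ar.dp1
    · exact n1 _ hxR ar.dp2
    · exact p2R hxR
    · exact n2 _ hxR ar.dr1
    · exact n2 _ hxR ar.dr2
  have c5 : ({p1, p2, 2, r1, r2} : Finset ℕ).card = 5 := by
    have a1 := ar.npr ar.pp1 ar.dp1 ar.dr1
    have a2 := ar.npr ar.pp1 ar.dp1 ar.dr2
    have a3 := ar.npr ar.pp2 ar.dp2 ar.dr1
    have a4 := ar.npr ar.pp2 ar.dp2 ar.dr2
    have a5 := ar.np2 ar.dp1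
    have a6 := ar.np2 ar.dp2
    have a7 := (ar.nr2 ar.dr1).symm
    have a8 := (ar.nr2 ar.dr2).symm
    have a9 := ar.hp
    have a10 := ar.hr
    simp [*]
  have hfinG : (charPrimes G).Finite := Set.finite_of_ncard_ne_zero (by rw [← Nat.card_coe_set_eq, h7]; norm_num)
  have hfin : (charPrimes R).Finite := hfinG.subset (by rw [hset]; exact Set.subset_union_right)
  have hcard : (charPrimes R).ncard = 2 := by
    have := Set.ncard_union_eq hdis (Finset.finite_toSet _) hfin
    rw [← hset, ← Nat.card_coe_set_eq, h7, Set.ncard_coe_finset, c5] at this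
    omega
  refine ⟨by rw [Nat.card_coe_set_eq, hcard], ?_, ?_⟩
  · ext x y
    rw [adj_iff]
    simp only [SimpleGraph.bot_adj, iff_false]
    rintro ⟨hne, h⟩
    exact nRR x.2 y.2 hne (eRR h)
  obtain ⟨s1, s2, hs, hsR⟩ := Set.ncard_eq_two.1 hcard
  have hs1 : s1 ∈ charPrimes R := by rw [hsR]; simp
  have hs2 : s2 ∈ charPrimes R := by rw [hsR]; simp
  let P : Fin 2 → ℕ := ![p1, p2]
  let Q : Fin 2 → ℕ := ![r1, r2]
  let T : Fin 2 → ℕ := ![s1, s2]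
  have Pp : ∀ i, (P i).Prime := by intro i; fin_cases i; exacts [ar.pp1, ar.pp2]
  have Qp : ∀ i, (Q i).Prime := by intro i; fin_cases i; exacts [ar.pr1, ar.pr2]
  have Pd : ∀ i, P i ∣ q - 1 := by intro i; fin_cases i; exacts [ar.dp1, ar.dp2]
  have Qd : ∀ i, Q i ∣ q + 1 := by intro i; fin_cases i; exacts [ar.dr1, ar.dr2]
  have TR : ∀ i, T i ∈ charPrimes R := by intro i; fin_cases i; exacts [hs1, hs2]
  have Tp : ∀ i, (T i).Prime := fun i => (mem_cp.1 (TR i)).1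
  have PR : ∀ i, P i ∉ charPrimes R := fun i h => n1 _ h (Pd i)
  have QR : ∀ i, Q i ∉ charPrimes R := fun i h => n2 _ h (Qd i)
  have inj2 : ∀ {x y : ℕ}, x ≠ y → ∀ i j : Fin 2, (![x, y] : Fin 2 → ℕ) i = ![x, y] j ↔ i = j := by
    intro x y h i j
    fin_cases i <;> fin_cases j <;> simp [h, h.symm]
  have Pi : ∀ i j, P i = P j ↔ i = j := inj2 ar.hp
  have Qi : ∀ i j, Q i = Q j ↔ i = j := inj2 ar.hr
  have Ti : ∀ i j, T i = T j ↔ i = j := inj2 hs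
  have PQ : ∀ i j, P i ≠ Q j := fun i j => ar.npr (Pp i) (Pd i) (Qd j)
  have P2 : ∀ i, P i ≠ 2 := fun i => ar.np2 (Pd i)
  have Q2 : ∀ i, Q i ≠ 2 := fun i => ar.nr2 (Qd i)
  have PT : ∀ i j, P i ≠ T j := fun i j h => PR i (h ▸ TR j)
  have QT : ∀ i j, Q i ≠ T j := fun i j h => QR i (h ▸ TR j)
  have T2 : ∀ j, T j ≠ 2 := fun j h => p2R (h ▸ TR j)
  have hsub : ∀ x ∈ charPrimes R, x ∈ charPrimes G := by
    intro x hx; rw [hset]; exact .inr hx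
  let w : ((Fin 2 ⊕ Fin 1) ⊕ Fin 2) ⊕ Fin 2 → ℕ := Sum.elim (Sum.elim (Sum.elim P (fun _ => 2)) Q) T
  have wG : ∀ a, w a ∈ charPrimes G := by
    rintro (((i | i) | i) | i)
    · exact mem_cp.2 ⟨Pp i, _, dm d1, (Pd i).mul_right _⟩
    · exact mem_cp.2 ⟨Nat.prime_two, _, dq d1, ar.two.mul_right _⟩
    · exact mem_cp.2 ⟨Qp i, _, dp d1, (Qd i).mul_right _⟩
    · exact hsub _ (TR i)
  have winj : Function.Injective w := by
    rintro (((i | i) | i) | i) (((j | j) | j) | j) h <;>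
    simp only [w, Sum.elim_inl, Sum.elim_inr] at h
    · rw [(Pi i j).1 h]
    · exact absurd h (P2 i)
    · exact absurd h (PQ i j)
    · exact absurd h (PT i j)
    · exact absurd h.symm (P2 j)
    · rw [Subsingleton.elim i j]
    · exact absurd h.symm (Q2 j)
    · exact absurd h.symm (T2 j)
    · exact absurd h.symm (PQ j i)
    · exact absurd h (Q2 i)
    · rw [(Qi i j).1 h]
    · exact absurd h (QT i j)
    · exact absurd h.symm (PT j i)
    · exact absurd h (T2 i)
    · exact absurd h.symm (QT j i)
    · rw [(Ti i j).1 h]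
  let v : ((Fin 2 ⊕ Fin 1) ⊕ Fin 2) ⊕ Fin 2 → charPrimes G := fun a => ⟨w a, wG a⟩
  have vinj : Function.Injective v := fun a b h => winj (congrArg Subtype.val h)
  have : Finite ↥(charPrimes G) := hfinG
  have vbij : Function.Bijective v := by
    rw [Nat.bijective_iff_injective_and_card]
    exact ⟨vinj, by rw [h7]; simp⟩
  have P2' : ∀ i, ¬ EE G (P i) 2 := by
    intro i h
    rcases hS (Pp i) Nat.prime_two (PR i) p2R h with h | h | h
    · exact ar.np2 h.2 rfl
    · exact ar.d0 (Pp i) (Pd i) h.1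
    · exact ar.nr2 h.2 rfl
  have Q2' : ∀ i, ¬ EE G (Q i) 2 := by
    intro i h
    rcases hS (Qp i) Nat.prime_two (QR i) p2R h with h | h | h
    · exact ar.np2 h.2 rfl
    · exact ar.d1 (Qp i) (Qd i) h.1
    · exact ar.nr2 h.2 rfl
  have PQ' : ∀ i j, ¬ EE G (P i) (Q j) := by
    intro i j h
    rcases hS (Pp i) (Qp j) (PR i) (QR j) h with h | h | h
    · exact ar.d2 (Qp j) h.2 (Qd j)
    · exact ar.d0 (Pp i) (Pd i) h.1
    · exact ar.d2 (Pp i) (Pd i) h.1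
  have PP' : ∀ i j, P i ≠ P j → EE G (P i) (P j) := fun i j h =>
    .of (Pp i) (Pp j) h (dm d1) ((Pd i).mul_right _) ((Pd j).mul_right _)
  have QQ' : ∀ i j, Q i ≠ Q j → EE G (Q i) (Q j) := fun i j h =>
    .of (Qp i) (Qp j) h (dp d1) ((Qd i).mul_right _) ((Qd j).mul_right _)
  have PT' : ∀ i j, EE G (P i) (T j) := fun i j => em (Pp i) (Pd i) (TR j)
  have QT' : ∀ i j, EE G (Q i) (T j) := fun i j => ep (Qp i) (Qd i) (TR j)
  have T2' : ∀ j, EE G 2 (T j) := fun j => eq Nat.prime_two ar.two (TR j)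
  refine ⟨SimpleGraph.Iso.symm ⟨Equiv.ofBijective v vbij, ?_⟩⟩
  rintro (((i | i) | i) | i) (((j | j) | j) | j) <;>
  simp only [Equiv.ofBijective_apply, adj_iff, v, w, Sum.elim_inl, Sum.elim_inr, graphJoin, SimpleGraph.sup_adj, SimpleGraph.sum_adj,
    SimpleGraph.top_adj, SimpleGraph.bot_adj, Sum.isLeft_inl, Sum.isLeft_inr, ne_eq, not_true, not_false_iff, or_false, or_true, iff_true, iff_false,
    Bool.true_eq_false, Bool.false_eq_true, reduceCtorEq, Sum.inl.injEq, Sum.inr.injEq]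
  · rw [Pi]; exact ⟨fun h => h.1, fun h => ⟨h, PP' i j (by rwa [ne_eq, Pi])⟩⟩
  · exact fun h => P2' i h.2
  · exact fun h => PQ' i j h.2
  · exact ⟨PT i j, PT' i j⟩
  · exact fun h => P2' j h.2.symm
  · simp [Subsingleton.elim i j]
  · exact fun h => Q2' j h.2.symm
  · exact ⟨(T2 j).symm, T2' j⟩
  · exact fun h => PQ' j i h.2.symm
  · exact fun h => Q2' i h.2
  · rw [Qi]; exact ⟨fun h => h.1, fun h => ⟨h, QQ' i j (by rwa [ne_eq, Qi])⟩⟩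
  · exact ⟨QT i j, QT' i j⟩
  · exact ⟨(PT j i).symm, (PT' j i).symm⟩
  · exact ⟨T2 i, (T2' i).symm⟩
  · exact ⟨(QT j i).symm, (QT' j i).symm⟩
  · exact fun h => nRR (TR i) (TR j) h.1 h.2
end ModK6

theorem stmt12 (G : Type) [Group G] [Finite G]
    (h4 : (charGraph G).CliqueFree 4)
    (h7 : Nat.card ↥(charPrimes G) = 7)
    (M : Subgroup G) (hM : M.Normal) (hRM : solvableRadical G < M)
    (f : ℕ) (hf : 2 ≤ f)
    (hS : Nonempty (↥(radicalQuotImage M) ≃* PSL2 (GaloisField 2 f)))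
    (hcent : Subgroup.centralizer ((radicalQuotImage M) : Set (G ⧸ solvableRadical G)) = ⊥)
    (hbip : ¬ (((charGraph G).induce
      {x : ↥(charPrimes G) | (x : ℕ) ∈ (Nat.card ↥(radicalQuotImage M)).primeFactors})ᶜ).Colorable 2)
    (hm : (2 ^ f - 1).primeFactors.card = 2)
    (hp : (2 ^ f + 1).primeFactors.card = 2) :
    (f = 6 ∨ f = 9 ∨ f.Prime) ∧
    Nonempty (G ≃* ↥(radicalQuotImage M) × ↥(solvableRadical G)) ∧
    Nat.card ↥(charPrimes ↥(solvableRadical G)) = 2 ∧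
    charGraph ↥(solvableRadical G) = ⊥ ∧
    Nonempty (charGraph G ≃g
      graphJoin (((⊤ : SimpleGraph (Fin 2)) ⊕g (⊤ : SimpleGraph (Fin 1))) ⊕g (⊤ : SimpleGraph (Fin 2))) (⊥ : SimpleGraph (Fin 2))) := by
  classical
  have hf3 := nt_three_le hf hm
  have hf0 : f ≠ 0 := by omega
  have hnt := nt_main hf hm hp
  have hq : Nat.card (GaloisField 2 f) = 2 ^ f := GaloisField.card 2 f hf0
  have h8' : 8 ≤ 2 ^ f := by
    calc 8 = 2 ^ 3 := by norm_num
      _ ≤ 2 ^ f := Nat.pow_le_pow_right (by norm_num) hf3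
  have : Finite (GaloisField 2 f) := Nat.finite_of_card_ne_zero (by rw [hq]; omega)
  set q := Nat.card (GaloisField 2 f) with hqd
  have h8 : 8 ≤ q := by rw [hq]; exact h8'
  obtain ⟨p1, p2, hp12, hpe⟩ := Finset.card_eq_two.1 hm
  obtain ⟨r1, r2, hr12, hre⟩ := Finset.card_eq_two.1 hp
  rw [← hq] at hpe hre
  have hpm : ∀ x, (x.Prime ∧ x ∣ q - 1) ↔ x = p1 ∨ x = p2 := by
    intro x
    have : x ∈ (q - 1).primeFactors ↔ x ∈ ({p1, p2} : Finset ℕ) := by rw [hpe]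
    rw [Nat.mem_primeFactors] at this
    simp only [Finset.mem_insert, Finset.mem_singleton] at this
    rw [← this]
    exact ⟨fun h => ⟨h.1, h.2, by omega⟩, fun h => ⟨h.1, h.2.1⟩⟩
  have hrm : ∀ x, (x.Prime ∧ x ∣ q + 1) ↔ x = r1 ∨ x = r2 := by
    intro x
    have : x ∈ (q + 1).primeFactors ↔ x ∈ ({r1, r2} : Finset ℕ) := by rw [hre]
    rw [Nat.mem_primeFactors] at this
    simp only [Finset.mem_insert, Finset.mem_singleton] at this
    rw [← this]
    exact ⟨fun h => ⟨h.1, h.2, by omega⟩, fun h => ⟨h.1, h.2.1⟩⟩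
  have ar : Ar q p1 p2 r1 r2 :=
    { h8 := h8
      two := by rw [hq]; exact dvd_pow_self 2 hf0
      q2 := fun x hx h => by
        rw [hq] at h
        exact (Nat.prime_dvd_prime_iff_eq hx Nat.prime_two).1 (hx.dvd_of_dvd_pow h)
      pp1 := ((hpm p1).2 (.inl rfl)).1
      pp2 := ((hpm p2).2 (.inr rfl)).1
      pr1 := ((hrm r1).2 (.inl rfl)).1
      pr2 := ((hrm r2).2 (.inr rfl)).1
      hp := hp12
      hr := hr12
      dp1 := ((hpm p1).2 (.inl rfl)).2
      dp2 := ((hpm p2).2 (.inr rfl)).2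
      dr1 := ((hrm r1).2 (.inl rfl)).2
      dr2 := ((hrm r2).2 (.inr rfl)).2
      ap := fun x hx h => (hpm x).1 ⟨hx, h⟩
      ar := fun x hx h => (hrm x).1 ⟨hx, h⟩ }
  obtain ⟨ε1⟩ := hS
  obtain ⟨ε2⟩ := psl_equiv (GaloisField 2 f)
  let ε : radicalQuotImage M ≃* SL (GaloisField 2 f) := ε1.trans ε2
  have hcS : Nat.card (radicalQuotImage M) = (q + 1) * (q * (q - 1)) := by
    rw [Nat.card_congr ε.toEquiv, SL_card]
  have hnorm : (radicalQuotImage M).Normal :=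
    Subgroup.Normal.map hM _ (QuotientGroup.mk'_surjective _)
  have lift : ∀ {n}, Deg (SL (GaloisField 2 f)) n → ∃ m, Deg G m ∧ n ∣ m := by
    intro n hn
    obtain ⟨m, hm, hd⟩ := (hn.surj ε.toMonoidHom ε.surjective).over
    exact ⟨m, hm.surj (QuotientGroup.mk' (solvableRadical G)) (QuotientGroup.mk'_surjective _), hd⟩
  have epp : EE G p1 p2 := by
    obtain ⟨m, hm, hd⟩ := lift (deg_q_sub (F := GaloisField 2 f) h8)
    exact .of ar.pp1 ar.pp2 ar.hp hm (ar.dp1.trans hd) (ar.dp2.trans hd)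
  have err : EE G r1 r2 := by
    obtain ⟨m, hm, hd⟩ := lift (deg_q_add (F := GaloisField 2 f) h8)
    exact .of ar.pr1 ar.pr2 ar.hr hm (ar.dr1.trans hd) (ar.dr2.trans hd)
  have hpr : ∀ x : ℕ, x ∈ (Nat.card (radicalQuotImage M)).primeFactors → x = 2 ∨ x = p1 ∨ x = p2 ∨ x = r1 ∨ x = r2 := by
    intro x hx
    have hxp := Nat.prime_of_mem_primeFactors hx
    have hd := Nat.dvd_of_mem_primeFactors hx
    rw [hcS] at hd
    rcases hxp.dvd_mul.1 hd with h | h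
    · have := ar.ar x hxp h; tauto
    · rcases hxp.dvd_mul.1 h with h | h
      · have := ar.q2 x hxp h; tauto
      · have := ar.ap x hxp h; tauto
  have colour : ∀ A : ℕ → Prop,
      (∀ x y : ℕ, x ≠ y → x.Prime → y.Prime → (x = 2 ∨ x = p1 ∨ x = p2 ∨ x = r1 ∨ x = r2) → (y = 2 ∨ y = p1 ∨ y = p2 ∨ y = r1 ∨ y = r2) →
        (A x ↔ A y) → EE G x y) → False := by
    intro A hA
    apply hbip
    refine ⟨SimpleGraph.Coloring.mk (fun x => if A (x.1 : ℕ) then (0 : Fin 2) else 1) ?_⟩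
    intro x y hxy hc
    rw [SimpleGraph.compl_adj] at hxy
    have hne : ((x.1 : charPrimes G) : ℕ) ≠ (y.1 : charPrimes G) := fun h => hxy.1 (Subtype.ext (Subtype.ext h))
    refine hxy.2 ?_
    rw [SimpleGraph.comap_adj]
    refine (adj_iff _ _).2 ⟨hne, hA _ _ hne (mem_cp.1 x.1.2).1 (mem_cp.1 y.1.2).1 (hpr _ x.2) (hpr _ y.2) ?_⟩
    by_cases h1 : A (x.1 : ℕ) <;> by_cases h2 : A (y.1 : ℕ) <;> simp [h1, h2] at hc ⊢
  have P2 := ar.np2 ar.dp1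
  have P2b := ar.np2 ar.dp2
  have R2 := ar.nr2 ar.dr1
  have R2b := ar.nr2 ar.dr2
  have PR1 := ar.npr ar.pp1 ar.dp1 ar.dr1
  have PR2 := ar.npr ar.pp1 ar.dp1 ar.dr2
  have PR3 := ar.npr ar.pp2 ar.dp2 ar.dr1
  have PR4 := ar.npr ar.pp2 ar.dp2 ar.dr2
  have hd2 : ∀ n, Deg G n → 2 ∣ n → (∃ p, p.Prime ∧ p ∣ q - 1 ∧ ¬ p ∣ n) ∧ (∃ r, r.Prime ∧ r ∣ q + 1 ∧ ¬ r ∣ n) := by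
    intro n hn h2
    constructor
    · by_contra! hcon
      have k1 := hcon p1 ar.pp1 ar.dp1
      have k2 := hcon p2 ar.pp2 ar.dp2
      refine colour (fun x => x = r1 ∨ x = r2) ?_
      intro x y hxy hx hy hx5 hy5 hA
      by_cases hc : x = r1 ∨ x = r2
      · have hc2 := hA.1 hc
        rcases hc with rfl | rfl <;> rcases hc2 with rfl | rfl
        · exact absurd rfl hxy
        · exact err
        · exact err.symm
        · exact absurd rfl hxy
      · have hc2 : ¬ (y = r1 ∨ y = r2) := fun h => hc (hA.2 h)
        have hxn : x ∣ n := by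
          rcases hx5 with rfl | rfl | rfl | h | h
          exacts [h2, k1, k2, absurd (.inl h) hc, absurd (.inr h) hc]
        have hyn : y ∣ n := by
          rcases hy5 with rfl | rfl | rfl | h | h
          exacts [h2, k1, k2, absurd (.inl h) hc2, absurd (.inr h) hc2]
        exact .of hx hy hxy hn hxn hyn
    · by_contra! hcon
      have k1 := hcon r1 ar.pr1 ar.dr1
      have k2 := hcon r2 ar.pr2 ar.dr2
      refine colour (fun x => x = p1 ∨ x = p2) ?_
      intro x y hxy hx hy hx5 hy5 hA
      by_cases hc : x = p1 ∨ x = p2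
      · have hc2 := hA.1 hc
        rcases hc with rfl | rfl <;> rcases hc2 with rfl | rfl
        · exact absurd rfl hxy
        · exact epp
        · exact epp.symm
        · exact absurd rfl hxy
      · have hc2 : ¬ (y = p1 ∨ y = p2) := fun h => hc (hA.2 h)
        have hxn : x ∣ n := by
          rcases hx5 with rfl | h | h | rfl | rfl
          exacts [h2, absurd (.inl h) hc, absurd (.inr h) hc, k1, k2]
        have hyn : y ∣ n := by
          rcases hy5 with rfl | h | h | rfl | rfl
          exacts [h2, absurd (.inl h) hc2, absurd (.inr h) hc2, k1, k2]
        exact .of hx hy hxy hn hxn hyn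
  have hd1 : ∀ n, Deg G n → ¬ (q + 1) * (q - 1) ∣ n := by
    intro n hn hd
    have e1 : q + 1 ∣ n := (Dvd.intro _ rfl).trans hd
    have e2 : q - 1 ∣ n := (Dvd.intro_left _ rfl).trans hd
    exact noK4' h4 ar.pp1 ar.pp2 ar.pr1 ar.pr2 hp12 PR1 PR2 PR3 PR4 hr12 hn (ar.dp1.trans e2) (ar.dp2.trans e2) (ar.dr1.trans e1) (ar.dr2.trans e1)
  obtain ⟨K, hK, hKR, hKM, ⟨e⟩⟩ := setup (F := GaloisField 2 f) h8 M hM hRM.le ε hd2 hd1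
  have hmapR : (solvableRadical G).map (QuotientGroup.mk' (solvableRadical G)) = ⊥ := by
    rw [Subgroup.map_eq_bot_iff, QuotientGroup.ker_mk']
  have hmap : K.map (QuotientGroup.mk' (solvableRadical G)) = radicalQuotImage M := by
    change _ = M.map _
    rw [← hKM, Subgroup.map_sup, hmapR, sup_bot_eq]
  have hC : Subgroup.centralizer (K : Set G) = solvableRadical G := by
    apply le_antisymm
    · intro g hg
      have h1 : (QuotientGroup.mk' (solvableRadical G) g) ∈ Subgroup.centralizer ((radicalQuotImage M) : Set (G ⧸ solvableRadical G)) := by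
        rw [Subgroup.mem_centralizer_iff, ← hmap]
        rintro _ ⟨k, hk, rfl⟩
        rw [← map_mul, ← map_mul, (Subgroup.mem_centralizer_iff.1 hg) k hk]
      rw [hcent, Subgroup.mem_bot] at h1
      exact (QuotientGroup.eq_one_iff g).1 h1
    · intro g hg
      rw [Subgroup.mem_centralizer_iff]
      intro k hk
      exact Subgroup.commute_of_normal_of_disjoint K _ hK inferInstance (disjoint_iff.2 hKR) k g hk hg
  have hcyc := ringaut_cyclic f
  have hra := ringaut_card hf0
  obtain ⟨s0, hs0⟩ := nt_pi hnt
  have hex : ∃ t ∈ charPrimes G, t ∉ ({2, p1, p2, r1, r2, s0} : Finset ℕ) := by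
    by_contra! hcon
    have h1 : charPrimes G ⊆ (({2, p1, p2, r1, r2, s0} : Finset ℕ) : Set ℕ) := fun x hx => hcon x hx
    have h2 := Set.ncard_le_ncard h1 (Finset.finite_toSet _)
    rw [← Nat.card_coe_set_eq, h7, Set.ncard_coe_finset] at h2
    have h3 : ({2, p1, p2, r1, r2, s0} : Finset ℕ).card ≤ 6 := Finset.card_le_six
    omega
  obtain ⟨t, htG, htn⟩ := hex
  simp only [Finset.mem_insert, Finset.mem_singleton, not_or] at htn
  obtain ⟨nt2, ntp1, ntp2, ntr1, ntr2, nts⟩ := htn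
  obtain ⟨ht, n, hn, htdn⟩ := mem_cp.1 htG
  have t0 : ¬ t ∣ q := fun h => nt2 (ar.q2 t ht h)
  have t1 : ¬ t ∣ q - 1 := fun h => by rcases ar.ap t ht h with h | h <;> contradiction
  have t2 : ¬ t ∣ q + 1 := fun h => by rcases ar.ar t ht h with h | h <;> contradiction
  have tf : ¬ t ∣ f := by
    intro h
    rcases hs0 t ht h with h | h | h | h
    · exact nts h
    · exact nt2 h
    · rw [← hq] at h; exact t1 h
    · rw [← hq] at h; exact t2 h
  obtain ⟨b, hb, htb⟩ := deg_C (F := GaloisField 2 f) h8 hcyc e hC hKR ht hn htdn (by rwa [hra]) t0 t1 t2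
  have htop : K ⊔ solvableRadical G = ⊤ := by
    refine top_of (F := GaloisField 2 f) h8 hcyc e hC hKR hb htb ?_
    intro n p hn hpp hpf hpn htn
    rw [hra] at hpf
    have hpt : p ≠ t := by rintro rfl; exact tf hpf
    constructor
    · intro hd
      by_contra hcon
      exact noK4' h4 hpp ht ar.pp1 ar.pp2 hpt (by rintro rfl; exact hcon ar.dp1) (by rintro rfl; exact hcon ar.dp2) ntp1 ntp2 hp12 hn
        hpn htn (ar.dp1.trans hd) (ar.dp2.trans hd)
    · intro hd
      by_contra hcon
      exact noK4' h4 hpp ht ar.pr1 ar.pr2 hpt (by rintro rfl; exact hcon ar.dr1) (by rintro rfl; exact hcon ar.dr2) ntr1 ntr2 hr12 hn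
        hpn htn (ar.dr1.trans hd) (ar.dr2.trans hd)
  obtain ⟨ψ, -⟩ := prod_equiv K (solvableRadical G) hKR
  let Ψ : K × solvableRadical G ≃* G := ψ.trans ((MulEquiv.subgroupCongr htop).trans Subgroup.topEquiv)
  have hDK : ∀ a, Deg K a ↔ (a = 1 ∨ a = q - 1 ∨ a = q ∨ a = q + 1) := by
    intro a
    constructor
    · intro h
      exact deg_SL (F := GaloisField 2 f) (by omega) (h.surj e.symm.toMonoidHom e.symm.surjective)
    · rintro (rfl | rfl | rfl | rfl)
      · exact Deg.one K
      · exact (deg_q_sub (F := GaloisField 2 f) h8).surj e.toMonoidHom e.surjective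
      · exact (exists_q (F := GaloisField 2 f) (by omega)).surj e.toMonoidHom e.surjective
      · exact (deg_q_add (F := GaloisField 2 f) h8).surj e.toMonoidHom e.surjective
  have hD : ∀ n, Deg G n ↔ ∃ a b, (a = 1 ∨ a = q - 1 ∨ a = q ∨ a = q + 1) ∧ Deg (solvableRadical G) b ∧ n = a * b := by
    intro n
    constructor
    · intro h
      obtain ⟨a, b, ha, hb, hab⟩ := (h.surj Ψ.toMonoidHom Ψ.surjective).of_prod
      exact ⟨a, b, (hDK a).1 ha, hb, hab⟩
    · rintro ⟨a, b, ha, hb, rfl⟩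
      exact (((hDK a).2 ha).prod hb).surj Ψ.symm.toMonoidHom Ψ.symm.surjective
  obtain ⟨c1, c2, c3⟩ := final_graph h4 h7 ar hD ht hb htb t0 t1 t2
  exact ⟨hnt, ⟨Ψ.symm.trans (MulEquiv.prodCongr (e.trans ε.symm) (MulEquiv.refl _))⟩, c1, c2, c3⟩
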